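/- Let 2 < p ≤ ∞ and let f be a continuous function on an open subset Ω of ℂⁿ. Assume there is a constant M such that for each j = 1,…,n and every complex line L parallel to the z_j-axis, ∂̄(f|_L) = A_L f holds in the distribution sense on L ∩ Ω with ‖A_L‖_{L^p(L∩Ω)} ≤ M. Then f⁻¹(0) is a complex variety in Ω. Moreover, every point of Ω has a neighborhood on which e^{−u} f is holomorphic for some function u of class C^α, with α = 1 − 2/p when 2 < p < ∞, and with any α < 1 when p = ∞. -/

import Mathlib

open MeasureTheory Metric Set

noncomputable section

/-- The Wirtinger derivative `∂φ/∂z̄` of a function `φ : ℂ → ℂ`. -/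
def dbar1 (φ : ℂ → ℂ) (z : ℂ) : ℂ :=
  (1 / 2 : ℂ) * (fderiv ℝ φ z 1 + Complex.I * fderiv ℝ φ z Complex.I)

/-- A test function on `U ⊆ ℂ`: smooth, compactly supported, with support in `U`. -/
def IsTest1 (U : Set ℂ) (φ : ℂ → ℂ) : Prop :=
  ContDiff ℝ (⊤ : ℕ∞) φ ∧ HasCompactSupport φ ∧ tsupport φ ⊆ U

/-- `∂g/∂z̄ = A g` in the distribution sense on `U ⊆ ℂ`. -/
def DbarEq1On (U : Set ℂ) (g A : ℂ → ℂ) : Prop :=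
  ∀ φ : ℂ → ℂ, IsTest1 U φ →
    ∫ z in U, g z * dbar1 φ z = - ∫ z in U, A z * g z * φ z

/-- Condition (L) for the complex line through `c` parallel to the `z_j`-axis:
`∂̄(f|_L) = A_L f` holds in the distribution sense on `L ∩ Ω`, for some `A_L`
with `‖A_L‖_{L^p(L ∩ Ω)} ≤ M`.  The line is parametrized by
`ζ ↦ Function.update c j ζ`. -/
def CondL (n : ℕ) (Ω : Set (Fin n → ℂ)) (f : (Fin n → ℂ) → ℂ) (p : ENNReal) (M : ℝ)
    (j : Fin n) (c : Fin n → ℂ) : Prop :=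
  ∃ A : ℂ → ℂ,
    eLpNorm A p (volume.restrict {ζ : ℂ | Function.update c j ζ ∈ Ω}) ≤ ENNReal.ofReal M ∧
    DbarEq1On {ζ : ℂ | Function.update c j ζ ∈ Ω}
      (fun ζ => f (Function.update c j ζ)) A

/-- `V` is a complex variety in the open set `Ω ⊆ ℂⁿ`. -/
def IsComplexVarietyIn (n : ℕ) (V Ω : Set (Fin n → ℂ)) : Prop :=
  ∀ z ∈ Ω, ∃ U : Set (Fin n → ℂ), IsOpen U ∧ z ∈ U ∧ U ⊆ Ω ∧
    ∃ (ι : Type) (g : ι → (Fin n → ℂ) → ℂ),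
      (∀ i, DifferentiableOn ℂ (g i) U) ∧
      V ∩ U = {w ∈ U | ∀ i, g i w = 0}

/-- `u` is locally Hölder continuous of exponent `α` on `U`. -/
def HolderLocOn {E : Type*} [NormedAddCommGroup E] (α : ℝ) (u : E → ℂ) (U : Set E) : Prop :=
  ∀ x ∈ U, ∃ t : Set E, IsOpen t ∧ x ∈ t ∧
    ∃ C : ℝ, ∀ a ∈ t ∩ U, ∀ b ∈ t ∩ U, ‖u a - u b‖ ≤ C * dist a b ^ α

section


/-- rotated unit vector -/
def eit (θ : ℝ) : ℂ := (Real.cos θ : ℂ) + (Real.sin θ : ℂ) * Complex.I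

lemma eit_continuous : Continuous eit := by unfold eit; fun_prop

lemma norm_eit (θ : ℝ) : ‖eit θ‖ = 1 := by
  have : eit θ = Complex.exp (θ * Complex.I) := by
    rw [Complex.exp_mul_I]; simp [eit]
  rw [this, Complex.norm_exp_ofReal_mul_I]

lemma eit_hasDerivAt (θ : ℝ) : HasDerivAt eit (Complex.I * eit θ) θ := by
  have h1 := (Real.hasDerivAt_cos θ).ofReal_comp
  have h2 := ((Real.hasDerivAt_sin θ).ofReal_comp).mul_const Complex.I
  have := h1.add h2
  refine (this.congr_deriv ?_)
  simp only [eit]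
  push_cast
  linear_combination (- (Complex.sin θ)) * Complex.I_mul_I

lemma clm_complex (L : ℂ →L[ℝ] ℂ) (w : ℂ) : L w = w.re * L 1 + w.im * L Complex.I := by
  conv_lhs => rw [← Complex.re_add_im w]
  rw [map_add]
  have h1 : ((w.re : ℝ) : ℂ) = (w.re : ℝ) • (1 : ℂ) := by simp
  have h2 : ((w.im : ℝ) : ℂ) * Complex.I = (w.im : ℝ) • Complex.I := by simp
  rw [h1, h2, map_smul, map_smul]; simp

lemma polar_alg (L : ℂ →L[ℝ] ℂ) (θ : ℝ) :
    (L 1 + Complex.I * L Complex.I) * (eit θ)⁻¹ = L (eit θ) + Complex.I * L (Complex.I * eit θ) := by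
  have hne : eit θ ≠ 0 := by
    intro h; have := norm_eit θ; rw [h] at this; simp at this
  rw [mul_inv_eq_iff_eq_mul₀ hne, clm_complex L (eit θ), clm_complex L (Complex.I * eit θ)]
  have h1 : (eit θ).re = Real.cos θ := by simp [eit, ← Complex.ofReal_cos, ← Complex.ofReal_sin, -Complex.ofReal_cos, -Complex.ofReal_sin]
  have h2 : (eit θ).im = Real.sin θ := by simp [eit, ← Complex.ofReal_cos, ← Complex.ofReal_sin, -Complex.ofReal_cos, -Complex.ofReal_sin]
  have h3 : (Complex.I * eit θ).re = -Real.sin θ := by simp [eit, ← Complex.ofReal_cos, ← Complex.ofReal_sin, -Complex.ofReal_cos, -Complex.ofReal_sin]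
  have h4 : (Complex.I * eit θ).im = Real.cos θ := by simp [eit, ← Complex.ofReal_cos, ← Complex.ofReal_sin, -Complex.ofReal_cos, -Complex.ofReal_sin]
  rw [h1, h2, h3, h4]
  have h5 : (Complex.cos θ)^2 + (Complex.sin θ)^2 = 1 := Complex.cos_sq_add_sin_sq _
  simp only [eit]
  push_cast
  have hI := Complex.I_mul_I
  linear_combination (-(L 1) - Complex.I * L Complex.I) * h5 + (Complex.sin θ * Complex.sin θ * L 1 - Complex.cos θ * Complex.sin θ * L Complex.I) * hI

lemma cauchy_pompeiu_zero (ψ : ℂ → ℂ) (hψ : ContDiff ℝ (⊤ : ℕ∞) ψ) (hc : HasCompactSupport ψ) :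
    ∫ ζ, dbar1 ψ ζ * ζ⁻¹ = - (Real.pi : ℂ) * ψ 0 := by
  have hfd : Continuous (fderiv ℝ ψ) := hψ.continuous_fderiv (by simp)
  have hdiff : Differentiable ℝ ψ := hψ.differentiable (by simp)
  obtain ⟨R, hR0, hR⟩ : ∃ R : ℝ, 0 < R ∧ ∀ z, R ≤ ‖z‖ → ψ z = 0 ∧ fderiv ℝ ψ z = 0 := by
    obtain ⟨R, hR0, hR⟩ := hc.isCompact.isBounded.subset_ball_lt 0 0
    refine ⟨R, hR0, fun z hz => ?_⟩
    have : z ∉ tsupport ψ := fun h => by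
      have := hR h
      rw [mem_ball_zero_iff] at this; linarith
    exact ⟨image_eq_zero_of_notMem_tsupport this,
      image_eq_zero_of_notMem_tsupport (fun h => this (tsupport_fderiv_subset ℝ h))⟩
  rw [← Complex.integral_comp_polarCoord_symm, polarCoord_target]
  set a : ℝ × ℝ → ℂ := fun p => fderiv ℝ ψ (p.1 * eit p.2) (eit p.2) with ha
  set b : ℝ × ℝ → ℂ := fun p => fderiv ℝ ψ (p.1 * eit p.2) (Complex.I * eit p.2) with hb
  have hac : Continuous a := by
    have := eit_continuous
    rw [ha]; fun_prop
  have hbc : Continuous b := by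
    have := eit_continuous
    rw [hb]; fun_prop
  have hsupp : ∀ p : ℝ × ℝ, R ≤ p.1 → a p = 0 ∧ b p = 0 := by
    intro p hp
    have : R ≤ ‖(p.1 : ℂ) * eit p.2‖ := by
      rw [norm_mul, norm_eit, mul_one, Complex.norm_real]; exact hp.trans (le_abs_self _)
    simp [ha, hb, (hR _ this).2]
  have hintg : ∀ c : ℝ × ℝ → ℂ, Continuous c → (∀ p, R ≤ p.1 → c p = 0) →
      IntegrableOn c (Ioi 0 ×ˢ Ioo (-Real.pi) Real.pi) (volume.prod volume) := by
    intro c hcc hcs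
    have h1 : IntegrableOn c (Icc 0 R ×ˢ Icc (-Real.pi) Real.pi) :=
      hcc.continuousOn.integrableOn_compact (isCompact_Icc.prod isCompact_Icc)
    rw [← Measure.volume_eq_prod]
    refine IntegrableOn.of_forall_sdiff_eq_zero h1 (measurableSet_Ioi.prod measurableSet_Ioo) ?_
    rintro ⟨r, θ⟩ ⟨⟨h2, h3⟩, h4⟩
    apply hcs
    by_contra h5
    push Not at h5
    exact h4 ⟨⟨(le_of_lt h2), h5.le⟩, ⟨h3.1.le, h3.2.le⟩⟩
  have hia := hintg a hac (fun p hp => (hsupp p hp).1)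
  have hib := hintg b hbc (fun p hp => (hsupp p hp).2)
  have step : ∀ p ∈ Ioi (0:ℝ) ×ˢ Ioo (-Real.pi) Real.pi,
      p.1 • (dbar1 ψ (Complex.polarCoord.symm p) * (Complex.polarCoord.symm p)⁻¹)
        = (1/2 : ℂ) * (a p + Complex.I * b p) := by
    rintro ⟨r, θ⟩ ⟨hr, -⟩
    have hr' : (r : ℂ) ≠ 0 := by
      simp only [mem_Ioi] at hr; exact_mod_cast hr.ne'
    have hs : Complex.polarCoord.symm (r, θ) = (r : ℂ) * eit θ := by
      rw [Complex.polarCoord_symm_apply]; rfl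
    rw [hs]
    simp only [ha, hb, dbar1]
    rw [← polar_alg, mul_inv, Complex.real_smul]
    field_simp
  rw [setIntegral_congr_fun (measurableSet_Ioi.prod measurableSet_Ioo) step]
  rw [integral_const_mul, Measure.volume_eq_prod, integral_add hia (hib.const_mul _),
    integral_const_mul]
  have I1 : ∫ p in Ioi (0:ℝ) ×ˢ Ioo (-Real.pi) Real.pi, a p ∂(volume.prod volume)
      = - (2 * Real.pi : ℂ) * ψ 0 := by
    rw [← setIntegral_prod_swap, setIntegral_prod]
    · have : ∀ θ ∈ Ioo (-Real.pi) Real.pi,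
          ∫ r in Ioi (0:ℝ), a (Prod.swap (θ, r)) = - ψ 0 := by
        intro θ _
        have hd : ∀ r ∈ Ici (0:ℝ), HasDerivAt (fun r : ℝ => ψ (r * eit θ)) (a (r, θ)) r := by
          intro r _
          have h1 : HasDerivAt (fun r : ℝ => (r : ℂ) * eit θ) (eit θ) r := by
            simpa using (Complex.ofRealCLM.hasDerivAt (x := r)).mul_const (eit θ)
          exact (hdiff _).hasFDerivAt.comp_hasDerivAt r h1
        have hio : IntegrableOn (fun r => a (r, θ)) (Ioi 0) := by
          have h1 : IntegrableOn (fun r => a (r, θ)) (Icc 0 R) :=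
            (by fun_prop : Continuous fun r => a (r, θ)).continuousOn.integrableOn_compact isCompact_Icc
          refine IntegrableOn.of_forall_sdiff_eq_zero h1 measurableSet_Ioi ?_
          rintro r ⟨h2, h4⟩
          apply (hsupp _ _).1
          by_contra h5
          push Not at h5
          exact h4 ⟨(le_of_lt h2), h5.le⟩
        have ht : Filter.Tendsto (fun r : ℝ => ψ (r * eit θ)) Filter.atTop (nhds 0) := by
          refine tendsto_const_nhds.congr' ?_
          filter_upwards [Filter.eventually_ge_atTop R] with r hr
          have : R ≤ ‖(r : ℂ) * eit θ‖ := by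
            rw [norm_mul, norm_eit, mul_one, Complex.norm_real]; exact hr.trans (le_abs_self _)
          exact (hR _ this).1.symm
        have := integral_Ioi_of_hasDerivAt_of_tendsto' hd hio ht
        simpa using this
      rw [setIntegral_congr_fun measurableSet_Ioo this]
      simp [Real.pi_pos.le]
      ring_nf
      simp
    · exact hia.swap
  have I2 : ∫ p in Ioi (0:ℝ) ×ˢ Ioo (-Real.pi) Real.pi, b p ∂(volume.prod volume) = 0 := by
    rw [setIntegral_prod _ hib]
    have : ∀ r ∈ Ioi (0:ℝ), ∫ θ in Ioo (-Real.pi) Real.pi, b (r, θ) = 0 := by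
      intro r hr
      simp only [mem_Ioi] at hr
      have hd : ∀ θ ∈ uIcc (-Real.pi) Real.pi,
          HasDerivAt (fun θ : ℝ => ψ (r * eit θ)) (r * b (r, θ)) θ := by
        intro θ _
        have h1 : HasDerivAt (fun θ : ℝ => (r : ℂ) * eit θ) (r * (Complex.I * eit θ)) θ :=
          (eit_hasDerivAt θ).const_mul _
        have := (hdiff _).hasFDerivAt.comp_hasDerivAt θ h1
        refine this.congr_deriv ?_
        have : (r : ℂ) * (Complex.I * eit θ) = (r : ℝ) • (Complex.I * eit θ) := by simp
        rw [this, map_smul]; simp [hb]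
      have h2 := intervalIntegral.integral_eq_sub_of_hasDerivAt hd
        ((by fun_prop : Continuous fun θ => (r : ℂ) * b (r, θ)).intervalIntegrable _ _)
      rw [intervalIntegral.integral_const_mul] at h2
      have h3 : eit Real.pi = eit (-Real.pi) := by simp [eit]
      rw [h3, sub_self] at h2
      have h4 : ∫ θ in (-Real.pi)..Real.pi, b (r, θ) = 0 := by
        rcases mul_eq_zero.mp h2 with h | h
        · exact absurd (by exact_mod_cast h) hr.ne'
        · exact h
      rw [intervalIntegral.integral_of_le (by linarith [Real.pi_pos]), integral_Ioc_eq_integral_Ioo] at h4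
      exact h4
    rw [setIntegral_congr_fun measurableSet_Ioi this]; simp
  rw [I1, I2]; ring

lemma dbar1_comp_sub (φ : ℂ → ℂ) (hφ : Differentiable ℝ φ) (z ζ : ℂ) :
    dbar1 (fun ζ => φ (z - ζ)) ζ = - dbar1 φ (z - ζ) := by
  have h1 : HasFDerivAt (fun ζ : ℂ => z - ζ) (-ContinuousLinearMap.id ℝ ℂ) ζ :=
    (hasFDerivAt_id ζ).const_sub z
  have : fderiv ℝ (fun ζ => φ (z - ζ)) ζ = - fderiv ℝ φ (z - ζ) := by
    have h2 : HasFDerivAt (fun ζ => φ (z - ζ)) _ ζ := (hφ (z - ζ)).hasFDerivAt.comp ζ h1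
    rw [h2.fderiv]
    ext <;> simp
  simp only [dbar1]
  rw [this]; simp; ring

lemma cauchy_pompeiu (φ : ℂ → ℂ) (hφ : ContDiff ℝ (⊤ : ℕ∞) φ) (hc : HasCompactSupport φ) (z : ℂ) :
    ∫ ζ, dbar1 φ (z - ζ) * ζ⁻¹ = (Real.pi : ℂ) * φ z := by
  have h1 := cauchy_pompeiu_zero (fun ζ => φ (z - ζ)) (hφ.comp (contDiff_const.sub contDiff_id))
    (hc.comp_homeomorph (Homeomorph.subLeft z))
  simp only [dbar1_comp_sub φ (hφ.differentiable (by simp)), sub_zero, neg_mul, integral_neg] at h1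
  exact neg_injective h1

end

section


/-- the two point kernel -/
def ker2 (a b ζ : ℂ) : ENNReal := ‖a - ζ‖ₑ⁻¹ * ‖b - ζ‖ₑ⁻¹

lemma ker2_measurable (a b : ℂ) : Measurable (ker2 a b) := by
  unfold ker2; fun_prop

lemma lintegral_affine (a d : ℂ) (hd : d ≠ 0) (f : ℂ → ENNReal) (hf : Measurable f) :
    ∫⁻ ζ, f ζ = ‖d‖ₑ ^ 2 * ∫⁻ w, f (a + d * w) := by
  have hdet : LinearMap.det (Algebra.lmul ℝ ℂ d) = Complex.normSq d := by
    rw [← Algebra.norm_apply, Algebra.norm_complex_apply]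
  have h0 : LinearMap.det (Algebra.lmul ℝ ℂ d) ≠ 0 := by rw [hdet]; simpa using hd
  have hm := Measure.map_linearMap_addHaar_eq_smul_addHaar (volume : Measure ℂ) h0
  have hmeas : Measurable (fun w : ℂ => d * w) := by fun_prop
  have h1 : ∫⁻ w, f (a + d * w) = ENNReal.ofReal |(Complex.normSq d)⁻¹| * ∫⁻ ζ, f ζ := by
    rw [← lintegral_add_left_eq_self f a]
    have h2 : Measure.map (fun w : ℂ => d * w) volume = ENNReal.ofReal |(Complex.normSq d)⁻¹| • volume := by
      rw [← hdet]; exact hm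
    rw [← smul_eq_mul, ← lintegral_smul_measure, ← h2, lintegral_map (by fun_prop) hmeas]
  rw [h1, ← mul_assoc]
  have h3 : ‖d‖ₑ ^ 2 * ENNReal.ofReal |(Complex.normSq d)⁻¹| = 1 := by
    rw [← ofReal_norm_eq_enorm, ← ENNReal.ofReal_pow (norm_nonneg _), ← ENNReal.ofReal_mul (by positivity)]
    rw [abs_of_nonneg (by have := Complex.normSq_nonneg d; positivity), Complex.normSq_eq_norm_sq,
      mul_inv_cancel₀ (by simpa using hd)]
    simp
  rw [h3, one_mul]

lemma radial_finite (s : ℝ) (hs1 : 1 < s) (hs2 : s < 2) :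
    ∫⁻ w : ℂ, ENNReal.ofReal ((‖w‖ * max (1/2) ‖w‖) ^ (-s)) < ⊤ := by
  apply Integrable.lintegral_lt_top
  rw [integrable_fun_norm_addHaar (volume : Measure ℂ) (f := fun y => (y * max (1/2) y) ^ (-s))]
  have : Module.finrank ℝ ℂ = 2 := Complex.finrank_real_complex
  rw [this]
  have hsplit : Ioi (0:ℝ) = Ioo 0 1 ∪ Ici 1 := by
    ext x; simp only [mem_Ioi, mem_union, mem_Ioo, mem_Ici]
    constructor
    · intro h; rcases lt_or_ge x 1 with h1 | h1
      · exact Or.inl ⟨h, h1⟩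
      · exact Or.inr h1
    · rintro (h | h)
      · exact h.1
      · linarith
  rw [hsplit]
  refine IntegrableOn.union ?_ ?_
  · have h1 : IntegrableOn (fun y : ℝ => (1/2 : ℝ)^(-s) * y ^ (1 - s)) (Ioo 0 1) :=
      ((intervalIntegral.integrableOn_Ioo_rpow_iff one_pos).2 (by linarith)).const_mul _
    refine Integrable.mono' h1 (by apply Measurable.aestronglyMeasurable; fun_prop) ?_
    filter_upwards [ae_restrict_mem measurableSet_Ioo] with y hy
    have hy0 := hy.1
    simp only [smul_eq_mul]
    rw [Real.norm_of_nonneg (by positivity), Real.mul_rpow hy0.le (by positivity)]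
    have h2 : (max (1/2) y) ^ (-s) ≤ (1/2 : ℝ)^(-s) :=
      Real.rpow_le_rpow_of_nonpos (by norm_num) (le_max_left _ _) (by linarith)
    have h3 : y ^ (1 - s) = y * y ^ (-s) := by
      rw [sub_eq_add_neg, Real.rpow_add hy0, Real.rpow_one]
    rw [h3]
    have h4 : 0 ≤ y * y ^ (-s) := by positivity
    calc y ^ (2 - 1) * (y ^ (-s) * max (1/2) y ^ (-s)) = (max (1/2) y ^ (-s)) * (y * y ^ (-s)) := by
          norm_num; ring
      _ ≤ _ := mul_le_mul_of_nonneg_right h2 h4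
  · have h1 : IntegrableOn (fun y : ℝ => y ^ (1 - 2 * s)) (Ici 1) := by
      rw [integrableOn_Ici_iff_integrableOn_Ioi]
      exact integrableOn_Ioi_rpow_of_lt (by linarith) one_pos
    refine h1.congr_fun ?_ measurableSet_Ici
    intro y hy
    have hy1 : (1:ℝ) ≤ y := hy
    have hy0 : 0 < y := by linarith
    simp only [smul_eq_mul]
    rw [max_eq_right (by linarith), ← sq, ← Real.rpow_natCast y 2, ← Real.rpow_mul hy0.le]
    norm_num
    rw [sub_eq_add_neg, Real.rpow_add hy0, Real.rpow_one]

lemma enorm_inv_mul_rpow (x y s : ℝ) (hx : 0 < x) (hy : 0 < y) :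
    ((ENNReal.ofReal x)⁻¹ * (ENNReal.ofReal y)⁻¹) ^ s = ENNReal.ofReal ((x * y) ^ (-s)) := by
  rw [← ENNReal.ofReal_inv_of_pos hx, ← ENNReal.ofReal_inv_of_pos hy, ← ENNReal.ofReal_mul (by positivity),
    ENNReal.ofReal_rpow_of_pos (by positivity), Real.rpow_neg (by positivity), ← mul_inv,
    Real.inv_rpow (by positivity)]

lemma ker2_unit_finite (s : ℝ) (hs1 : 1 < s) (hs2 : s < 2) :
    ∫⁻ w : ℂ, (ker2 0 1 w) ^ s < ⊤ := by
  set g : ℂ → ENNReal := fun w => ENNReal.ofReal ((‖w‖ * max (1/2) ‖w‖) ^ (-s)) with hg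
  have hgm : Measurable g := by rw [hg]; fun_prop
  have hle : ∫⁻ w : ℂ, (ker2 0 1 w) ^ s ≤ ∫⁻ w : ℂ, (g w + g (1 - w)) := by
    apply lintegral_mono_ae
    have h0 : ∀ᵐ w : ℂ, w ≠ 0 := by simp [ae_iff]
    have h1 : ∀ᵐ w : ℂ, w ≠ 1 := by simp [ae_iff]
    filter_upwards [h0, h1] with w hw0 hw1
    have hx : 0 < ‖w‖ := norm_pos_iff.2 hw0
    have hy : 0 < ‖1 - w‖ := norm_pos_iff.2 (sub_ne_zero.2 (Ne.symm hw1))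
    have htri : 1 ≤ ‖w‖ + ‖1 - w‖ := by
      have := norm_add_le w (1 - w); simpa using this
    have hk : ker2 0 1 w ^ s = ENNReal.ofReal ((‖w‖ * ‖1 - w‖) ^ (-s)) := by
      rw [ker2, zero_sub, enorm_neg, ← ofReal_norm_eq_enorm, ← ofReal_norm_eq_enorm,
        enorm_inv_mul_rpow _ _ _ hx hy]
    rw [hk]
    rcases le_total ‖w‖ ‖1 - w‖ with h | h
    · refine le_trans ?_ (le_add_right le_rfl)
      apply ENNReal.ofReal_le_ofReal
      apply Real.rpow_le_rpow_of_nonpos (by positivity) _ (by linarith)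
      exact mul_le_mul_of_nonneg_left (max_le (by linarith) h) hx.le
    · refine le_trans ?_ (le_add_left le_rfl)
      apply ENNReal.ofReal_le_ofReal
      apply Real.rpow_le_rpow_of_nonpos (by positivity) _ (by linarith)
      rw [mul_comm]
      exact mul_le_mul_of_nonneg_right (max_le (by linarith) h) hy.le
  refine lt_of_le_of_lt hle ?_
  rw [lintegral_add_left hgm, lintegral_sub_left_eq_self g 1]
  exact ENNReal.add_lt_top.2 ⟨radial_finite s hs1 hs2, radial_finite s hs1 hs2⟩

/-- Hölder estimate for the two point kernel. -/
lemma ker2_holder (q : ℝ) (hq : 2 < q) : ∃ C : ENNReal, C ≠ ⊤ ∧ ∀ a b : ℂ, a ≠ b →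
    ∀ B : ℂ → ENNReal, AEMeasurable B volume →
    ∫⁻ ζ, B ζ * ker2 a b ζ ≤ C * (∫⁻ ζ, B ζ ^ q) ^ (1 / q) * ‖a - b‖ₑ ^ (-(2 / q)) := by
  have hconj := Real.HolderConjugate.conjExponent (p := q) (by linarith)
  set s := q.conjExponent with hs
  have hs' : s = q / (q - 1) := rfl
  have hs1 : 1 < s := by rw [hs', lt_div_iff₀ (by linarith)]; linarith
  have hs2 : s < 2 := by rw [hs', div_lt_iff₀ (by linarith)]; linarith
  have hs0 : 0 < s := by linarith
  have hfin := ker2_unit_finite s hs1 hs2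
  refine ⟨(∫⁻ w : ℂ, (ker2 0 1 w) ^ s) ^ (1 / s), ?_, ?_⟩
  · exact ENNReal.rpow_ne_top_of_nonneg (by positivity) hfin.ne
  intro a b hab B hB
  have h1 := ENNReal.lintegral_mul_le_Lp_mul_Lq volume hconj hB (ker2_measurable a b).aemeasurable
  refine le_trans h1 ?_
  have hd : b - a ≠ 0 := sub_ne_zero.2 (Ne.symm hab)
  have he : ‖b - a‖ₑ ≠ 0 := by simpa using hd
  have het : ‖b - a‖ₑ ≠ ⊤ := enorm_ne_top
  have h2 : ∫⁻ ζ, ker2 a b ζ ^ s = ‖b - a‖ₑ ^ (2 - 2 * s) * ∫⁻ w, ker2 0 1 w ^ s := by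
    rw [lintegral_affine a (b - a) hd _ ((ker2_measurable a b).pow_const s)]
    have h3 : ∀ w, ker2 a b (a + (b - a) * w) ^ s = ‖b - a‖ₑ ^ (- (2 * s)) * ker2 0 1 w ^ s := by
      intro w
      have e1 : a - (a + (b - a) * w) = (b - a) * (0 - w) := by ring
      have e2 : b - (a + (b - a) * w) = (b - a) * (1 - w) := by ring
      simp only [ker2]
      rw [e1, e2, enorm_mul, enorm_mul, ENNReal.mul_inv (Or.inl he) (Or.inl het),
        ENNReal.mul_inv (Or.inl he) (Or.inl het)]
      have : ‖b - a‖ₑ⁻¹ * ‖0 - w‖ₑ⁻¹ * (‖b - a‖ₑ⁻¹ * ‖1 - w‖ₑ⁻¹) =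
        (‖b - a‖ₑ⁻¹ * ‖b - a‖ₑ⁻¹) * (‖0 - w‖ₑ⁻¹ * ‖1 - w‖ₑ⁻¹) := by ring
      rw [this, ENNReal.mul_rpow_of_nonneg _ _ hs0.le, ← sq, ← ENNReal.rpow_two, ENNReal.inv_rpow,
        ENNReal.inv_rpow, ← ENNReal.rpow_mul, ENNReal.rpow_neg]
    simp_rw [h3]
    rw [lintegral_const_mul _ ((ker2_measurable 0 1).pow_const s), ← mul_assoc, ← ENNReal.rpow_two,
      ← ENNReal.rpow_add _ _ he het, ← sub_eq_add_neg]
  rw [h2, ENNReal.mul_rpow_of_nonneg _ _ (by positivity), ← ENNReal.rpow_mul]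
  have h4 : (2 - 2 * s) * (1 / s) = -(2 / q) := by
    have hq0 : q - 1 ≠ 0 := by linarith
    have hq1 : q ≠ 0 := by linarith
    rw [hs']; field_simp; ring
  rw [h4, ← enorm_neg (b - a), neg_sub]
  apply le_of_eq; ring

end

section


/-- Wirtinger type derivative: `σ = I` gives `∂̄_j`, `σ = -I` gives `∂_j`. -/
def WD {n : ℕ} (σ : ℂ) (j : Fin n) (φ : (Fin n → ℂ) → ℂ) (z : Fin n → ℂ) : ℂ :=
  (1 / 2 : ℂ) * (fderiv ℝ φ z (Pi.single j 1) + σ * fderiv ℝ φ z (Pi.single j Complex.I))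

/-- test functions on `ℂⁿ`. -/
def Tst {n : ℕ} (V : Set (Fin n → ℂ)) (φ : (Fin n → ℂ) → ℂ) : Prop :=
  ContDiff ℝ (⊤ : ℕ∞) φ ∧ HasCompactSupport φ ∧ tsupport φ ⊆ V

section WDcalc
variable {n : ℕ} {σ τ : ℂ} {j k : Fin n}

lemma WD_contDiff {φ : (Fin n → ℂ) → ℂ} (h : ContDiff ℝ (⊤ : ℕ∞) φ) :
    ContDiff ℝ (⊤ : ℕ∞) (WD σ j φ) := by
  have h1 : ContDiff ℝ (⊤ : ℕ∞) (fderiv ℝ φ) := h.fderiv_right (by norm_cast)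
  unfold WD
  fun_prop

lemma WD_zero_of_nhds {φ : (Fin n → ℂ) → ℂ} {z : Fin n → ℂ} (h : z ∉ tsupport φ) : WD σ j φ z = 0 := by
  have : fderiv ℝ φ z = 0 := by
    apply image_eq_zero_of_notMem_tsupport
    exact fun hh => h (tsupport_fderiv_subset ℝ hh)
  simp [WD, this]

lemma WD_tsupport (φ : (Fin n → ℂ) → ℂ) : tsupport (WD σ j φ) ⊆ tsupport φ := by
  apply closure_minimal _ (isClosed_tsupport φ)
  intro z hz
  by_contra h
  exact hz (WD_zero_of_nhds h)

lemma WD_compact {φ : (Fin n → ℂ) → ℂ} (h : HasCompactSupport φ) : HasCompactSupport (WD σ j φ) :=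
  h.mono' ((subset_tsupport _).trans (WD_tsupport φ))

lemma Tst.WD {V : Set (Fin n → ℂ)} {φ : (Fin n → ℂ) → ℂ} (h : Tst V φ) (σ : ℂ) (j : Fin n) : Tst V (WD σ j φ) :=
  ⟨WD_contDiff h.1, WD_compact h.2.1, (WD_tsupport φ).trans h.2.2⟩

lemma Tst.mono {V W : Set (Fin n → ℂ)} {φ : (Fin n → ℂ) → ℂ} (h : Tst V φ) (hVW : V ⊆ W) : Tst W φ :=
  ⟨h.1, h.2.1, h.2.2.trans hVW⟩

lemma Tst.mul_right {V : Set (Fin n → ℂ)} {φ g : (Fin n → ℂ) → ℂ} (h : Tst V φ) (hg : ContDiff ℝ (⊤ : ℕ∞) g) :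
    Tst V (fun z => φ z * g z) :=
  ⟨h.1.mul hg, h.2.1.mul_right, (tsupport_mul_subset_left).trans h.2.2⟩

lemma WD_congr {φ ψ : (Fin n → ℂ) → ℂ} {z : Fin n → ℂ} (h : φ =ᶠ[nhds z] ψ) : WD σ j φ z = WD σ j ψ z := by
  simp only [WD, h.fderiv_eq]

lemma WD_add {φ ψ : (Fin n → ℂ) → ℂ} {z : Fin n → ℂ} (h : DifferentiableAt ℝ φ z) (h' : DifferentiableAt ℝ ψ z) :
    WD σ j (fun z => φ z + ψ z) z = WD σ j φ z + WD σ j ψ z := by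
  simp only [WD]; rw [fderiv_fun_add h h']; simp; ring

lemma WD_mul {φ ψ : (Fin n → ℂ) → ℂ} {z : Fin n → ℂ} (h : DifferentiableAt ℝ φ z) (h' : DifferentiableAt ℝ ψ z) :
    WD σ j (fun z => φ z * ψ z) z = φ z * WD σ j ψ z + WD σ j φ z * ψ z := by
  simp only [WD]; rw [fderiv_fun_mul h h']; simp; ring

lemma WD_const (c : ℂ) (z : Fin n → ℂ) : WD σ j (fun _ => c) z = 0 := by
  simp [WD]

lemma WD_neg {φ : (Fin n → ℂ) → ℂ} {z : Fin n → ℂ} : WD σ j (fun z => - φ z) z = - WD σ j φ z := by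
  simp only [WD]; rw [fderiv_fun_neg]; simp; ring

/-- chain rule with holomorphic outer function -/
lemma WD_comp_holo {φ : (Fin n → ℂ) → ℂ} {z : Fin n → ℂ} {g : ℂ → ℂ} {g' : ℂ} (h : DifferentiableAt ℝ φ z)
    (hg : HasDerivAt g g' (φ z)) : WD σ j (fun z => g (φ z)) z = g' * WD σ j φ z := by
  have h1 : HasFDerivAt g ((ContinuousLinearMap.toSpanSingleton ℂ g').restrictScalars ℝ) (φ z) :=
    hg.hasFDerivAt.restrictScalars ℝ
  have h2 := (h1.comp z h.hasFDerivAt).fderiv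
  have h3 : fderiv ℝ (fun z => g (φ z)) z = _ := h2
  simp only [WD]; rw [h3]; simp; ring

lemma WD_conj {φ : (Fin n → ℂ) → ℂ} {z : Fin n → ℂ} (h : DifferentiableAt ℝ φ z) :
    WD σ j (fun z => (starRingEnd ℂ) (φ z)) z = (starRingEnd ℂ) (WD ((starRingEnd ℂ) σ) j φ z) := by
  have h2 := ((Complex.conjCLE.toContinuousLinearMap.hasFDerivAt (x := φ z)).comp z h.hasFDerivAt).fderiv
  have h3 : fderiv ℝ (fun z => (starRingEnd ℂ) (φ z)) z = _ := h2
  simp only [WD]; rw [h3]; simp [Complex.conj_ofNat]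

lemma WD_comm {φ : (Fin n → ℂ) → ℂ} (h : ContDiff ℝ (⊤ : ℕ∞) φ) (z : Fin n → ℂ) :
    WD σ j (WD τ k φ) z = WD τ k (WD σ j φ) z := by
  have h1 : ContDiff ℝ (⊤ : ℕ∞) (fderiv ℝ φ) := h.fderiv_right (by norm_cast)
  have hd : DifferentiableAt ℝ (fderiv ℝ φ) z := h1.differentiable (by simp) z
  have key : ∀ (σ : ℂ) (j : Fin n) (v : Fin n → ℂ), fderiv ℝ (WD σ j φ) z v = (1 / 2 : ℂ) *
      (fderiv ℝ (fderiv ℝ φ) z v (Pi.single j 1) + σ * fderiv ℝ (fderiv ℝ φ) z v (Pi.single j Complex.I)) := by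
    intro σ j v
    have e : HasFDerivAt (WD σ j φ) _ z := ((((hd.hasFDerivAt.clm_apply (hasFDerivAt_const (Pi.single j 1) z)).add
        ((hd.hasFDerivAt.clm_apply (hasFDerivAt_const (Pi.single j Complex.I) z)).const_mul σ)).const_mul (1/2 : ℂ)))
    rw [e.fderiv]; simp; ring
  have hsymm : ∀ v w, fderiv ℝ (fderiv ℝ φ) z v w = fderiv ℝ (fderiv ℝ φ) z w v := by
    intro v w
    have := (h.contDiffAt (x := z)).isSymmSndFDerivAt (by simpa using (WithTop.coe_le_coe.2 le_top : ((2:ℕ∞) : WithTop ℕ∞) ≤ ((⊤:ℕ∞) : WithTop ℕ∞)))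
    exact this.eq v w
  have e1 : WD σ j (WD τ k φ) z = _ := rfl
  rw [WD, WD, key, key, key, key, hsymm (Pi.single j 1) (Pi.single k 1), hsymm (Pi.single j 1) (Pi.single k Complex.I),
    hsymm (Pi.single j Complex.I) (Pi.single k 1), hsymm (Pi.single j Complex.I) (Pi.single k Complex.I)]
  ring

lemma fderiv_update_comp {φ : (Fin n → ℂ) → ℂ} (h : Differentiable ℝ φ) (z : Fin n → ℂ) (ζ v : ℂ) :
    fderiv ℝ (fun ζ => φ (Function.update z j ζ)) ζ v = fderiv ℝ φ (Function.update z j ζ) (Pi.single j v) := by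
  have h1 : HasFDerivAt (Function.update z j) (ContinuousLinearMap.single ℝ (fun _ : Fin n => ℂ) j) ζ :=
    by
    have e : ContinuousLinearMap.single ℝ (fun _ : Fin n => ℂ) j =
        ContinuousLinearMap.pi (Pi.single j (ContinuousLinearMap.id ℝ ℂ)) := by
      apply ContinuousLinearMap.ext; intro v; funext i
      by_cases hi : i = j
      · subst hi; simp
      · simp [Pi.single_eq_of_ne hi]
    rw [e]
    exact hasFDerivAt_update (𝕜 := ℝ) (i := j) z ζ
  have h2 := ((h (Function.update z j ζ)).hasFDerivAt.comp ζ h1).fderiv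
  have h3 : fderiv ℝ (fun ζ => φ (Function.update z j ζ)) ζ = _ := h2
  rw [h3]; simp

lemma dbar1_line {φ : (Fin n → ℂ) → ℂ} (h : Differentiable ℝ φ) (z : Fin n → ℂ) (ζ : ℂ) :
    dbar1 (fun ζ => φ (Function.update z j ζ)) ζ = WD Complex.I j φ (Function.update z j ζ) := by
  simp only [dbar1, WD]
  rw [fderiv_update_comp h, fderiv_update_comp h]

lemma WD_coord {χ : ℂ → ℂ} (h : Differentiable ℝ χ) (z : Fin n → ℂ) :
    WD Complex.I j (fun z => χ (z k)) z = if j = k then dbar1 χ (z k) else 0 := by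
  have h1 : HasFDerivAt (fun z : Fin n → ℂ => z k) (ContinuousLinearMap.proj (R := ℝ) (φ := fun _ : Fin n => ℂ) k) z :=
    (ContinuousLinearMap.proj (R := ℝ) (φ := fun _ : Fin n => ℂ) k).hasFDerivAt
  have h2 := ((h (z k)).hasFDerivAt.comp z h1).fderiv
  have h3 : fderiv ℝ (fun z : Fin n → ℂ => χ (z k)) z = _ := h2
  simp only [WD, dbar1]; rw [h3]
  split_ifs with hjk
  · subst hjk; simp
  · simp [Pi.single_eq_of_ne (Ne.symm hjk)]

lemma integral_WD_eq_zero {φ : (Fin n → ℂ) → ℂ} (h : ContDiff ℝ (⊤ : ℕ∞) φ) (hc : HasCompactSupport φ) :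
    ∫ z, WD σ j φ z = 0 := by
  have h1 : Continuous (fderiv ℝ φ) := h.continuous_fderiv (by simp)
  have hi : ∀ v, Integrable (fun z => fderiv ℝ φ z v) (volume : Measure (Fin n → ℂ)) := fun v =>
    (h1.clm_apply continuous_const).integrable_of_hasCompactSupport
      ((hc.fderiv ℝ).comp_left (g := fun L : (Fin n → ℂ) →L[ℝ] ℂ => L v) (by simp))
  have h0 : ∀ v, ∫ z, fderiv ℝ φ z v = 0 := by
    intro v
    have := integral_mul_fderiv_eq_neg_fderiv_mul_of_integrable (μ := (volume : Measure (Fin n → ℂ)))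
      (f := fun _ => (1:ℂ)) (g := φ) (v := v) (by simp) (by simpa using hi v)
      (by simpa using h.continuous.integrable_of_hasCompactSupport hc) (by simp) (fun x _ => h.differentiable (by simp) x)
    simpa using this
  simp only [WD]
  rw [integral_const_mul, integral_add (hi _) ((hi _).const_mul _), integral_const_mul, h0, h0]
  simp

end WDcalc
end

section


lemma inv_le_ker2 (a ζ : ℂ) : ‖a - ζ‖ₑ⁻¹ ≤ 1 + 2 * ker2 a (a + 1) ζ := by
  rcases le_or_gt 1 ‖a - ζ‖ₑ with h | h
  · exact (ENNReal.inv_le_one.2 h).trans (le_add_right le_rfl)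
  · refine le_trans ?_ (le_add_left le_rfl)
    have h2 : ‖a + 1 - ζ‖ₑ ≤ 2 := by
      have e : a + 1 - ζ = (a - ζ) + 1 := by ring
      rw [e]
      refine (enorm_add_le _ _).trans ?_
      rw [← one_add_one_eq_two, enorm_one]
      gcongr
    have h3 : 1 ≤ 2 * ‖a + 1 - ζ‖ₑ⁻¹ := by
      calc (1:ENNReal) = 2 * 2⁻¹ := (ENNReal.mul_inv_cancel (by norm_num) (by norm_num)).symm
        _ ≤ _ := by gcongr
    calc ‖a - ζ‖ₑ⁻¹ = ‖a - ζ‖ₑ⁻¹ * 1 := by rw [mul_one]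
      _ ≤ ‖a - ζ‖ₑ⁻¹ * (2 * ‖a + 1 - ζ‖ₑ⁻¹) := by gcongr
      _ = _ := by rw [ker2]; ring

/-- uniform local integrability of the Cauchy kernel -/
lemma cauchy_kernel_loc (ρ : ℝ) : ∃ C : ENNReal, C ≠ ⊤ ∧ ∀ a c : ℂ,
    ∫⁻ ζ in ball c ρ, ‖a - ζ‖ₑ⁻¹ ≤ C := by
  obtain ⟨C, hC, h⟩ := ker2_holder 3 (by norm_num)
  set V : ENNReal := volume (ball (0:ℂ) ρ) with hV
  have hVt : V ≠ ⊤ := measure_ball_lt_top.ne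
  refine ⟨V + 2 * (C * V ^ (1 / (3:ℝ)) * 1), ?_, ?_⟩
  · have : V ^ (1 / (3:ℝ)) ≠ ⊤ := ENNReal.rpow_ne_top_of_nonneg (by norm_num) hVt
    finiteness
  intro a c
  have hVc : volume (ball c ρ) = V := by rw [hV, Measure.addHaar_ball_center]
  have h1 := h a (a + 1) (by simp) ((ball c ρ).indicator 1) (measurable_one.indicator measurableSet_ball).aemeasurable
  calc ∫⁻ ζ in ball c ρ, ‖a - ζ‖ₑ⁻¹ ≤ ∫⁻ ζ in ball c ρ, (1 + 2 * ker2 a (a + 1) ζ) :=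
        lintegral_mono (fun ζ => inv_le_ker2 a ζ)
    _ = V + 2 * ∫⁻ ζ in ball c ρ, ker2 a (a+1) ζ := by
        rw [lintegral_add_left measurable_const, lintegral_const_mul _ (ker2_measurable _ _)]
        simp [hVc]
    _ ≤ _ := by
        gcongr
        have e1 : ∫⁻ ζ in ball c ρ, ker2 a (a+1) ζ = ∫⁻ ζ, (ball c ρ).indicator 1 ζ * ker2 a (a+1) ζ := by
          rw [← lintegral_indicator measurableSet_ball]
          congr 1; ext ζ
          by_cases hζ : ζ ∈ ball c ρ <;> simp [hζ]
        rw [e1]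
        refine h1.trans ?_
        have e2 : ∫⁻ ζ, ((ball c ρ).indicator 1 ζ : ENNReal) ^ (3:ℝ) = V := by
          rw [← hVc, ← lintegral_indicator_one measurableSet_ball]
          congr 1; ext ζ
          by_cases hζ : ζ ∈ ball c ρ <;> simp [hζ]
        rw [e2]
        have e3 : ‖a - (a + 1)‖ₑ = 1 := by simp
        rw [e3]; simp

/-- uniform local integrability of the Cauchy kernel, indicator version -/
lemma cauchy_kernel_loc0 (ρ : ℝ) : ∃ C : ENNReal, C ≠ ⊤ ∧ ∀ c : ℂ,
    ∫⁻ ζ in ball c ρ, ‖ζ‖ₑ⁻¹ ≤ C := by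
  obtain ⟨C, hC, h⟩ := cauchy_kernel_loc ρ
  exact ⟨C, hC, fun c => by simpa using h 0 c⟩

section slice
variable {n : ℕ}

lemma sub_single_eq (z : Fin n → ℂ) (k : Fin n) (ζ : ℂ) :
    z - Pi.single k ζ = Function.update z k (z k - ζ) := by
  ext i
  by_cases h : i = k
  · subst h; simp
  · simp [h]

lemma add_single_eq (z : Fin n → ℂ) (k : Fin n) (ζ : ℂ) :
    z + Pi.single k ζ = Function.update z k (z k + ζ) := by
  ext i
  by_cases h : i = k
  · subst h; simp
  · simp [h]

lemma continuous_single' (k : Fin n) : Continuous (fun ζ : ℂ => (Pi.single k ζ : Fin n → ℂ)) :=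
  continuous_single (A := fun _ : Fin n => ℂ) k

lemma measurable_shear (k : Fin n) : Measurable (fun p : (Fin n → ℂ) × ℂ => p.1 - Pi.single k p.2) :=
  (continuous_fst.sub ((continuous_single' k).comp continuous_snd)).measurable

lemma measurable_shear' (k : Fin n) : Measurable (fun p : (Fin n → ℂ) × ℂ => p.1 + Pi.single k p.2) :=
  (continuous_fst.add ((continuous_single' k).comp continuous_snd)).measurable

lemma continuous_upd (k : Fin n) : Continuous (fun p : (Fin n → ℂ) × ℂ => Function.update p.1 k p.2) :=
  continuous_fst.update k continuous_snd

/-- Tonelli with the shear -/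
lemma lintegral_shear (k : Fin n) (H : (Fin n → ℂ) → ENNReal) (hH : Measurable H)
    (G : (Fin n → ℂ) → ENNReal) (hG : Measurable G) (w : ℂ → ENNReal) (hw : Measurable w) :
    ∫⁻ z, ∫⁻ ζ, H (z - (Pi.single k ζ : Fin n → ℂ)) * w ζ * G z =
    ∫⁻ z, H z * ∫⁻ ζ, w ζ * G (z + Pi.single k ζ) := by
  have m1 := measurable_shear k
  have m2 := measurable_shear' k
  rw [lintegral_lintegral_swap (((hH.comp m1).mul (hw.comp measurable_snd)).mul (hG.comp measurable_fst)).aemeasurable]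
  have h1 : ∀ ζ : ℂ, ∫⁻ z, H (z - (Pi.single k ζ : Fin n → ℂ)) * w ζ * G z =
      ∫⁻ z, H z * w ζ * G (z + Pi.single k ζ) := by
    intro ζ
    rw [← lintegral_add_right_eq_self _ (Pi.single k ζ : Fin n → ℂ)]
    simp
  simp_rw [h1]
  rw [lintegral_lintegral_swap]
  · congr 1; ext z
    rw [← lintegral_const_mul]
    · simp_rw [mul_assoc]
    · have : Measurable (fun ζ : ℂ => z + (Pi.single k ζ : Fin n → ℂ)) :=
        (continuous_const.add (continuous_single' k)).measurable
      exact hw.mul (hG.comp this)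
  · apply Measurable.aemeasurable
    have m3 : Measurable (fun p : ℂ × (Fin n → ℂ) => p.2 + Pi.single k p.1) := m2.comp measurable_swap
    exact ((hH.comp measurable_snd).mul (hw.comp measurable_fst)).mul (hG.comp m3)

lemma dist_coord_le {z z0 : Fin n → ℂ} {ρ : ℝ} (h : z ∈ ball z0 ρ) (k : Fin n) : z k ∈ ball (z0 k) ρ := by
  rw [mem_ball] at *
  exact (dist_le_pi_dist z z0 k).trans_lt h

/-- Integrability of the sheared kernel. -/
lemma shear_integrable (k : Fin n) (z0 : Fin n → ℂ) (ρ : ℝ) (H : (Fin n → ℂ) → ℂ) (hHm : Measurable H)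
    (hH : Integrable H) (g : (Fin n → ℂ) → ℂ) (hg : Measurable g) (C : ℝ) (hC : ∀ z, ‖g z‖ ≤ C)
    (hs : ∀ z, z ∉ ball z0 ρ → g z = 0) :
    Integrable (fun p : (Fin n → ℂ) × ℂ => H (p.1 - Pi.single k p.2) * p.2⁻¹ * g p.1) (volume.prod volume) := by
  have m1 := measurable_shear k
  have m2 := measurable_shear' k
  have m3 : Measurable (fun p : (Fin n → ℂ) × ℂ => H (p.1 - Pi.single k p.2) * p.2⁻¹ * g p.1) :=
    ((hHm.comp m1).mul measurable_snd.inv).mul (hg.comp measurable_fst)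
  refine ⟨m3.aestronglyMeasurable, ?_⟩
  rw [hasFiniteIntegral_iff_enorm, lintegral_prod _ m3.enorm.aemeasurable]
  simp only [enorm_mul]
  rw [lintegral_shear k (fun z => ‖H z‖ₑ) hHm.enorm (fun z => ‖g z‖ₑ) hg.enorm (fun ζ => ‖ζ⁻¹‖ₑ) measurable_id.inv.enorm]
  obtain ⟨K, hK, hK'⟩ := cauchy_kernel_loc0 ρ
  have h1 : ∀ z, ∫⁻ ζ : ℂ, ‖ζ⁻¹‖ₑ * ‖g (z + (Pi.single k ζ : Fin n → ℂ))‖ₑ ≤ ENNReal.ofReal C * K := by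
    intro z
    have h2 : ∀ᵐ ζ : ℂ, ‖ζ⁻¹‖ₑ * ‖g (z + (Pi.single k ζ : Fin n → ℂ))‖ₑ ≤
        (ball (z0 k - z k) ρ).indicator (fun ζ => ENNReal.ofReal C * ‖ζ‖ₑ⁻¹) ζ := by
      have h0 : ∀ᵐ w : ℂ, w ≠ 0 := by simp [ae_iff]
      filter_upwards [h0] with ζ hζ0
      by_cases hζ : ζ ∈ ball (z0 k - z k) ρ
      · rw [indicator_of_mem hζ, mul_comm, enorm_inv hζ0]
        gcongr
        rw [← ofReal_norm]; exact ENNReal.ofReal_le_ofReal (hC _)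
      · have : g (z + (Pi.single k ζ : Fin n → ℂ)) = 0 := by
          apply hs
          intro hh
          apply hζ
          have := dist_coord_le hh k
          rw [mem_ball, dist_eq_norm] at *
          simp at this
          convert this using 2; ring
        simp [this]
    refine (lintegral_mono_ae h2).trans ?_
    rw [lintegral_indicator measurableSet_ball, lintegral_const_mul _ (by fun_prop)]
    gcongr
    exact hK' _
  calc _ ≤ ∫⁻ z, ‖H z‖ₑ * (ENNReal.ofReal C * K) := by gcongr with z; exact h1 z
    _ = (∫⁻ z, ‖H z‖ₑ) * (ENNReal.ofReal C * K) := lintegral_mul_const _ hHm.enorm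
    _ < ⊤ := ENNReal.mul_lt_top hH.2 (by finiteness)

/-- Cauchy transform in the `k`-th variable. -/
def TK (k : Fin n) (H : (Fin n → ℂ) → ℂ) (z : Fin n → ℂ) : ℂ :=
  (Real.pi : ℂ)⁻¹ * ∫ ζ : ℂ, H (z - (Pi.single k ζ : Fin n → ℂ)) * ζ⁻¹

lemma TK_measurable (k : Fin n) (H : (Fin n → ℂ) → ℂ) (hHm : Measurable H) : Measurable (TK k H) := by
  have m1 := measurable_shear k
  have : StronglyMeasurable (fun z : Fin n → ℂ => ∫ ζ : ℂ, H (z - (Pi.single k ζ : Fin n → ℂ)) * ζ⁻¹) := by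
    apply StronglyMeasurable.integral_prod_right (f := fun (z : Fin n → ℂ) (ζ : ℂ) => H (z - (Pi.single k ζ : Fin n → ℂ)) * ζ⁻¹)
    exact ((hHm.comp m1).mul measurable_snd.inv).stronglyMeasurable
  unfold TK
  exact this.measurable.const_mul _

lemma TK_pairing (k : Fin n) (z0 : Fin n → ℂ) (ρ : ℝ) (H : (Fin n → ℂ) → ℂ) (hHm : Measurable H)
    (hH : Integrable H) (g : (Fin n → ℂ) → ℂ) (hg : Measurable g) (C : ℝ) (hC : ∀ z, ‖g z‖ ≤ C)
    (hs : ∀ z, z ∉ ball z0 ρ → g z = 0) :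
    Integrable (fun z => TK k H z * g z) ∧ ∫ z, TK k H z * g z = - ∫ z, H z * TK k g z := by
  have hI := shear_integrable k z0 ρ H hHm hH g hg C hC hs
  have e0 : ∀ z, (∫ ζ : ℂ, H (z - (Pi.single k ζ : Fin n → ℂ)) * ζ⁻¹ * g z) = (∫ ζ : ℂ, H (z - (Pi.single k ζ : Fin n → ℂ)) * ζ⁻¹) * g z :=
    fun z => integral_mul_const _ _
  constructor
  · have := hI.integral_prod_left.const_mul ((Real.pi : ℂ)⁻¹)
    refine this.congr (ae_of_all _ fun z => ?_)
    simp only [TK]; rw [e0]; ring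
  · have e1 : ∫ z, TK k H z * g z = (Real.pi : ℂ)⁻¹ * ∫ z, ∫ ζ : ℂ, H (z - (Pi.single k ζ : Fin n → ℂ)) * ζ⁻¹ * g z := by
      rw [← integral_const_mul]; congr 1; ext z; rw [e0, TK]; ring
    have e2 : ∫ z, H z * TK k g z = (Real.pi : ℂ)⁻¹ * ∫ z, ∫ ζ : ℂ, H z * (g (z - Pi.single k ζ) * ζ⁻¹) := by
      rw [← integral_const_mul]; congr 1; ext z; rw [integral_const_mul, TK]; ring
    rw [e1, e2, ← mul_neg]
    congr 1
    rw [integral_integral_swap hI]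
    have e3 : ∀ ζ : ℂ, ∫ z, H (z - (Pi.single k ζ : Fin n → ℂ)) * ζ⁻¹ * g z = ∫ z, H z * ζ⁻¹ * g (z + (Pi.single k ζ : Fin n → ℂ)) := by
      intro ζ
      rw [← integral_add_right_eq_self _ (Pi.single k ζ : Fin n → ℂ)]
      simp
    simp_rw [e3]
    have hI2 : Integrable (Function.uncurry fun (ζ : ℂ) (z : Fin n → ℂ) => H z * ζ⁻¹ * g (z + (Pi.single k ζ : Fin n → ℂ))) (volume.prod volume) := by
      have hmp : MeasurePreserving (fun p : ℂ × (Fin n → ℂ) => (p.1, p.2 + Pi.single k p.1)) (volume.prod volume) (volume.prod volume) := by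
        refine MeasurePreserving.skew_product (μa := volume) (μb := volume) (μc := volume) (μd := volume) (g := fun (ζ : ℂ) (z : Fin n → ℂ) => z + Pi.single k ζ) (MeasurePreserving.id _) ?_ ?_
        · exact (measurable_shear' k).comp measurable_swap
        · exact ae_of_all _ fun ζ => (measurePreserving_add_right volume (Pi.single k ζ : Fin n → ℂ)).map_eq
      have := hmp.integrable_comp_of_integrable hI.swap
      refine this.congr (ae_of_all _ fun p => ?_)
      simp [Function.uncurry]
    rw [integral_integral_swap hI2, ← integral_neg]
    congr 1; ext z
    rw [← integral_neg, ← integral_neg_eq_self]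
    congr 1; ext ζ
    simp [sub_eq_add_neg, Pi.single_neg]; ring
end slice
end

section


lemma inv_integrableOn (c : ℂ) (ρ : ℝ) : IntegrableOn (fun ζ : ℂ => ζ⁻¹) (ball c ρ) := by
  obtain ⟨C, hC, h⟩ := cauchy_kernel_loc0 ρ
  refine ⟨(by fun_prop : Measurable fun ζ : ℂ => ζ⁻¹).aestronglyMeasurable, ?_⟩
  rw [hasFiniteIntegral_iff_enorm]
  have h0 : ∀ᵐ w : ℂ ∂(volume.restrict (ball c ρ)), w ≠ 0 := by
    apply ae_restrict_of_ae; simp [ae_iff]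
  have : ∫⁻ ζ in ball c ρ, ‖ζ⁻¹‖ₑ = ∫⁻ ζ in ball c ρ, ‖ζ‖ₑ⁻¹ :=
    lintegral_congr_ae (by filter_upwards [h0] with ζ hζ; rw [enorm_inv hζ])
  rw [this]
  exact (h c).trans_lt hC.lt_top

lemma inv_locallyIntegrable : LocallyIntegrable (fun ζ : ℂ => ζ⁻¹) volume := by
  intro c
  exact ⟨ball c 1, ball_mem_nhds c one_pos, inv_integrableOn c 1⟩

section TKs
variable {n : ℕ}

lemma TK_contDiff (k : Fin n) {φ : (Fin n → ℂ) → ℂ} (h : ContDiff ℝ (⊤ : ℕ∞) φ) (hc : HasCompactSupport φ) :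
    ContDiff ℝ (⊤ : ℕ∞) (TK k φ) := by
  have h1 := contDiffOn_convolution_right_with_param (μ := (volume : Measure ℂ)) (n := ⊤) (ContinuousLinearMap.mul ℝ ℂ)
    (f := fun ζ : ℂ => ζ⁻¹) (g := fun (p : Fin n → ℂ) (x : ℂ) => φ (Function.update p k x)) (s := univ)
    (k := (fun z : Fin n → ℂ => z k) '' (tsupport φ)) isOpen_univ (hc.isCompact.image (continuous_apply k))
    (by
      intro p x _ hx
      apply image_eq_zero_of_notMem_tsupport
      intro hh
      exact hx ⟨_, hh, by simp⟩) inv_locallyIntegrable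
    (by
      apply ContDiff.contDiffOn
      apply h.comp
      rw [contDiff_pi]
      intro i
      by_cases hi : i = k
      · subst hi; simp; exact contDiff_snd
      · simp [hi]; exact (contDiff_apply ℝ ℂ i).comp contDiff_fst)
  rw [univ_prod_univ, contDiffOn_univ] at h1
  have h2 : ContDiff ℝ (⊤ : ℕ∞) (fun z : Fin n → ℂ => (z, z k)) := contDiff_id.prodMk (contDiff_apply ℝ ℂ k)
  have h3 := (contDiff_const (c := ((Real.pi : ℂ)⁻¹))).mul (h1.comp h2)
  refine cast (congrArg (ContDiff ℝ (⊤ : ℕ∞)) (funext fun z => ?_)) h3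
  symm
  simp only [TK, Function.comp, convolution]
  congr 2; ext ζ
  simp only [ContinuousLinearMap.mul_apply']
  rw [sub_single_eq, mul_comm]

lemma TK_fderiv (k : Fin n) {φ : (Fin n → ℂ) → ℂ} (h : ContDiff ℝ (⊤ : ℕ∞) φ) (hc : HasCompactSupport φ) (z v : Fin n → ℂ) :
    fderiv ℝ (TK k φ) z v = (Real.pi : ℂ)⁻¹ * ∫ ζ : ℂ, fderiv ℝ φ (z - (Pi.single k ζ : Fin n → ℂ)) v * ζ⁻¹ := by
  obtain ⟨C, hC⟩ := (hc.fderiv ℝ).exists_bound_of_continuous (h.continuous_fderiv (by simp))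
  obtain ⟨C0, hC0⟩ := hc.exists_bound_of_continuous h.continuous
  obtain ⟨ρ, hρ⟩ := hc.isCompact.isBounded.subset_ball (0 : Fin n → ℂ)
  have hm : Measurable (fun ζ : ℂ => (z - (Pi.single k ζ : Fin n → ℂ))) :=
    (continuous_const.sub (continuous_single' k)).measurable
  have hm' : ∀ x : Fin n → ℂ, Measurable (fun ζ : ℂ => (x - (Pi.single k ζ : Fin n → ℂ))) := fun x =>
    (continuous_const.sub (continuous_single' k)).measurable
  have hsupp : ∀ x ∈ ball z 1, ∀ ζ : ℂ, ζ ∉ ball (z k) (ρ + 1) → (x - (Pi.single k ζ : Fin n → ℂ)) ∉ tsupport φ := by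
    intro x hx ζ hζ hh
    apply hζ
    have h1 := dist_coord_le (hρ hh) k
    have h2 := dist_coord_le hx k
    rw [mem_ball, dist_eq_norm] at *
    simp only [Pi.sub_apply, Pi.single_eq_same, Pi.zero_apply, sub_zero] at h1
    calc ‖ζ - z k‖ = ‖(x k - z k) - (x k - ζ)‖ := by congr 1; ring
      _ ≤ ‖x k - z k‖ + ‖x k - ζ‖ := norm_sub_le _ _
      _ < _ := by linarith
  have hbi : ∀ c : ℝ, Integrable (fun ζ : ℂ => (ball (z k) (ρ+1)).indicator (fun ζ => c * ‖ζ⁻¹‖) ζ) volume := fun c =>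
    (integrable_indicator_iff measurableSet_ball).2 ((inv_integrableOn (z k) (ρ+1)).norm.const_mul c)
  have key := hasFDerivAt_integral_of_dominated_of_fderiv_le (𝕜 := ℝ) (μ := (volume : Measure ℂ)) (x₀ := z)
    (F := fun x ζ => φ (x - (Pi.single k ζ : Fin n → ℂ)) * ζ⁻¹) (s := ball z 1)
    (F' := fun x ζ => ζ⁻¹ • fderiv ℝ φ (x - (Pi.single k ζ : Fin n → ℂ)))
    (bound := fun ζ => (ball (z k) (ρ+1)).indicator (fun ζ => C * ‖ζ⁻¹‖) ζ) (ball_mem_nhds z one_pos)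
    (Filter.Eventually.of_forall fun x => ((h.continuous.measurable.comp (hm' x)).mul measurable_id.inv).aestronglyMeasurable)
    (by
      refine Integrable.mono' (hbi C0) ((h.continuous.measurable.comp (hm' z)).mul measurable_id.inv).aestronglyMeasurable ?_
      refine ae_of_all _ fun ζ => ?_
      by_cases hζ : ζ ∈ ball (z k) (ρ+1)
      · rw [indicator_of_mem hζ, norm_mul]; gcongr; exact hC0 _
      · rw [indicator_of_notMem hζ, image_eq_zero_of_notMem_tsupport (hsupp z (mem_ball_self one_pos) ζ hζ)]; simp)
    (by
      apply Measurable.aestronglyMeasurable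
      exact (measurable_id.inv).smul ((h.continuous_fderiv (by simp)).measurable.comp hm))
    (by
      refine ae_of_all _ fun ζ x hx => ?_
      by_cases hζ : ζ ∈ ball (z k) (ρ+1)
      · rw [indicator_of_mem hζ, norm_smul, mul_comm]; gcongr; exact hC _
      · have : fderiv ℝ φ (x - (Pi.single k ζ : Fin n → ℂ)) = 0 := by
          apply image_eq_zero_of_notMem_tsupport
          exact fun hh => hsupp x hx ζ hζ (tsupport_fderiv_subset ℝ hh)
        rw [indicator_of_notMem hζ, this]; simp) (hbi C)
    (by
      refine ae_of_all _ fun ζ x hx => ?_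
      have h1 : HasFDerivAt (fun x : Fin n → ℂ => φ (x - (Pi.single k ζ : Fin n → ℂ))) (fderiv ℝ φ (x - (Pi.single k ζ : Fin n → ℂ))) x := by
        have := (h.differentiable (by simp) (x - (Pi.single k ζ : Fin n → ℂ))).hasFDerivAt.comp x ((hasFDerivAt_id (𝕜 := ℝ) x).sub_const (Pi.single k ζ : Fin n → ℂ))
        rw [ContinuousLinearMap.comp_id] at this; exact this
      exact h1.mul_const _)
  have hi : Integrable (fun ζ : ℂ => ζ⁻¹ • fderiv ℝ φ (z - (Pi.single k ζ : Fin n → ℂ))) volume := by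
    refine Integrable.mono' (hbi C) ?_ ?_
    · exact ((measurable_id.inv).smul ((h.continuous_fderiv (by simp)).measurable.comp hm)).aestronglyMeasurable
    · refine ae_of_all _ fun ζ => ?_
      by_cases hζ : ζ ∈ ball (z k) (ρ+1)
      · rw [indicator_of_mem hζ, norm_smul, mul_comm]; gcongr; exact hC _
      · have : fderiv ℝ φ (z - (Pi.single k ζ : Fin n → ℂ)) = 0 := by
          apply image_eq_zero_of_notMem_tsupport
          exact fun hh => hsupp z (mem_ball_self one_pos) ζ hζ (tsupport_fderiv_subset ℝ hh)
        rw [indicator_of_notMem hζ, norm_smul, this, norm_zero, mul_zero]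
  have k2 := (key.const_mul ((Real.pi : ℂ)⁻¹)).fderiv
  have k3 : fderiv ℝ (TK k φ) z = _ := k2
  rw [k3, smul_apply, ContinuousLinearMap.integral_apply hi, smul_eq_mul]
  congr 2; ext ζ
  simp [mul_comm]

lemma TK_WD (k j : Fin n) (σ : ℂ) {φ : (Fin n → ℂ) → ℂ} (h : ContDiff ℝ (⊤ : ℕ∞) φ) (hc : HasCompactSupport φ) (z : Fin n → ℂ) :
    WD σ j (TK k φ) z = TK k (WD σ j φ) z := by
  obtain ⟨C, hC⟩ := (hc.fderiv ℝ).exists_bound_of_continuous (h.continuous_fderiv (by simp))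
  obtain ⟨ρ, hρ⟩ := hc.isCompact.isBounded.subset_ball (0 : Fin n → ℂ)
  have hm : Measurable (fun ζ : ℂ => (z - (Pi.single k ζ : Fin n → ℂ))) :=
    (continuous_const.sub (continuous_single' k)).measurable
  have hi : ∀ v, Integrable (fun ζ : ℂ => fderiv ℝ φ (z - (Pi.single k ζ : Fin n → ℂ)) v * ζ⁻¹) volume := by
    intro v
    have hbi : Integrable (fun ζ : ℂ => (ball (z k) ρ).indicator (fun ζ => (C * ‖v‖) * ‖ζ⁻¹‖) ζ) volume :=
      (integrable_indicator_iff measurableSet_ball).2 ((inv_integrableOn (z k) ρ).norm.const_mul _)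
    refine Integrable.mono' hbi ?_ ?_
    · exact ((((h.continuous_fderiv (by simp)).clm_apply continuous_const).measurable.comp hm).mul measurable_id.inv).aestronglyMeasurable
    · refine ae_of_all _ fun ζ => ?_
      by_cases hζ : ζ ∈ ball (z k) ρ
      · rw [indicator_of_mem hζ, norm_mul]; gcongr
        exact ((fderiv ℝ φ _).le_opNorm v).trans (by gcongr; exact hC _)
      · have : fderiv ℝ φ (z - (Pi.single k ζ : Fin n → ℂ)) = 0 := by
          apply image_eq_zero_of_notMem_tsupport
          intro hh
          have h1 := dist_coord_le (hρ (tsupport_fderiv_subset ℝ hh)) k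
          apply hζ
          rw [mem_ball, dist_eq_norm] at *
          simp only [Pi.sub_apply, Pi.single_eq_same, Pi.zero_apply, sub_zero] at h1
          rwa [norm_sub_rev]
        rw [indicator_of_notMem hζ, this]; simp
  rw [WD, TK_fderiv k h hc, TK_fderiv k h hc, TK]
  have e : ∀ ζ : ℂ, WD σ j φ (z - (Pi.single k ζ : Fin n → ℂ)) * ζ⁻¹ =
      (1/2 : ℂ) * (fderiv ℝ φ (z - (Pi.single k ζ : Fin n → ℂ)) (Pi.single j 1) * ζ⁻¹ + σ * (fderiv ℝ φ (z - (Pi.single k ζ : Fin n → ℂ)) (Pi.single j Complex.I) * ζ⁻¹)) := by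
    intro ζ; rw [WD]; ring
  simp_rw [e]
  rw [integral_const_mul, integral_add (hi _) ((hi _).const_mul _), integral_const_mul]
  ring

lemma slice_contDiff {φ : (Fin n → ℂ) → ℂ} (h : ContDiff ℝ (⊤ : ℕ∞) φ) (k : Fin n) (z : Fin n → ℂ) :
    ContDiff ℝ (⊤ : ℕ∞) (fun ζ => φ (Function.update z k ζ)) :=
  h.comp (contDiff_update _ z k)

lemma slice_tsupport {φ : (Fin n → ℂ) → ℂ} (k : Fin n) (z : Fin n → ℂ) :
    tsupport (fun ζ => φ (Function.update z k ζ)) ⊆ {ζ | Function.update z k ζ ∈ tsupport φ} := by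
  apply closure_minimal
  · intro ζ hζ; exact subset_tsupport _ hζ
  · exact (isClosed_tsupport φ).preimage (continuous_const.update k continuous_id)

lemma slice_compact {φ : (Fin n → ℂ) → ℂ} (hc : HasCompactSupport φ) (k : Fin n) (z : Fin n → ℂ) :
    HasCompactSupport (fun ζ => φ (Function.update z k ζ)) := by
  apply IsCompact.of_isClosed_subset (hc.isCompact.image (continuous_apply k)) (isClosed_tsupport _)
  intro ζ hζ
  exact ⟨_, slice_tsupport k z hζ, by simp⟩

/-- Cauchy–Pompeiu -/
lemma TK_dbar (k : Fin n) {φ : (Fin n → ℂ) → ℂ} (h : ContDiff ℝ (⊤ : ℕ∞) φ) (hc : HasCompactSupport φ) (z : Fin n → ℂ) :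
    TK k (WD Complex.I k φ) z = φ z := by
  have h1 := cauchy_pompeiu (fun ζ => φ (Function.update z k ζ)) (slice_contDiff h k z) (slice_compact hc k z) (z k)
  simp only [Function.update_eq_self] at h1
  rw [TK]
  have e : ∀ ζ : ℂ, WD Complex.I k φ (z - (Pi.single k ζ : Fin n → ℂ)) * ζ⁻¹ = dbar1 (fun ζ => φ (Function.update z k ζ)) (z k - ζ) * ζ⁻¹ := by
    intro ζ
    rw [dbar1_line (h.differentiable (by simp)), sub_single_eq]
  simp_rw [e]
  rw [h1, ← mul_assoc, inv_mul_cancel₀ (by exact_mod_cast Real.pi_ne_zero), one_mul]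

/-- cutoff of the transform is a test function -/
lemma TK_cutoff_test (k : Fin n) {z0 : Fin n → ℂ} {R : ℝ} {φ : (Fin n → ℂ) → ℂ} (hφ : Tst (ball z0 R) φ)
    {χ : ℂ → ℂ} (hχ : ContDiff ℝ (⊤ : ℕ∞) χ) (hχc : HasCompactSupport χ) (hχs : tsupport χ ⊆ ball (z0 k) R) :
    Tst (ball z0 R) (fun z => χ (z k) * TK k φ z) := by
  have hsm : ContDiff ℝ (⊤ : ℕ∞) (fun z : Fin n → ℂ => χ (z k) * TK k φ z) :=
    (hχ.comp (contDiff_apply ℝ ℂ k)).mul (TK_contDiff k hφ.1 hφ.2.1)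
  set Kc : Set (Fin n → ℂ) := (fun p : (Fin n → ℂ) × ℂ => Function.update p.1 k p.2) '' (tsupport φ ×ˢ tsupport χ) with hK
  have hKc : IsCompact Kc := (hφ.2.1.isCompact.prod hχc.isCompact).image (continuous_upd k)
  have hsub : tsupport (fun z : Fin n → ℂ => χ (z k) * TK k φ z) ⊆ Kc := by
    apply closure_minimal _ hKc.isClosed
    intro z hz
    have hz' : χ (z k) * TK k φ z ≠ 0 := hz
    have h1 : χ (z k) ≠ 0 := left_ne_zero_of_mul hz'
    have h2 : TK k φ z ≠ 0 := right_ne_zero_of_mul hz'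
    have h3 : ∃ ζ : ℂ, φ (z - (Pi.single k ζ : Fin n → ℂ)) ≠ 0 := by
      by_contra hcon
      push Not at hcon
      apply h2
      simp [TK, hcon]
    obtain ⟨ζ, hζ⟩ := h3
    refine ⟨(z - (Pi.single k ζ : Fin n → ℂ), z k), ⟨subset_tsupport _ hζ, subset_tsupport _ h1⟩, ?_⟩
    simp [sub_single_eq]
  refine ⟨hsm, hKc.of_isClosed_subset (isClosed_tsupport _) hsub, hsub.trans ?_⟩
  rintro _ ⟨⟨w, ζ⟩, ⟨hw, hζ⟩, rfl⟩
  have hw' := hφ.2.2 hw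
  have hζ' := hχs hζ
  simp only [mem_ball] at hw' hζ' ⊢
  have hR : 0 < R := dist_nonneg.trans_lt hw'
  rw [dist_pi_lt_iff hR]
  intro i
  by_cases hi : i = k
  · subst hi; simpa using hζ'
  · simpa [hi] using (dist_le_pi_dist w z0 i).trans_lt hw'
end TKs
end

section

section dolb
variable {n : ℕ}

lemma enorm_inv_le (ζ : ℂ) : ‖ζ⁻¹‖ₑ ≤ ‖ζ‖ₑ⁻¹ := by
  by_cases h : ζ = 0
  · simp [h]
  · rw [enorm_inv h]

lemma enorm_le_one_of {x : ℂ} (h : ‖x‖ ≤ 1) : ‖x‖ₑ ≤ 1 := by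
  rw [← ofReal_norm]; exact ENNReal.ofReal_le_one.2 h

lemma TK_enorm_le (k : Fin n) (H : (Fin n → ℂ) → ℂ) (z : Fin n → ℂ) :
    ‖TK k H z‖ₑ ≤ ‖(Real.pi : ℂ)⁻¹‖ₑ * ∫⁻ ζ, ‖H (Function.update z k ζ)‖ₑ * ‖z k - ζ‖ₑ⁻¹ := by
  rw [TK, enorm_mul]
  gcongr
  refine (enorm_integral_le_lintegral_enorm _).trans ?_
  rw [← lintegral_sub_left_eq_self (fun ζ => ‖H (z - (Pi.single k ζ : Fin n → ℂ)) * ζ⁻¹‖ₑ) (z k)]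
  apply lintegral_mono
  intro ζ
  simp only [enorm_mul, sub_single_eq, sub_sub_cancel]
  gcongr
  exact enorm_inv_le _

/-- Uniform bound of the Cauchy potential on the lines. -/
def P1 (j : Fin n) (B : (Fin n → ℂ) → ℂ) (N : ENNReal) : Prop :=
  ∀ (x : Fin n → ℂ) (a : ℂ), ∫⁻ ζ, ‖B (Function.update x j ζ)‖ₑ * ‖a - ζ‖ₑ⁻¹ ≤ N

def Good (j : Fin n) (B : (Fin n → ℂ) → ℂ) : Prop :=
  Measurable B ∧ Integrable B ∧ ∃ N : ENNReal, N ≠ ⊤ ∧ P1 j B N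

def WClosed (V : Set (Fin n → ℂ)) (B : Fin n → (Fin n → ℂ) → ℂ) : Prop :=
  ∀ j k φ, Tst V φ → ∫ z, B j z * WD Complex.I k φ z = ∫ z, B k z * WD Complex.I j φ z

lemma bump_exists (c : ℂ) {a b : ℝ} (ha : 0 < a) (hab : a < b) : ∃ χ : ℂ → ℂ, ContDiff ℝ (⊤ : ℕ∞) χ ∧
    HasCompactSupport χ ∧ tsupport χ ⊆ ball c b ∧ (∀ z ∈ ball c a, χ z = 1) ∧ ∀ z, ‖χ z‖ ≤ 1 := by
  let g : ContDiffBump c := ⟨a, (a + b) / 2, ha, by linarith⟩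
  refine ⟨fun z => (g z : ℂ), ?_, ?_, ?_, ?_, ?_⟩
  · exact Complex.ofRealCLM.contDiff.comp g.contDiff
  · exact g.hasCompactSupport.comp_left (g := fun x : ℝ => (x : ℂ)) (by simp)
  · refine (closure_mono (Function.support_comp_subset (g := fun x : ℝ => (x : ℂ)) (by simp) g)).trans ?_
    have := g.tsupport_eq
    rw [tsupport] at this; rw [this]
    exact closedBall_subset_ball (by change (a+b)/2 < b; linarith)
  · intro z hz
    simp [g.one_of_mem_closedBall (ball_subset_closedBall hz)]
  · intro z
    simp only [Complex.norm_real, Real.norm_eq_abs, abs_of_nonneg g.nonneg]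
    exact g.le_one

lemma dbar1_smooth {χ : ℂ → ℂ} (h : ContDiff ℝ (⊤ : ℕ∞) χ) : Continuous (dbar1 χ) := by
  have := h.continuous_fderiv (by simp)
  unfold dbar1
  exact continuous_const.mul ((this.clm_apply continuous_const).add (continuous_const.mul (this.clm_apply continuous_const)))

lemma dbar1_tsupport (χ : ℂ → ℂ) {z : ℂ} (hz : z ∉ tsupport χ) : dbar1 χ z = 0 := by
  have : fderiv ℝ χ z = 0 := by
    by_contra hh
    exact hz (support_fderiv_subset ℝ hh)
  simp [dbar1, this]

lemma Tst.bdd {V : Set (Fin n → ℂ)} {φ : (Fin n → ℂ) → ℂ} (h : Tst V φ) : ∃ C : ℝ, ∀ z, ‖φ z‖ ≤ C :=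
  h.2.1.exists_bound_of_continuous h.1.continuous

lemma Tst.zero {V : Set (Fin n → ℂ)} {φ : (Fin n → ℂ) → ℂ} (h : Tst V φ) {z} (hz : z ∉ V) : φ z = 0 :=
  image_eq_zero_of_notMem_tsupport fun hh => hz (h.2.2 hh)

lemma Tst.integrable_mul {V : Set (Fin n → ℂ)} {φ B : (Fin n → ℂ) → ℂ} (h : Tst V φ) (hB : Integrable B) :
    Integrable (fun z => B z * φ z) := by
  obtain ⟨C, hC⟩ := h.bdd
  exact hB.mul_bdd (c := C) h.1.continuous.aestronglyMeasurable (ae_of_all _ hC)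

lemma Tst.integrable_mul_bdd {V : Set (Fin n → ℂ)} {φ u : (Fin n → ℂ) → ℂ} (h : Tst V φ) (hu : Measurable u)
    {C : ℝ} (hC : ∀ z, ‖u z‖ ≤ C) :
    Integrable (fun z => u z * φ z) := by
  have := h.1.continuous.integrable_of_hasCompactSupport h.2.1 (μ := volume)
  exact this.bdd_mul hu.aestronglyMeasurable (ae_of_all _ hC)

lemma dolb_step (k : Fin n) (z0 : Fin n → ℂ) {mid R : ℝ} (h0 : 0 < mid) (hmR : mid < R)
    (B : Fin n → (Fin n → ℂ) → ℂ) (hB : ∀ j, Good j (B j)) (hcl : WClosed (ball z0 R) B) :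
    ∃ u1 : (Fin n → ℂ) → ℂ, Measurable u1 ∧ (∃ C : ℝ, ∀ z, ‖u1 z‖ ≤ C) ∧
      ∃ B' : Fin n → (Fin n → ℂ) → ℂ, (∀ j, Good j (B' j)) ∧ B' k = 0 ∧ (∀ j, B j = 0 → B' j = 0) ∧
      ∀ j φ, Tst (ball z0 mid) φ → ∫ z, u1 z * WD Complex.I j φ z = - (∫ z, B j z * φ z) + ∫ z, B' j z * φ z := by
  obtain ⟨χ, hχ, hχc, hχs, hχ1, hχb⟩ := bump_exists (z0 k) h0 hmR
  have hpk : Continuous (fun z : Fin n → ℂ => z k) := continuous_apply k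
  have hdc : Continuous (dbar1 χ) := dbar1_smooth hχ
  obtain ⟨Cd, hCd⟩ : ∃ C : ℝ, ∀ z, ‖dbar1 χ z‖ ≤ C := by
    have : HasCompactSupport (dbar1 χ) := by
      apply hχc.mono'
      intro z hz
      by_contra hh
      exact hz (dbar1_tsupport χ hh)
    exact this.exists_bound_of_continuous hdc
  have hCd0 : 0 ≤ Cd := (norm_nonneg _).trans (hCd 0)
  -- u1
  set H : (Fin n → ℂ) → ℂ := fun z => B k z * χ (z k) with hH
  have hHm : Measurable H := (hB k).1.mul (hχ.continuous.comp hpk).measurable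
  have hHi : Integrable H := (hB k).2.1.mul_bdd (c := 1) (hχ.continuous.comp hpk).aestronglyMeasurable (ae_of_all _ fun z => hχb _)
  obtain ⟨N, hN, hP⟩ := (hB k).2.2
  have hu1b : ∀ z, ‖TK k H z‖ ≤ (‖(Real.pi : ℂ)⁻¹‖ₑ * N).toReal := by
    intro z
    rw [← toReal_enorm]
    apply ENNReal.toReal_mono (by finiteness)
    refine (TK_enorm_le k H z).trans ?_
    gcongr
    refine le_trans (lintegral_mono fun ζ => ?_) (hP z (z k))
    gcongr
    simp only [hH, enorm_mul]
    calc _ ≤ ‖B k (Function.update z k ζ)‖ₑ * 1 := by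
          gcongr
          exact enorm_le_one_of (hχb _)
      _ = _ := mul_one _
  -- B'
  set G : Fin n → (Fin n → ℂ) → ℂ := fun j z => B j z * dbar1 χ (z k) with hG
  have hGm : ∀ j, Measurable (G j) := fun j => (hB j).1.mul (hdc.comp hpk).measurable
  have hGi : ∀ j, Integrable (G j) := fun j => (hB j).2.1.mul_bdd (c := Cd) (hdc.comp hpk).aestronglyMeasurable (ae_of_all _ fun z => hCd _)
  set ib : (Fin n → ℂ) → ℂ := (ball z0 R).indicator 1 with hib
  have hibm : Measurable ib := measurable_one.indicator measurableSet_ball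
  have hibb : ∀ z, ‖ib z‖ ≤ 1 := by
    intro z; by_cases hz : z ∈ ball z0 R <;> simp [hib, hz]
  have hibz : ∀ z, z ∉ ball z0 R → ib z = 0 := fun z hz => indicator_of_notMem hz _
  have hib1 : ∀ z, z ∈ ball z0 R → ib z = 1 := fun z hz => indicator_of_mem hz _
  refine ⟨TK k H, TK_measurable k H hHm, ⟨_, hu1b⟩, fun j => if j = k then 0 else fun z => TK k (G j) z * ib z, ?_, by simp, ?_, ?_⟩
  · intro j
    by_cases hjk : j = k
    · simp only [hjk, if_true]
      exact ⟨measurable_const, integrable_zero _ _ _, 0, by simp, fun x a => by simp⟩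
    simp only [hjk, if_false]
    refine ⟨(TK_measurable k _ (hGm j)).mul hibm, (TK_pairing k z0 R (G j) (hGm j) (hGi j) ib hibm 1 hibb hibz).1, ?_⟩
    obtain ⟨N, hN, hP⟩ := (hB j).2.2
    obtain ⟨C, hC, hC'⟩ := cauchy_kernel_loc R
    refine ⟨‖(Real.pi : ℂ)⁻¹‖ₑ * (ENNReal.ofReal Cd * C * N), by finiteness, ?_⟩
    intro x a
    have hupd : ∀ ζ w, Function.update (Function.update x j ζ) k w = Function.update (Function.update x k w) j ζ := by
      intro ζ w; exact Function.update_comm hjk _ _ _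
    have mB : Measurable (fun p : ℂ × ℂ => B j (Function.update (Function.update x k p.2) j p.1)) := by
      apply (hB j).1.comp
      exact (((continuous_const.update k continuous_snd)).update j continuous_fst).measurable
    have hle : ∀ ζ : ℂ, ‖TK k (G j) (Function.update x j ζ) * ib (Function.update x j ζ)‖ₑ ≤
        ‖(Real.pi : ℂ)⁻¹‖ₑ * ∫⁻ w, ‖B j (Function.update (Function.update x k w) j ζ)‖ₑ * (‖dbar1 χ w‖ₑ * ‖x k - w‖ₑ⁻¹) := by
      intro ζ
      rw [enorm_mul]
      calc _ ≤ ‖TK k (G j) (Function.update x j ζ)‖ₑ * 1 := by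
            gcongr
            exact enorm_le_one_of (hibb _)
        _ ≤ _ := by
          rw [mul_one]
          refine (TK_enorm_le k _ _).trans (le_of_eq ?_)
          congr 1
          apply lintegral_congr
          intro w
          simp only [hG, enorm_mul, hupd]
          have e1 : Function.update x j ζ k = x k := by rw [Function.update_of_ne (Ne.symm hjk)]
          have e2 : Function.update (Function.update x k w) j ζ k = w := by
            rw [Function.update_of_ne (Ne.symm hjk)]; simp
          rw [e1, e2, mul_assoc]
    calc ∫⁻ ζ, ‖TK k (G j) (Function.update x j ζ) * ib (Function.update x j ζ)‖ₑ * ‖a - ζ‖ₑ⁻¹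
        ≤ ∫⁻ ζ, (‖(Real.pi : ℂ)⁻¹‖ₑ * ∫⁻ w, ‖B j (Function.update (Function.update x k w) j ζ)‖ₑ * (‖dbar1 χ w‖ₑ * ‖x k - w‖ₑ⁻¹)) * ‖a - ζ‖ₑ⁻¹ := by
          gcongr with ζ; exact hle ζ
      _ = ‖(Real.pi : ℂ)⁻¹‖ₑ * ∫⁻ ζ, ∫⁻ w, (‖B j (Function.update (Function.update x k w) j ζ)‖ₑ * (‖dbar1 χ w‖ₑ * ‖x k - w‖ₑ⁻¹)) * ‖a - ζ‖ₑ⁻¹ := by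
          rw [← lintegral_const_mul' _ _ (by finiteness)]
          apply lintegral_congr; intro ζ
          rw [mul_assoc, lintegral_mul_const]
          apply Measurable.mul
          · exact (mB.comp (measurable_const.prodMk measurable_id)).enorm
          · exact (hdc.measurable.enorm).mul ((measurable_const.sub measurable_id).enorm.inv)
      _ = ‖(Real.pi : ℂ)⁻¹‖ₑ * ∫⁻ w, ∫⁻ ζ, (‖B j (Function.update (Function.update x k w) j ζ)‖ₑ * (‖dbar1 χ w‖ₑ * ‖x k - w‖ₑ⁻¹)) * ‖a - ζ‖ₑ⁻¹ := by
          congr 1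
          apply lintegral_lintegral_swap
          apply Measurable.aemeasurable
          apply Measurable.mul
          · apply mB.enorm.mul
            exact ((hdc.measurable.comp measurable_snd).enorm).mul ((measurable_const.sub measurable_snd).enorm.inv)
          · exact ((measurable_const.sub measurable_fst).enorm.inv)
      _ ≤ ‖(Real.pi : ℂ)⁻¹‖ₑ * ∫⁻ w, (‖dbar1 χ w‖ₑ * ‖x k - w‖ₑ⁻¹) * N := by
          gcongr with w
          have : ∀ ζ, (‖B j (Function.update (Function.update x k w) j ζ)‖ₑ * (‖dbar1 χ w‖ₑ * ‖x k - w‖ₑ⁻¹)) * ‖a - ζ‖ₑ⁻¹ =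
            (‖dbar1 χ w‖ₑ * ‖x k - w‖ₑ⁻¹) * (‖B j (Function.update (Function.update x k w) j ζ)‖ₑ * ‖a - ζ‖ₑ⁻¹) := fun ζ => by ring
          simp_rw [this]
          rw [lintegral_const_mul]
          · gcongr; exact hP _ _
          · exact (mB.comp (measurable_id.prodMk measurable_const)).enorm.mul ((measurable_const.sub measurable_id).enorm.inv)
      _ ≤ _ := by
          gcongr
          rw [lintegral_mul_const' _ _ hN]
          gcongr
          calc ∫⁻ w, ‖dbar1 χ w‖ₑ * ‖x k - w‖ₑ⁻¹ ≤ ∫⁻ w, (ball (z0 k) R).indicator (fun w => ENNReal.ofReal Cd * ‖x k - w‖ₑ⁻¹) w := by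
                gcongr with w
                by_cases hw : w ∈ ball (z0 k) R
                · rw [indicator_of_mem hw]
                  gcongr
                  rw [← ofReal_norm]; exact ENNReal.ofReal_le_ofReal (hCd _)
                · rw [dbar1_tsupport χ (fun hh => hw (hχs hh))]; simp
            _ ≤ _ := by
                rw [lintegral_indicator measurableSet_ball, lintegral_const_mul' _ _ ENNReal.ofReal_ne_top]
                gcongr
                exact hC' _ _
  · intro j hj
    by_cases hjk : j = k
    · simp [hjk]
    simp only [hjk, if_false]
    ext z
    simp [hG, hj, TK]
  · intro j φ hφ
    have hφR : Tst (ball z0 R) φ := hφ.mono (ball_subset_ball hmR.le)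
    have hW := hφ.WD Complex.I j
    obtain ⟨C, hC⟩ := hW.bdd
    have h1 := (TK_pairing k z0 mid H hHm hHi _ hW.1.continuous.measurable C hC (fun z hz => hW.zero hz)).2
    rw [h1]
    have hT := TK_contDiff k hφ.1 hφ.2.1
    by_cases hjk : j = k
    · simp only [hjk, if_true, Pi.zero_apply, zero_mul, integral_zero, add_zero, neg_inj]
      congr 1; ext z
      rw [TK_dbar k hφ.1 hφ.2.1]
      by_cases hz : z ∈ ball z0 mid
      · simp [hH, hχ1 _ (dist_coord_le hz k)]
      · simp [hφ.zero hz]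
    · simp only [hjk, if_false]
      have hψ := TK_cutoff_test k hφR hχ hχc hχs
      have e1 : ∀ z, H z * TK k (WD Complex.I j φ) z = B k z * WD Complex.I j (fun z => χ (z k) * TK k φ z) z := by
        intro z
        rw [WD_mul (φ := fun z : Fin n → ℂ => χ (z k)) ((hχ.comp (contDiff_apply ℝ ℂ k)).differentiable (by simp) z) (hT.differentiable (by simp) z),
          WD_coord (hχ.differentiable (by simp)), if_neg hjk, TK_WD k j _ hφ.1 hφ.2.1]
        simp [hH]; ring
      simp_rw [e1]
      rw [← hcl j k _ hψ]
      have e2 : ∀ z, B j z * WD Complex.I k (fun z => χ (z k) * TK k φ z) z = B j z * φ z + G j z * TK k φ z := by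
        intro z
        rw [WD_mul (φ := fun z : Fin n → ℂ => χ (z k)) ((hχ.comp (contDiff_apply ℝ ℂ k)).differentiable (by simp) z) (hT.differentiable (by simp) z),
          WD_coord (hχ.differentiable (by simp)), if_pos rfl, TK_WD k k _ hφ.1 hφ.2.1, TK_dbar k hφ.1 hφ.2.1]
        by_cases hz : z ∈ ball z0 mid
        · simp [hG, hχ1 _ (dist_coord_le hz k)]; ring
        · simp [hG, hφ.zero hz]; ring
      have hi1 := hφ.integrable_mul (hB j).2.1
      have hi2 : Integrable (fun z => G j z * TK k φ z) := by
        have := (hψ.WD Complex.I k).integrable_mul (hB j).2.1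
        simp_rw [e2] at this
        refine (this.sub hi1).congr (ae_of_all _ fun z => ?_)
        simp
      simp_rw [e2]
      rw [integral_add hi1 hi2]
      obtain ⟨C', hC'⟩ := hφ.bdd
      have h2 := (TK_pairing k z0 mid (G j) (hGm j) (hGi j) φ hφ.1.continuous.measurable C' hC' (fun z hz => hφ.zero hz)).2
      have e3 : ∀ z, TK k (G j) z * ib z * φ z = TK k (G j) z * φ z := by
        intro z
        by_cases hz : z ∈ ball z0 R
        · simp [hib1 z hz]
        · simp [hφR.zero hz]
      simp_rw [e3]
      rw [h2]; ring

theorem weak_dolbeault (z0 : Fin n → ℂ) (S : Finset (Fin n)) : ∀ (r R : ℝ), 0 < r → r < R →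
    ∀ B : Fin n → (Fin n → ℂ) → ℂ, (∀ j, Good j (B j)) → (∀ j, j ∉ S → B j = 0) → WClosed (ball z0 R) B →
    ∃ u : (Fin n → ℂ) → ℂ, Measurable u ∧ (∃ C : ℝ, ∀ z, ‖u z‖ ≤ C) ∧
      ∀ j φ, Tst (ball z0 r) φ → ∫ z, u z * WD Complex.I j φ z = - ∫ z, B j z * φ z := by
  induction S using Finset.induction_on with
  | empty =>
    intro r R _ _ B _ h _
    refine ⟨0, measurable_const, ⟨0, by simp⟩, ?_⟩
    intro j φ _
    simp [h j (by simp)]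
  | insert k S hk ih =>
    intro r R hr hrR B hB h hcl
    obtain ⟨u1, hu1, ⟨C1, hC1⟩, B', hB', hk', hz', hE⟩ := dolb_step k z0 (mid := (r + R) / 2) (R := R) (by linarith) (by linarith) B hB hcl
    obtain ⟨u2, hu2, ⟨C2, hC2⟩, hE2⟩ := ih r ((r + R) / 2) hr (by linarith) B' hB' (by
      intro j hj
      by_cases hjk : j = k
      · rw [hjk, hk']
      · exact hz' j (h j (by simp [hjk, hj]))) (by
      intro j l φ hφ
      have h1 := hE j _ (hφ.WD Complex.I l)
      have h2 := hE l _ (hφ.WD Complex.I j)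
      have h3 := hcl j l φ (hφ.mono (ball_subset_ball (by linarith)))
      have h4 : ∀ z, WD Complex.I j (WD Complex.I l φ) z = WD Complex.I l (WD Complex.I j φ) z := fun z => WD_comm hφ.1 z
      simp_rw [h4] at h1
      linear_combination h2 - h1 + h3)
    refine ⟨fun z => u1 z + u2 z, hu1.add hu2, ⟨C1 + C2, fun z => (norm_add_le _ _).trans (add_le_add (hC1 z) (hC2 z))⟩, ?_⟩
    intro j φ hφ
    have hW := hφ.WD Complex.I j
    simp_rw [add_mul]
    rw [integral_add (hW.integrable_mul_bdd hu1 hC1) (hW.integrable_mul_bdd hu2 hC2), hE2 j φ hφ,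
      hE j φ (hφ.mono (ball_subset_ball (by linarith)))]
    ring
end dolb
end

section

section molgen
variable {G : Type*} [NormedAddCommGroup G] [NormedSpace ℝ G] [FiniteDimensional ℝ G] [MeasureSpace G] [BorelSpace G]
  [(volume : Measure G).IsAddHaarMeasure]

/-- standard bumps -/
def rho (G : Type*) [NormedAddCommGroup G] [NormedSpace ℝ G] (m : ℕ) : ContDiffBump (0 : G) :=
  ⟨1 / (2 * ((m:ℝ) + 1)), 1 / ((m:ℝ) + 1), by positivity, by
    have : (0:ℝ) < m + 1 := by positivity
    rw [one_div_lt_one_div (by positivity) this]; linarith⟩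

lemma rho_rOut (m : ℕ) : (rho G m).rOut = 1 / ((m:ℝ) + 1) := rfl

lemma rho_tendsto : Filter.Tendsto (fun m => (rho G m).rOut) Filter.atTop (nhds 0) := by
  simp only [rho_rOut]
  exact tendsto_one_div_add_atTop_nhds_zero_nat

def rk (G : Type*) [NormedAddCommGroup G] [NormedSpace ℝ G] [FiniteDimensional ℝ G] [MeasureSpace G] (m : ℕ) : G → ℝ :=
  (rho G m).normed volume

lemma rk_nonneg (m : ℕ) (x : G) : 0 ≤ rk G m x := (rho G m).nonneg_normed x
lemma rk_contDiff (m : ℕ) : ContDiff ℝ (⊤ : ℕ∞) (rk G m) := (rho G m).contDiff_normed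
lemma rk_compact (m : ℕ) : HasCompactSupport (rk G m) := (rho G m).hasCompactSupport_normed
lemma rk_neg (m : ℕ) (x : G) : rk G m (-x) = rk G m x := (rho G m).normed_neg x
lemma rk_integral (m : ℕ) : ∫ x, rk G m x = 1 := (rho G m).integral_normed
lemma rk_continuous (m : ℕ) : Continuous (rk G m) := (rho G m).continuous_normed
lemma rk_zero (m : ℕ) {x : G} (hx : 1 / ((m:ℝ) + 1) ≤ ‖x‖) : rk G m x = 0 := by
  have : x ∉ Function.support (rk G m) := by
    rw [rk, ContDiffBump.support_normed_eq]; simpa [rho_rOut] using hx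
  simpa using this
lemma rk_tsupport (m : ℕ) : tsupport (rk G m) = closedBall 0 (1 / ((m:ℝ) + 1)) := (rho G m).tsupport_normed_eq
lemma rk_integrable (m : ℕ) : Integrable (rk G m) := (rho G m).integrable_normed
lemma rk_lintegral (m : ℕ) : ∫⁻ x, ‖rk G m x‖ₑ = 1 := by
  have := rk_integral (G := G) m
  rw [integral_eq_lintegral_of_nonneg_ae (ae_of_all _ (rk_nonneg m)) (rk_integrable m).1] at this
  have h2 : ∫⁻ x, ‖rk G m x‖ₑ = ∫⁻ x, ENNReal.ofReal (rk G m x) := by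
    apply lintegral_congr; intro x; rw [Real.enorm_eq_ofReal (rk_nonneg m x)]
  rw [h2, ← ENNReal.toReal_eq_one_iff]; exact this

/-- mollification -/
def mol (m : ℕ) (g : G → ℂ) (z : G) : ℂ := ∫ t, (rk G m t : ℂ) * g (z - t)

lemma mol_conv (m : ℕ) (g : G → ℂ) : mol m g = convolution (rk G m) g (ContinuousLinearMap.lsmul ℝ ℝ) volume := by
  ext z
  simp [mol, convolution]

lemma mol_swap (m : ℕ) (g : G → ℂ) (z : G) : mol m g z = ∫ y, (rk G m (z - y) : ℂ) * g y := by
  rw [mol, ← integral_sub_left_eq_self _ volume z]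
  simp

lemma mol_contDiff (m : ℕ) {g : G → ℂ} (hg : LocallyIntegrable g) : ContDiff ℝ (⊤ : ℕ∞) (mol m g) := by
  rw [mol_conv]
  exact HasCompactSupport.contDiff_convolution_left _ (rk_compact m) (rk_contDiff m) hg

lemma loc_mul_integrable {g : G → ℂ} (hg : LocallyIntegrable g) {w : G → ℂ} (hw : Continuous w) (hc : HasCompactSupport w) :
    Integrable (fun y => w y * g y) := by
  have := hg.integrable_smul_left_of_hasCompactSupport hw hc
  simpa using this

lemma shift_compact {w : G → ℂ} (hc : HasCompactSupport w) (z : G) : HasCompactSupport (fun y => w (z - y)) :=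
  hc.comp_homeomorph (Homeomorph.subLeft z)

lemma mol_fderiv (m : ℕ) {g : G → ℂ} (hg : LocallyIntegrable g) (z v : G) :
    fderiv ℝ (mol m g) z v = ∫ y, (fderiv ℝ (rk G m) (z - y) v : ℂ) * g y := by
  have h := HasCompactSupport.hasFDerivAt_convolution_left (𝕜 := ℝ) (μ := volume) (ContinuousLinearMap.lsmul ℝ ℝ) (rk_compact m) ((rk_contDiff (G := G) m).of_le (by norm_cast)) hg z
  rw [mol_conv, h.fderiv, convolution_eq_swap]
  rw [ContinuousLinearMap.integral_apply]
  · congr 1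
  · have := ((rk_compact (G := G) m).fderiv ℝ).convolutionExists_left (μ := volume) (ContinuousLinearMap.precompL G (ContinuousLinearMap.lsmul ℝ ℝ : ℝ →L[ℝ] ℂ →L[ℝ] ℂ)) ((rk_contDiff (G := G) m).continuous_fderiv (by simp)) hg z
    exact this.integrable_swap

lemma mol_bound (m : ℕ) {g : G → ℂ} {C : ℝ} (hC : ∀ z, ‖g z‖ ≤ C) (z : G) : ‖mol m g z‖ ≤ C := by
  have hC0 : 0 ≤ C := (norm_nonneg _).trans (hC 0)
  calc ‖mol m g z‖ ≤ ∫ t, rk G m t * C := by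
        apply norm_integral_le_of_norm_le ((rk_integrable m).mul_const C)
        refine ae_of_all _ fun t => ?_
        rw [norm_mul, Complex.norm_real, Real.norm_of_nonneg (rk_nonneg m t)]
        exact mul_le_mul_of_nonneg_left (hC _) (rk_nonneg m t)
    _ = C := by rw [integral_mul_const, rk_integral, one_mul]

lemma mol_pairing (m : ℕ) {g ψ : G → ℂ} (hg : Integrable g) (hψ : Integrable ψ) {C : ℝ} (hC : ∀ z, ‖ψ z‖ ≤ C) :
    ∫ z, ψ z * mol m g z = ∫ z, mol m ψ z * g z := by
  have hk := Integrable.convolution_integrand (ContinuousLinearMap.mul ℝ ℂ) (μ := volume) (ν := volume) hg ((rk_integrable (G := G) m).ofReal (𝕜 := ℂ))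
  have hk2 : Integrable (fun p : G × G => ψ p.1 * ((rk G m (p.1 - p.2) : ℂ) * g p.2)) (volume.prod volume) := by
    have : Integrable (fun p : G × G => ψ p.1 * (g p.2 * (rk G m (p.1 - p.2) : ℂ))) (volume.prod volume) :=
      hk.bdd_mul (c := C) (f := fun p : G × G => ψ p.1) hψ.1.comp_fst (ae_of_all _ fun p => hC _)
    refine this.congr (ae_of_all _ fun p => ?_)
    simp only []; ring
  have e1 : ∫ z, ψ z * mol m g z = ∫ z, ∫ y, ψ z * ((rk G m (z - y) : ℂ) * g y) := by
    congr 1; ext z; rw [mol_swap, integral_const_mul]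
  have e2 : ∫ z, mol m ψ z * g z = ∫ y, ∫ z, ψ z * ((rk G m (z - y) : ℂ) * g y) := by
    congr 1; ext y; rw [mol_swap, ← integral_mul_const]
    congr 1; ext z
    rw [← rk_neg m (z - y), neg_sub]; ring
  rw [e1, e2, integral_integral_swap hk2]

lemma mol_integrable (m : ℕ) {g : G → ℂ} (hg : Integrable g) : Integrable (mol m g) := by
  rw [mol_conv]
  exact (rk_integrable m).integrable_convolution _ hg

/-- continuous convergence -/
def CC (ψ : ℕ → G → ℂ) (ψ' : G → ℂ) (y : G) : Prop :=
  Filter.Tendsto (fun p : ℕ × G => ψ p.1 p.2) (Filter.atTop ×ˢ nhds y) (nhds (ψ' y))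

lemma mol_CC {ψ : ℕ → G → ℂ} {ψ' : G → ℂ} {y : G} (h : CC ψ ψ' y) (hm : ∀ m, AEStronglyMeasurable (ψ m) volume) :
    CC (fun m => mol m (ψ m)) ψ' y := by
  unfold CC
  have := ContDiffBump.convolution_tendsto_right (μ := (volume : Measure G)) (ι := ℕ × G) (φ := fun p => rho G p.1) (g := fun p => ψ p.1)
    (k := fun p => p.2) (l := Filter.atTop ×ˢ nhds y) (x₀ := y) (z₀ := ψ' y) (rho_tendsto.comp Filter.tendsto_fst)
    (Filter.Eventually.of_forall fun p => hm _) ?_ Filter.tendsto_snd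
  · simp_rw [mol_conv]; exact this
  · have h2 : Filter.Tendsto (fun q : (ℕ × G) × G => (q.1.1, q.2)) ((Filter.atTop ×ˢ nhds y) ×ˢ nhds y) (Filter.atTop ×ˢ nhds y) :=
      (Filter.tendsto_fst.comp Filter.tendsto_fst).prodMk Filter.tendsto_snd
    exact h.comp h2

lemma CC.tendsto {ψ : ℕ → G → ℂ} {ψ' : G → ℂ} {y : G} (h : CC ψ ψ' y) : Filter.Tendsto (fun m => ψ m y) Filter.atTop (nhds (ψ' y)) :=
  Filter.Tendsto.comp h (Filter.tendsto_id.prodMk tendsto_const_nhds)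

lemma CC_const {ψ : G → ℂ} {y : G} (h : ContinuousAt ψ y) : CC (fun _ => ψ) ψ y :=
  h.tendsto.comp Filter.tendsto_snd

/-- weak-strong pairing limit -/
lemma dual_limit {ψ : ℕ → G → ℂ} {ψ' A : G → ℂ} (hA : Integrable A) (hm : ∀ m, Integrable (ψ m))
    {C : ℝ} (hC : ∀ m z, ‖ψ m z‖ ≤ C) (hcc : ∀ y, CC ψ ψ' y) :
    Filter.Tendsto (fun m => ∫ z, ψ m z * mol m A z) Filter.atTop (nhds (∫ z, ψ' z * A z)) := by
  have e : ∀ m, ∫ z, ψ m z * mol m A z = ∫ z, mol m (ψ m) z * A z := fun m => mol_pairing m hA (hm m) (hC m)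
  simp_rw [e]
  apply tendsto_integral_of_dominated_convergence (fun z => C * ‖A z‖)
  · intro m
    exact (mol_contDiff m (hm m).locallyIntegrable).continuous.aestronglyMeasurable.mul hA.1
  · exact hA.norm.const_mul C
  · intro m
    refine ae_of_all _ fun z => ?_
    rw [norm_mul]
    exact mul_le_mul_of_nonneg_right (mol_bound m (hC m) z) (norm_nonneg _)
  · refine ae_of_all _ fun y => ?_
    exact (mol_CC (hcc y) (fun m => (hm m).1)).tendsto.mul_const _

lemma mol_sq (m : ℕ) {g : G → ℂ} (hg : LocallyIntegrable g) (hg2 : LocallyIntegrable (fun z => ((‖g z‖ ^ 2 : ℝ) : ℂ))) (z : G) :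
    ‖mol m g z‖ ^ 2 ≤ (mol m (fun z => ((‖g z‖ ^ 2 : ℝ) : ℂ)) z).re := by
  have hrc : Continuous (fun y : G => (rk G m (z - y) : ℂ)) := by
    exact Complex.continuous_ofReal.comp ((rk_continuous m).comp (continuous_const.sub continuous_id))
  have hrs : HasCompactSupport (fun y : G => (rk G m (z - y) : ℂ)) :=
    shift_compact (w := fun y => (rk G m y : ℂ)) ((rk_compact m).comp_left (g := fun x : ℝ => (x:ℂ)) (by simp)) z
  have i1 : Integrable (fun y => rk G m (z - y) * ‖g y‖) := by
    refine (loc_mul_integrable hg hrc hrs).norm.congr (ae_of_all _ fun y => ?_)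
    simp [abs_of_nonneg (rk_nonneg m _)]
  have i2 : Integrable (fun y => rk G m (z - y) * ‖g y‖ ^ 2) := by
    refine (loc_mul_integrable hg2 hrc hrs).norm.congr (ae_of_all _ fun y => ?_)
    simp [abs_of_nonneg (rk_nonneg m _)]
  have i0 : Integrable (fun y => rk G m (z - y)) := (rk_integrable m).comp_sub_left z
  have e0 : ∫ y, rk G m (z - y) = 1 := by rw [integral_sub_left_eq_self (rk G m)]; exact rk_integral m
  have e2 : (mol m (fun z => ((‖g z‖ ^ 2 : ℝ) : ℂ)) z).re = ∫ y, rk G m (z - y) * ‖g y‖ ^ 2 := by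
    rw [mol_swap]
    have : ∀ y, (rk G m (z - y) : ℂ) * ((‖g y‖ ^ 2 : ℝ) : ℂ) = ((rk G m (z - y) * ‖g y‖ ^ 2 : ℝ) : ℂ) := by intro y; push_cast; ring
    simp_rw [this]
    rw [integral_complex_ofReal, Complex.ofReal_re]
  have e1 : ‖mol m g z‖ ≤ ∫ y, rk G m (z - y) * ‖g y‖ := by
    rw [mol_swap]
    apply norm_integral_le_of_norm_le i1
    refine ae_of_all _ fun y => ?_
    simp [abs_of_nonneg (rk_nonneg m _)]
  set c := ∫ y, rk G m (z - y) * ‖g y‖ with hc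
  have h3 : 0 ≤ ∫ y, rk G m (z - y) * (‖g y‖ - c) ^ 2 := integral_nonneg fun y => mul_nonneg (rk_nonneg m _) (sq_nonneg _)
  have e4 : ∀ y, rk G m (z - y) * (‖g y‖ - c) ^ 2 = rk G m (z - y) * ‖g y‖ ^ 2 - (2 * c) * (rk G m (z - y) * ‖g y‖) + c ^ 2 * rk G m (z - y) := by
    intro y; ring
  simp_rw [e4] at h3
  have i3 : Integrable (fun y => rk G m (z - y) * ‖g y‖ ^ 2 - (2 * c) * (rk G m (z - y) * ‖g y‖)) := i2.sub (i1.const_mul _)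
  rw [integral_add i3 (i0.const_mul _), integral_sub i2 (i1.const_mul _), integral_const_mul, integral_const_mul, e0, ← hc] at h3
  rw [e2]
  have : ‖mol m g z‖ ^ 2 ≤ c ^ 2 := by gcongr
  nlinarith

lemma mol_ae {g : G → ℂ} (hg : LocallyIntegrable g) : ∀ᵐ z, Filter.Tendsto (fun m => mol m g z) Filter.atTop (nhds (g z)) := by
  have := ContDiffBump.ae_convolution_tendsto_right_of_locallyIntegrable (μ := (volume : Measure G)) (φ := fun m => rho G m) (K := 2) rho_tendsto
    (Filter.Eventually.of_forall fun m => by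
      change 1 / ((m:ℝ) + 1) ≤ 2 * (1 / (2 * ((m:ℝ) + 1)))
      apply le_of_eq; field_simp) hg
  simp_rw [mol_conv]; exact this

end molgen
end

section

section moln
variable {n : ℕ}

lemma mol_WD (m : ℕ) (j : Fin n) (z0 : Fin n → ℂ) (R : ℝ) {g H : (Fin n → ℂ) → ℂ} (hg : LocallyIntegrable g)
    (hw : ∀ φ, Tst (ball z0 R) φ → ∫ z, g z * WD Complex.I j φ z = - ∫ z, H z * φ z) (z : Fin n → ℂ)
    (hz : z ∈ ball z0 (R - 1 / ((m:ℝ) + 1))) : WD Complex.I j (mol m g) z = mol m H z := by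
  set φ : (Fin n → ℂ) → ℂ := fun y => (rk (Fin n → ℂ) m (z - y) : ℂ) with hφ
  have hsm : ContDiff ℝ (⊤ : ℕ∞) (fun y : Fin n → ℂ => (rk (Fin n → ℂ) m y : ℂ)) :=
    Complex.ofRealCLM.contDiff.comp (rk_contDiff m)
  have hφs : ContDiff ℝ (⊤ : ℕ∞) φ := hsm.comp (contDiff_const.sub contDiff_id)
  have hφc : HasCompactSupport φ :=
    shift_compact (w := fun y => (rk (Fin n → ℂ) m y : ℂ)) ((rk_compact m).comp_left (g := fun x : ℝ => (x:ℂ)) (by simp)) z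
  have hφt : Tst (ball z0 R) φ := by
    refine ⟨hφs, hφc, ?_⟩
    have : tsupport φ ⊆ closedBall z (1 / ((m:ℝ) + 1)) := by
      apply closure_minimal _ isClosed_closedBall
      intro y hy
      by_contra hh
      apply hy
      simp only [hφ, Complex.ofReal_eq_zero]
      apply rk_zero
      rw [mem_closedBall, not_le, dist_comm, dist_eq_norm] at hh
      exact hh.le
    refine this.trans (closedBall_subset_ball' ?_)
    rw [mem_ball] at hz; linarith
  have hfd : ∀ y v, fderiv ℝ φ y v = -(fderiv ℝ (rk (Fin n → ℂ) m) (z - y) v : ℂ) := by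
    intro y v
    have h1 : HasFDerivAt (rk (Fin n → ℂ) m) (fderiv ℝ (rk (Fin n → ℂ) m) (z - y)) (z - y) :=
      ((rk_contDiff m).differentiable (by simp) _).hasFDerivAt
    have h2 : HasFDerivAt (fun y : Fin n → ℂ => z - y) (-ContinuousLinearMap.id ℝ _) y := (hasFDerivAt_id y).const_sub z
    have h3 := Complex.ofRealCLM.hasFDerivAt.comp y (h1.comp y h2)
    have h4 : HasFDerivAt φ _ y := h3
    rw [h4.fderiv]; simp
  have h := hw φ hφt
  have i1 : ∀ v, Integrable (fun y => (fderiv ℝ (rk (Fin n → ℂ) m) (z - y) v : ℂ) * g y) := by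
    intro v
    have := loc_mul_integrable hg (w := fun y => fderiv ℝ φ y v) ((hφs.continuous_fderiv (by simp)).clm_apply continuous_const)
      (hφc.fderiv_apply ℝ v)
    refine this.neg.congr (ae_of_all _ fun y => ?_)
    simp [hfd]
  have e1 : WD Complex.I j (mol m g) z = - ∫ y, g y * WD Complex.I j φ y := by
    rw [WD, mol_fderiv m hg, mol_fderiv m hg, ← integral_const_mul, ← integral_add (i1 _) ((i1 _).const_mul _), ← integral_const_mul, ← integral_neg]
    congr 1; ext y
    rw [WD, hfd, hfd]; ring
  rw [e1, h, neg_neg, mol_swap]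
  congr 1; ext y; rw [mul_comm]

def Pot (q : ℝ) (K : ENNReal) (j : Fin n) (A : (Fin n → ℂ) → ℂ) : Prop :=
  ∀ (x : Fin n → ℂ) (a b : ℂ), a ≠ b → ∫⁻ ζ, ‖A (Function.update x j ζ)‖ₑ * ker2 a b ζ ≤ K * ‖a - b‖ₑ ^ (-(2 / q))

lemma upd_sub (x t : Fin n → ℂ) (j : Fin n) (ζ : ℂ) :
    Function.update x j ζ - t = Function.update (x - t) j (ζ - t j) := by
  ext i
  by_cases h : i = j
  · subst h; simp
  · simp [h]

lemma Pot_mol (m : ℕ) {q : ℝ} {K : ENNReal} {j : Fin n} {A : (Fin n → ℂ) → ℂ} (hA : Measurable A) (h : Pot q K j A) :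
    Pot q K j (mol m A) := by
  intro x a b hab
  have m1 : Measurable (fun p : ℂ × (Fin n → ℂ) => Function.update x j p.1 - p.2) :=
    ((continuous_const.update j continuous_fst).sub continuous_snd).measurable
  have mr : Measurable (fun t => ‖rk (Fin n → ℂ) m t‖ₑ) := (rk_continuous m).measurable.enorm
  calc ∫⁻ ζ, ‖mol m A (Function.update x j ζ)‖ₑ * ker2 a b ζ
      ≤ ∫⁻ ζ, ∫⁻ t, ‖rk (Fin n → ℂ) m t‖ₑ * ‖A (Function.update x j ζ - t)‖ₑ * ker2 a b ζ := by
        apply lintegral_mono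
        intro ζ
        simp only []
        rw [lintegral_mul_const]
        · gcongr
          refine (enorm_integral_le_lintegral_enorm _).trans (le_of_eq ?_)
          apply lintegral_congr; intro t
          rw [enorm_mul]; congr 1
          rw [← ofReal_norm, ← ofReal_norm]; simp
        · exact mr.mul ((hA.comp (m1.comp (measurable_const.prodMk measurable_id))).enorm)
    _ = ∫⁻ t, ∫⁻ ζ, ‖rk (Fin n → ℂ) m t‖ₑ * ‖A (Function.update x j ζ - t)‖ₑ * ker2 a b ζ := by
        apply lintegral_lintegral_swap
        apply Measurable.aemeasurable
        exact ((mr.comp measurable_snd).mul (hA.comp m1).enorm).mul ((ker2_measurable a b).comp measurable_fst)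
    _ ≤ ∫⁻ t, ‖rk (Fin n → ℂ) m t‖ₑ * (K * ‖a - b‖ₑ ^ (-(2 / q))) := by
        apply lintegral_mono
        intro t
        simp only [mul_assoc]
        rw [lintegral_const_mul' _ _ (by finiteness)]
        gcongr
        have := h (x - t) (a - t j) (b - t j) (by simpa using hab)
        rw [sub_sub_sub_cancel_right] at this
        refine le_trans (le_of_eq ?_) this
        rw [← lintegral_sub_right_eq_self (fun ζ => ‖A (Function.update (x - t) j ζ)‖ₑ * ker2 (a - t j) (b - t j) ζ) (t j)]
        apply lintegral_congr; intro ζ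
        rw [upd_sub]
        simp only [ker2, sub_sub_sub_cancel_right]
    _ = _ := by
        rw [lintegral_mul_const _ mr, rk_lintegral, one_mul]

lemma kernel_diff (a b ζ : ℂ) (ha : a ≠ ζ) (hb : b ≠ ζ) : ‖(a - ζ)⁻¹ - (b - ζ)⁻¹‖ₑ = ‖a - b‖ₑ * ker2 a b ζ := by
  have h1 : a - ζ ≠ 0 := sub_ne_zero.2 ha
  have h2 : b - ζ ≠ 0 := sub_ne_zero.2 hb
  have e : (a - ζ)⁻¹ - (b - ζ)⁻¹ = -((a - b) * ((a - ζ)⁻¹ * (b - ζ)⁻¹)) := by field_simp; ring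
  rw [e, enorm_neg, enorm_mul, enorm_mul, enorm_inv h1, enorm_inv h2, ker2]

lemma holder_1d {q : ℝ} (hq : 2 < q) {v : ℂ → ℂ} (hv : ContDiff ℝ (⊤ : ℕ∞) v) (hc : HasCompactSupport v) {K : ENNReal} (hK : K ≠ ⊤)
    (h : ∀ a b, a ≠ b → ∫⁻ ζ, ‖dbar1 v ζ‖ₑ * ker2 a b ζ ≤ K * ‖a - b‖ₑ ^ (-(2 / q))) (a b : ℂ) :
    ‖v a - v b‖ ≤ (‖(Real.pi : ℂ)⁻¹‖ₑ * K).toReal * dist a b ^ (1 - 2 / q) := by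
  by_cases hab : a = b
  · subst hab; simp
    positivity
  have hd : Continuous (dbar1 v) := dbar1_smooth hv
  have hdc : HasCompactSupport (dbar1 v) := by
      apply hc.mono'
      intro z hz
      by_contra hh
      exact hz (dbar1_tsupport v hh)
  have e : ∀ a, v a = (Real.pi : ℂ)⁻¹ * ∫ ζ, dbar1 v ζ * (a - ζ)⁻¹ := by
    intro a
    have := cauchy_pompeiu v hv hc a
    have hpi : (Real.pi : ℂ) ≠ 0 := by exact_mod_cast Real.pi_ne_zero
    rw [← integral_sub_left_eq_self _ volume a] at this
    simp only [sub_sub_cancel] at this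
    rw [this]; field_simp
  have hi : ∀ a, Integrable (fun ζ => dbar1 v ζ * (a - ζ)⁻¹) := by
    intro a
    have h1 : Integrable (fun ζ => ζ⁻¹ * dbar1 v (a - ζ)) := by
      have := loc_mul_integrable inv_locallyIntegrable (w := fun ζ => dbar1 v (a - ζ)) (hd.comp (continuous_const.sub continuous_id)) (shift_compact hdc a)
      refine this.congr (ae_of_all _ fun ζ => ?_)
      simp only []; ring
    refine (h1.comp_sub_left a).congr (ae_of_all _ fun ζ => ?_)
    simp; ring
  have key : ‖v a - v b‖ₑ ≤ ‖(Real.pi : ℂ)⁻¹‖ₑ * K * ‖a - b‖ₑ ^ (1 - 2 / q) := by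
    rw [e a, e b, ← mul_sub, ← integral_sub (hi a) (hi b), enorm_mul, mul_assoc]
    gcongr
    refine (enorm_integral_le_lintegral_enorm _).trans ?_
    have ha : ∀ᵐ w : ℂ, w ≠ a := by simp [ae_iff]
    have hb : ∀ᵐ w : ℂ, w ≠ b := by simp [ae_iff]
    calc ∫⁻ ζ, ‖dbar1 v ζ * (a - ζ)⁻¹ - dbar1 v ζ * (b - ζ)⁻¹‖ₑ = ∫⁻ ζ, ‖a - b‖ₑ * (‖dbar1 v ζ‖ₑ * ker2 a b ζ) := by
          apply lintegral_congr_ae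
          filter_upwards [ha, hb] with ζ h1 h2
          rw [← mul_sub, enorm_mul, kernel_diff a b ζ h1.symm h2.symm]; ring
      _ = ‖a - b‖ₑ * ∫⁻ ζ, ‖dbar1 v ζ‖ₑ * ker2 a b ζ := lintegral_const_mul' _ _ (by finiteness)
      _ ≤ ‖a - b‖ₑ * (K * ‖a - b‖ₑ ^ (-(2 / q))) := by gcongr; exact h a b hab
      _ = _ := by
          have h0 : ‖a - b‖ₑ ≠ 0 := by simpa [sub_eq_zero] using hab
          rw [sub_eq_add_neg 1, ENNReal.rpow_add _ _ h0 (by finiteness), ENNReal.rpow_one]; ring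
  have h1 : 0 ≤ 1 - 2 / q := by
    rw [sub_nonneg, div_le_one (by linarith)]; exact hq.le
  rw [← toReal_enorm, dist_eq_norm, ← toReal_enorm (a - b), ENNReal.toReal_rpow, ← ENNReal.toReal_mul]
  apply ENNReal.toReal_mono _ key
  have := ENNReal.rpow_ne_top_of_nonneg h1 (show ‖a - b‖ₑ ≠ ⊤ by finiteness)
  finiteness
end moln
end

section

section hol
variable {n : ℕ}

lemma dbar1_mul {φ ψ : ℂ → ℂ} {z : ℂ} (h : DifferentiableAt ℝ φ z) (h' : DifferentiableAt ℝ ψ z) :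
    dbar1 (fun z => φ z * ψ z) z = φ z * dbar1 ψ z + dbar1 φ z * ψ z := by
  simp only [dbar1]; rw [fderiv_fun_mul h h']; simp; ring

lemma dbar1_bdd {χ : ℂ → ℂ} (hχ : ContDiff ℝ (⊤ : ℕ∞) χ) (hχc : HasCompactSupport χ) : ∃ C : ℝ, ∀ z, ‖dbar1 χ z‖ ≤ C := by
  have : HasCompactSupport (dbar1 χ) := by
    apply hχc.mono'
    intro z hz
    by_contra hh
    exact hz (dbar1_tsupport χ hh)
  exact this.exists_bound_of_continuous (dbar1_smooth hχ)

lemma upd_mem_ball {z0 x : Fin n → ℂ} {R : ℝ} (hx : x ∈ ball z0 R) {k : Fin n} {b : ℂ} (hb : b ∈ ball (z0 k) R) :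
    Function.update x k b ∈ ball z0 R := by
  have hR : 0 < R := pos_of_mem_ball hx
  rw [mem_ball, dist_pi_lt_iff hR]
  intro i
  by_cases h : i = k
  · subst h; simpa using hb
  · simpa [h] using dist_coord_le hx i

lemma coord_holder {q : ℝ} (hq : 2 < q) (z0 : Fin n → ℂ) {r R : ℝ} (hr : 0 < r) (hrR : r < R) (k : Fin n) (C : ℝ) (K : ENNReal) (hK : K ≠ ⊤) :
    ∃ C' : ℝ, 0 ≤ C' ∧ ∀ w B : (Fin n → ℂ) → ℂ, ContDiff ℝ (⊤ : ℕ∞) w → (∀ z, ‖w z‖ ≤ C) →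
      (∀ z ∈ ball z0 R, WD Complex.I k w z = B z) → Pot q K k B → ∀ x ∈ ball z0 r, ∀ b ∈ ball (z0 k) r,
      ‖w (Function.update x k b) - w x‖ ≤ C' * dist b (x k) ^ (1 - 2 / q) := by
  obtain ⟨χ, hχ, hχc, hχs, hχ1, hχb⟩ := bump_exists (z0 k) hr hrR
  obtain ⟨Cd, hCd⟩ := dbar1_bdd hχ hχc
  obtain ⟨C1, hC1, hC1'⟩ := ker2_holder q hq
  set V : ENNReal := ∫⁻ ζ, ((ball (z0 k) R).indicator (fun _ => ENNReal.ofReal (Cd * C)) ζ) ^ q with hV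
  have hVt : V ≠ ⊤ := by
    have : V = ∫⁻ ζ, (ball (z0 k) R).indicator (fun _ => ENNReal.ofReal (Cd * C) ^ q) ζ := by
      apply lintegral_congr; intro ζ
      by_cases hζ : ζ ∈ ball (z0 k) R
      · simp [hζ]
      · simp [hζ, show 0 < q by linarith]
    rw [this, lintegral_indicator measurableSet_ball, setLIntegral_const]
    have h1 := ENNReal.rpow_ne_top_of_nonneg (show 0 ≤ q by linarith) (ENNReal.ofReal_ne_top (r := Cd * C))
    have h2 : volume (ball (z0 k) R) ≠ ⊤ := measure_ball_lt_top.ne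
    finiteness
  set K' : ENNReal := C1 * V ^ (1 / q) + K with hK'
  have hK't : K' ≠ ⊤ := by
    have := ENNReal.rpow_ne_top_of_nonneg (show 0 ≤ 1 / q by positivity) hVt
    finiteness
  refine ⟨(‖(Real.pi : ℂ)⁻¹‖ₑ * K').toReal, ENNReal.toReal_nonneg, ?_⟩
  intro w B hw hwC hWB hP x hx b hb
  have hsl := slice_contDiff hw k x
  have hv := holder_1d hq (v := fun ζ => χ ζ * w (Function.update x k ζ)) (hχ.mul hsl) hχc.mul_right hK't (by
    intro a b hab
    have hd : ∀ ζ, ‖dbar1 (fun ζ => χ ζ * w (Function.update x k ζ)) ζ‖ₑ ≤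
        (ball (z0 k) R).indicator (fun _ => ENNReal.ofReal (Cd * C)) ζ + ‖B (Function.update x k ζ)‖ₑ := by
      intro ζ
      rw [dbar1_mul (hχ.differentiable (by simp) _) (hsl.differentiable (by simp) _), dbar1_line (hw.differentiable (by simp))]
      by_cases hζ : ζ ∈ ball (z0 k) R
      · rw [indicator_of_mem hζ, hWB _ (upd_mem_ball (ball_subset_ball hrR.le hx) hζ), add_comm]
        refine (enorm_add_le _ _).trans ?_
        gcongr
        · rw [← ofReal_norm, norm_mul]
          apply ENNReal.ofReal_le_ofReal
          exact mul_le_mul (hCd _) (hwC _) (norm_nonneg _) ((norm_nonneg _).trans (hCd 0))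
        · rw [enorm_mul]
          calc _ ≤ 1 * ‖B (Function.update x k ζ)‖ₑ := by gcongr; exact enorm_le_one_of (hχb _)
            _ = _ := one_mul _
      · have h1 : ζ ∉ tsupport χ := fun h => hζ (hχs h)
        rw [dbar1_tsupport χ h1, image_eq_zero_of_notMem_tsupport h1]; simp
    have mi : Measurable ((ball (z0 k) R).indicator (fun _ : ℂ => ENNReal.ofReal (Cd * C))) := measurable_const.indicator measurableSet_ball
    calc _ ≤ ∫⁻ ζ, ((ball (z0 k) R).indicator (fun _ => ENNReal.ofReal (Cd * C)) ζ * ker2 a b ζ + ‖B (Function.update x k ζ)‖ₑ * ker2 a b ζ) := by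
          apply lintegral_mono; intro ζ
          simp only []
          rw [← add_mul]; gcongr; exact hd ζ
      _ ≤ C1 * V ^ (1 / q) * ‖a - b‖ₑ ^ (-(2 / q)) + K * ‖a - b‖ₑ ^ (-(2 / q)) := by
          have mm : Measurable (fun ζ => (ball (z0 k) R).indicator (fun _ => ENNReal.ofReal (Cd * C)) ζ * ker2 a b ζ) := mi.mul (ker2_measurable a b)
          rw [lintegral_add_left mm]
          exact add_le_add (hC1' a b hab _ mi.aemeasurable) (hP x a b hab)
      _ = _ := by rw [hK', add_mul]) b (x k)
  simp only [Function.update_eq_self] at hv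
  rw [hχ1 b hb, hχ1 _ (dist_coord_le hx k), one_mul, one_mul] at hv
  exact hv

lemma holder_all {q : ℝ} (hq : 2 < q) (z0 : Fin n → ℂ) {r R : ℝ} (hr : 0 < r) (hrR : r < R) (C : ℝ) (K : Fin n → ENNReal) (hK : ∀ k, K k ≠ ⊤) :
    ∃ C' : ℝ, ∀ (w : (Fin n → ℂ) → ℂ) (B : Fin n → (Fin n → ℂ) → ℂ), ContDiff ℝ (⊤ : ℕ∞) w → (∀ z, ‖w z‖ ≤ C) →
      (∀ k, ∀ z ∈ ball z0 R, WD Complex.I k w z = B k z) → (∀ k, Pot q (K k) k (B k)) → ∀ a ∈ ball z0 r, ∀ b ∈ ball z0 r,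
      ‖w b - w a‖ ≤ C' * dist b a ^ (1 - 2 / q) := by
  choose C' hC0 hC' using fun k => coord_holder hq z0 hr hrR k C (K k) (hK k)
  refine ⟨∑ k, C' k, ?_⟩
  intro w B hw hwC hWB hP a ha b hb
  have hα : 0 ≤ 1 - 2 / q := by
    rw [sub_nonneg, div_le_one (by linarith)]; exact hq.le
  have key : ∀ S : Finset (Fin n), ‖w (fun i => if i ∈ S then b i else a i) - w a‖ ≤ (∑ k ∈ S, C' k) * dist b a ^ (1 - 2 / q) := by
    intro S
    induction S using Finset.induction_on with
    | empty => simp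
    | insert k S hk ih =>
      set y : Fin n → ℂ := fun i => if i ∈ S then b i else a i with hy
      have hyb : y ∈ ball z0 r := by
        rw [mem_ball, dist_pi_lt_iff hr]
        intro i
        by_cases hi : i ∈ S
        · simpa [hy, hi] using dist_coord_le hb i
        · simpa [hy, hi] using dist_coord_le ha i
      have e : (fun i => if i ∈ insert k S then b i else a i) = Function.update y k (b k) := by
        ext i
        by_cases hi : i = k
        · subst hi; simp
        · simp [hi, hy]
      rw [e, Finset.sum_insert hk, add_mul]
      have h1 := hC' k w (B k) hw hwC (hWB k) (hP k) y hyb (b k) (dist_coord_le hb k)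
      have hyk : y k = a k := by simp [hy, hk]
      rw [hyk] at h1
      have h2 : C' k * dist (b k) (a k) ^ (1 - 2 / q) ≤ C' k * dist b a ^ (1 - 2 / q) := by
        apply mul_le_mul_of_nonneg_left _ (hC0 k)
        exact Real.rpow_le_rpow dist_nonneg (dist_le_pi_dist b a k) hα
      calc _ = ‖(w (Function.update y k (b k)) - w y) + (w y - w a)‖ := by congr 1; ring
        _ ≤ _ := (norm_add_le _ _).trans (add_le_add (h1.trans h2) ih)
  simpa using key Finset.univ

/-- regular representative -/
theorem holder_reg (z0 : Fin n → ℂ) {r R : ℝ} (hr : 0 < r) (hrR : r < R) {u : (Fin n → ℂ) → ℂ} (hu : Measurable u)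
    {C : ℝ} (hC : ∀ z, ‖u z‖ ≤ C) {A : Fin n → (Fin n → ℂ) → ℂ} (hA : ∀ j, Measurable (A j))
    (hw : ∀ j φ, Tst (ball z0 R) φ → ∫ z, u z * WD Complex.I j φ z = - ∫ z, A j z * φ z)
    (hP0 : ∃ q : ℝ, 2 < q ∧ ∀ j, ∃ K : ENNReal, K ≠ ⊤ ∧ Pot q K j (A j)) :
    ∃ v : (Fin n → ℂ) → ℂ, (∀ y ∈ ball z0 r, CC (fun m => mol m u) v y) ∧
      ∀ q : ℝ, 2 < q → (∀ j, ∃ K : ENNReal, K ≠ ⊤ ∧ Pot q K j (A j)) →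
        ∃ C' : ℝ, ∀ a ∈ ball z0 r, ∀ b ∈ ball z0 r, ‖v a - v b‖ ≤ C' * dist a b ^ (1 - 2 / q) := by
  have hui : LocallyIntegrable u := by
    apply (locallyIntegrable_const C).mono hu.aestronglyMeasurable
    exact ae_of_all _ fun z => (hC z).trans (le_abs_self C)
  obtain ⟨m0, hm0⟩ := exists_nat_one_div_lt (show 0 < (R - r) / 2 by linarith)
  have hm1 : ∀ m ≥ m0, 1 / ((m:ℝ) + 1) < (R - r) / 2 := by
    intro m hm
    refine lt_of_le_of_lt ?_ hm0
    gcongr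
  have equi : ∀ q : ℝ, 2 < q → (∀ j, ∃ K : ENNReal, K ≠ ⊤ ∧ Pot q K j (A j)) →
        ∃ C' : ℝ, ∀ m ≥ m0, ∀ a ∈ ball z0 r, ∀ b ∈ ball z0 r, ‖mol m u b - mol m u a‖ ≤ C' * dist b a ^ (1 - 2 / q) := by
    intro q hq hP
    choose K hK hKP using hP
    obtain ⟨C', hC'⟩ := holder_all hq z0 hr (show r < (r + R) / 2 by linarith) C K hK
    refine ⟨C', fun m hm => ?_⟩
    apply hC' (mol m u) (fun k => mol m (A k)) (mol_contDiff m hui) (mol_bound m hC)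
    · intro k z hz
      apply mol_WD m k z0 R hui (hw k) z
      refine ball_subset_ball ?_ hz
      linarith [hm1 m hm]
    · exact fun k => Pot_mol m (hA k) (hKP k)
  obtain ⟨q0, hq0, hP0⟩ := hP0
  have ho : ∀ q : ℝ, 2 < q → 0 < 1 - 2 / q := by
    intro q hq
    rw [sub_pos, div_lt_one (by linarith)]; exact hq
  obtain ⟨C0, hC0⟩ := equi q0 hq0 hP0
  have hae := mol_ae hui
  -- uniform equicontinuity
  have ueq : ∀ y ∈ ball z0 r, ∀ ε > 0, ∃ δ > 0, ∀ x, dist x y < δ → x ∈ ball z0 r ∧ ∀ m ≥ m0, ‖mol m u x - mol m u y‖ < ε := by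
    intro y hy ε hε
    have ht : Filter.Tendsto (fun x => C0 * dist x y ^ (1 - 2 / q0)) (nhds y) (nhds (C0 * dist y y ^ (1 - 2 / q0))) := by
      apply Filter.Tendsto.const_mul
      apply Filter.Tendsto.rpow_const
      · exact (continuous_id.dist continuous_const).tendsto y
      · right; exact (ho q0 hq0).le
    rw [dist_self, Real.zero_rpow (ho q0 hq0).ne', mul_zero] at ht
    have h1 := (ht.eventually (gt_mem_nhds hε)).and (isOpen_ball.mem_nhds hy)
    obtain ⟨δ, hδ, hd⟩ := Metric.eventually_nhds_iff.1 h1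
    refine ⟨δ, hδ, fun x hx => ⟨(hd hx).2, fun m hm => ?_⟩⟩
    exact (hC0 m hm y hy x (hd hx).2).trans_lt (hd hx).1
  have hlim : ∀ y ∈ ball z0 r, ∃ l, Filter.Tendsto (fun m => mol m u y) Filter.atTop (nhds l) := by
    intro y hy
    apply cauchySeq_tendsto_of_complete
    rw [Metric.cauchySeq_iff]
    intro ε hε
    obtain ⟨δ, hδ, hd⟩ := ueq y hy (ε / 3) (by positivity)
    obtain ⟨x, hx, hxy⟩ : ∃ x, Filter.Tendsto (fun m => mol m u x) Filter.atTop (nhds (u x)) ∧ dist x y < δ := by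
      obtain ⟨x, hx1, hx2⟩ := (dense_iff_inter_open.1 (Measure.dense_of_ae hae)) (ball y δ) isOpen_ball ⟨y, mem_ball_self hδ⟩
      exact ⟨x, hx2, hx1⟩
    obtain ⟨N, hN⟩ := (Metric.cauchySeq_iff.1 hx.cauchySeq) (ε / 3) (by positivity)
    refine ⟨max N m0, fun m hm l hl => ?_⟩
    have h1 := (hd x hxy).2 m (le_trans (le_max_right _ _) hm)
    have h2 := (hd x hxy).2 l (le_trans (le_max_right _ _) hl)
    have h3 := hN m (le_trans (le_max_left _ _) hm) l (le_trans (le_max_left _ _) hl)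
    rw [dist_eq_norm] at h3 ⊢
    calc ‖mol m u y - mol l u y‖ = ‖-(mol m u x - mol m u y) + (mol m u x - mol l u x) + (mol l u x - mol l u y)‖ := by congr 1; ring
      _ ≤ ‖mol m u x - mol m u y‖ + ‖mol m u x - mol l u x‖ + ‖mol l u x - mol l u y‖ := by
        refine (norm_add₃_le).trans ?_
        rw [norm_neg]
      _ < ε := by linarith
  choose! v hv using hlim
  refine ⟨v, ?_, ?_⟩
  · intro y hy
    rw [CC, Metric.tendsto_nhds]
    intro ε hε
    obtain ⟨δ, hδ, hd⟩ := ueq y hy (ε / 2) (by positivity)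
    have h1 := (Metric.tendsto_nhds.1 (hv y hy) (ε / 2) (by positivity)).and (Filter.eventually_ge_atTop m0)
    have h2 : ∀ᶠ x in nhds y, dist x y < δ := Metric.eventually_nhds_iff.2 ⟨δ, hδ, fun x hx => hx⟩
    filter_upwards [h1.prod_mk h2] with p hp
    have h3 := (hd p.2 hp.2).2 p.1 hp.1.2
    have h4 := hp.1.1
    rw [← dist_eq_norm] at h3
    linarith [dist_triangle (mol p.1 u p.2) (mol p.1 u y) (v y)]
  · intro q hq hP
    obtain ⟨C', hC'⟩ := equi q hq hP
    refine ⟨C', fun a ha b hb => ?_⟩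
    apply le_of_tendsto ((hv a ha).sub (hv b hb)).norm
    filter_upwards [Filter.eventually_ge_atTop m0] with m hm
    exact hC' m hm b hb a ha
end hol
end

section

section twist
variable {n : ℕ}

lemma CC_cut {φ : (Fin n → ℂ) → ℂ} {V : Set (Fin n → ℂ)} (hφ : Continuous φ) (hs : tsupport φ ⊆ V)
    {w : ℕ → (Fin n → ℂ) → ℂ} {w' : (Fin n → ℂ) → ℂ} (h : ∀ y ∈ V, CC w w' y) (y : Fin n → ℂ) :
    CC (fun m z => φ z * w m z) (fun z => φ z * w' z) y := by
  by_cases hy : y ∈ V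
  · exact (CC_const hφ.continuousAt).mul (h y hy)
  · have h1 : y ∉ tsupport φ := fun hh => hy (hs hh)
    have h2 : ∀ᶠ z in nhds y, φ z = 0 := by
      have := (isClosed_tsupport φ).isOpen_compl.mem_nhds h1
      filter_upwards [this] with z hz
      exact image_eq_zero_of_notMem_tsupport hz
    have h3 : ∀ᶠ p : ℕ × (Fin n → ℂ) in Filter.atTop ×ˢ nhds y, φ p.2 = 0 := Filter.tendsto_snd.eventually h2
    unfold CC
    simp only []
    rw [image_eq_zero_of_notMem_tsupport h1, zero_mul]
    apply tendsto_const_nhds.congr'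
    filter_upwards [h3] with p hp
    simp [hp]

lemma twist (z0 : Fin n → ℂ) {r R : ℝ} (hrR : r < R) {f u v : (Fin n → ℂ) → ℂ} {A : (Fin n → ℂ) → ℂ} {j : Fin n}
    (hf : Continuous f) (hA : Integrable A) (hu : Measurable u) {C : ℝ} (hC : ∀ z, ‖u z‖ ≤ C)
    (hfA : ∀ φ, Tst (ball z0 R) φ → ∫ z, f z * WD Complex.I j φ z = - ∫ z, A z * f z * φ z)
    (huA : ∀ φ, Tst (ball z0 R) φ → ∫ z, u z * WD Complex.I j φ z = - ∫ z, A z * φ z)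
    (hv : ∀ y ∈ ball z0 r, CC (fun m => mol m u) v y) {φ : (Fin n → ℂ) → ℂ} (hφ : Tst (ball z0 r) φ) :
    ∫ z, Complex.exp (- v z) * f z * WD Complex.I j φ z = 0 := by
  have hui : LocallyIntegrable u := by
    apply (locallyIntegrable_const C).mono hu.aestronglyMeasurable
    exact ae_of_all _ fun z => (hC z).trans (le_abs_self C)
  set e : ℕ → (Fin n → ℂ) → ℂ := fun m z => Complex.exp (- mol m u z) with he
  have hes : ∀ m, ContDiff ℝ (⊤ : ℕ∞) (e m) := fun m => (mol_contDiff m hui).neg.cexp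
  have heb : ∀ m z, ‖e m z‖ ≤ Real.exp C := by
    intro m z
    rw [he]; simp only [Complex.norm_exp]
    apply Real.exp_le_exp.2
    exact (Complex.re_le_norm _).trans (by rw [norm_neg]; exact mol_bound m hC z)
  have hcc : ∀ y ∈ ball z0 r, CC e (fun z => Complex.exp (- v z)) y := by
    intro y hy
    exact (Complex.continuous_exp.tendsto _).comp (hv y hy).neg
  -- functions
  have lim : ∀ ψ : (Fin n → ℂ) → ℂ, Tst (ball z0 r) ψ → ∀ B : (Fin n → ℂ) → ℂ, Integrable (fun z => B z * ψ z) →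
      Filter.Tendsto (fun m => ∫ z, B z * ψ z * e m z) Filter.atTop (nhds (∫ z, B z * ψ z * Complex.exp (- v z))) := by
    intro ψ hψ B hB
    apply tendsto_integral_of_dominated_convergence (fun z => ‖B z * ψ z‖ * Real.exp C)
    · intro m; exact hB.1.mul (hes m).continuous.aestronglyMeasurable
    · exact hB.norm.mul_const _
    · intro m; refine ae_of_all _ fun z => ?_
      rw [norm_mul]; gcongr; exact heb m z
    · refine ae_of_all _ fun z => ?_
      by_cases hz : z ∈ ball z0 r
      · exact (hcc z hz).tendsto.const_mul _
      · simp [hψ.zero hz]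
  have hfφc : Continuous (fun z => f z * φ z) := hf.mul hφ.1.continuous
  have hfφs : HasCompactSupport (fun z => f z * φ z) := hφ.2.1.mul_left
  obtain ⟨Cφ, hCφ⟩ := hfφs.exists_bound_of_continuous hfφc
  have hCφ0 : 0 ≤ Cφ := (norm_nonneg _).trans (hCφ 0)
  have hAf : Integrable (fun z => (A z * f z) * φ z) := by
    have := hA.mul_bdd (c := Cφ) hfφc.aestronglyMeasurable (ae_of_all _ hCφ)
    refine this.congr (ae_of_all _ fun z => ?_)
    simp only []; ring
  have hfW : Integrable (fun z => f z * WD Complex.I j φ z) :=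
    (hf.mul (hφ.WD _ _).1.continuous).integrable_of_hasCompactSupport ((hφ.WD _ _).2.1.mul_left)
  have L1 := lim φ hφ (fun z => A z * f z) hAf
  have L2 := lim _ (hφ.WD Complex.I j) f hfW
  have L3 : Filter.Tendsto (fun m => ∫ z, (f z * φ z * e m z) * mol m A z) Filter.atTop
      (nhds (∫ z, (f z * φ z * Complex.exp (- v z)) * A z)) := by
    apply dual_limit (C := Cφ * Real.exp C) hA
    · intro m
      exact (hfφc.mul (hes m).continuous).integrable_of_hasCompactSupport hfφs.mul_right
    · intro m z
      rw [norm_mul]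
      exact mul_le_mul (hCφ z) (heb m z) (norm_nonneg _) hCφ0
    · intro y
      apply CC_cut (V := ball z0 r) hfφc ((tsupport_mul_subset_right).trans hφ.2.2) hcc
  obtain ⟨m0, hm0⟩ := exists_nat_one_div_lt (show 0 < (R - r) by linarith)
  have key : ∀ᶠ m in Filter.atTop, ∫ z, f z * WD Complex.I j φ z * e m z = (∫ z, (f z * φ z * e m z) * mol m A z) - ∫ z, (A z * f z) * φ z * e m z := by
    filter_upwards [Filter.eventually_ge_atTop m0] with m hm
    have hm1 : 1 / ((m:ℝ) + 1) < R - r := by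
      refine lt_of_le_of_lt ?_ hm0
      gcongr
    have ht : Tst (ball z0 R) (fun z => φ z * e m z) := (hφ.mul_right (hes m)).mono (ball_subset_ball hrR.le)
    have h1 := hfA _ ht
    have h2 : ∀ z, f z * WD Complex.I j (fun z => φ z * e m z) z = f z * WD Complex.I j φ z * e m z - (f z * φ z * e m z) * mol m A z := by
      intro z
      rw [WD_mul (hφ.1.differentiable (by simp) z) ((hes m).differentiable (by simp) z)]
      by_cases hz : z ∈ ball z0 r
      · have h3 : WD Complex.I j (e m) z = - (e m z * mol m A z) := by
          have hd := (mol_contDiff m hui).differentiable (by simp) z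
          rw [he]
          rw [WD_comp_holo (φ := fun z => - mol m u z) (g := Complex.exp) hd.neg (Complex.hasDerivAt_exp _), WD_neg,
            mol_WD m j z0 R hui huA z (ball_subset_ball (by linarith) hz)]
          ring
        rw [h3]; ring
      · rw [hφ.zero hz, (hφ.WD Complex.I j).zero hz]; simp
    simp_rw [h2] at h1
    rw [integral_sub, sub_eq_iff_eq_add] at h1
    · rw [h1]
      have : ∫ z, A z * f z * (φ z * e m z) = ∫ z, (A z * f z) * φ z * e m z := by congr 1; ext z; ring
      rw [this]; ring
    · exact ((hf.mul (hφ.WD Complex.I j).1.continuous).mul (hes m).continuous).integrable_of_hasCompactSupport ((hφ.WD Complex.I j).2.1.mul_left.mul_right)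
    · have := (hfφc.mul ((hes m).continuous.mul (mol_contDiff m hA.locallyIntegrable).continuous)).integrable_of_hasCompactSupport (μ := volume) hfφs.mul_right
      refine this.congr (ae_of_all _ fun z => ?_)
      simp only [Pi.mul_apply]; ring
  have L4 := (L3.sub L1).congr' (key.mono fun m h => h.symm)
  have := tendsto_nhds_unique L2 L4
  have e1 : ∫ z, (f z * φ z * Complex.exp (- v z)) * A z = ∫ z, (A z * f z) * φ z * Complex.exp (- v z) := by congr 1; ext z; ring
  rw [e1, sub_self] at this
  rw [← this]; congr 1; ext z; ring

end twist
end

section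

section weyl
variable {n : ℕ}

lemma holo_of_WD {F : (Fin n → ℂ) → ℂ} {z : Fin n → ℂ} (hF : DifferentiableAt ℝ F z) (h : ∀ j, WD Complex.I j F z = 0) :
    DifferentiableAt ℂ F z := by
  rw [differentiableAt_iff_restrictScalars ℝ hF]
  set D := fderiv ℝ F z with hD
  refine ⟨∑ j, (D (Pi.single j 1 : Fin n → ℂ)) • (ContinuousLinearMap.proj j : (Fin n → ℂ) →L[ℂ] ℂ), ?_⟩
  have hI : ∀ j, D (Pi.single j Complex.I : Fin n → ℂ) = Complex.I * D (Pi.single j 1 : Fin n → ℂ) := by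
    intro j
    have := h j
    simp only [WD, ← hD] at this
    have h2 : D (Pi.single j 1 : Fin n → ℂ) + Complex.I * D (Pi.single j Complex.I : Fin n → ℂ) = 0 := by
      simpa using this
    have h3 : Complex.I * (D (Pi.single j 1 : Fin n → ℂ) + Complex.I * D (Pi.single j Complex.I : Fin n → ℂ)) = 0 := by rw [h2, mul_zero]
    have h4 := Complex.I_mul_I
    linear_combination (-1 : ℂ) * h3 + D (Pi.single j Complex.I : Fin n → ℂ) * h4
  ext w
  have hw : w = ∑ j, ((w j).re • (Pi.single j 1 : Fin n → ℂ) + (w j).im • (Pi.single j Complex.I : Fin n → ℂ)) := by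
    ext i
    rw [Finset.sum_apply, Finset.sum_eq_single i]
    · simp
    · intro b _ hb; simp [Pi.single_eq_of_ne hb.symm]
    · simp
  conv_rhs => rw [hw, map_sum]
  simp only [ContinuousLinearMap.coe_restrictScalars', _root_.sum_apply, _root_.smul_apply,
    ContinuousLinearMap.proj_apply, smul_eq_mul]
  apply Finset.sum_congr rfl
  intro j _
  rw [map_add, map_smul, map_smul, hI]
  conv_lhs => rw [← Complex.re_add_im (w j)]
  simp only [Complex.real_smul]
  ring

lemma holo_limit {x : Fin n → ℂ} {ρ : ℝ} (hρ : 0 < ρ) {F : ℕ → (Fin n → ℂ) → ℂ} {h : (Fin n → ℂ) → ℂ}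
    (hF : ∀ m, DifferentiableOn ℂ (F m) (ball x (2 * ρ))) (hu : TendstoUniformlyOn F h Filter.atTop (ball x (2 * ρ))) :
    DifferentiableAt ℂ h x := by
  have hsub : ∀ y ∈ ball x ρ, ball y ρ ⊆ ball x (2 * ρ) := fun y hy => ball_subset_ball' (by rw [mem_ball] at hy; linarith)
  have hUC : UniformCauchySeqOn (fun m => fderiv ℂ (F m)) Filter.atTop (ball x ρ) := by
    rw [Metric.uniformCauchySeqOn_iff]
    intro ε hε
    have h1 := Metric.uniformCauchySeqOn_iff.1 hu.uniformCauchySeqOn (ε * ρ / 8) (by positivity)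
    obtain ⟨N, hN⟩ := h1
    refine ⟨N, fun m hm k hk y hy => ?_⟩
    have hd : ∀ m, DifferentiableOn ℂ (F m) (ball y ρ) := fun m => (hF m).mono (hsub y hy)
    have hda : ∀ m, DifferentiableAt ℂ (F m) y := fun m => (hd m).differentiableAt (ball_mem_nhds y hρ)
    rw [dist_eq_norm, ← fderiv_sub (hda m) (hda k)]
    have := Complex.norm_fderiv_le_div_of_mapsTo_ball (f := F m - F k) (R₂ := ε * ρ / 4 + ε * ρ / 8) ((hd m).sub (hd k)) (by
      intro w hw
      rw [mem_closedBall, dist_eq_norm]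
      have e1 := hN m hm k hk w (hsub y hy hw)
      have e2 := hN m hm k hk y (hsub y hy (mem_ball_self hρ))
      rw [dist_eq_norm] at e1 e2
      have := norm_sub_le (F m w - F k w) (F m y - F k y)
      simp only [Pi.sub_apply]
      nlinarith) hρ
    refine this.trans_lt ?_
    rw [div_lt_iff₀ hρ]; nlinarith
  have hlim : ∀ y ∈ ball x ρ, ∃ L, Filter.Tendsto (fun m => fderiv ℂ (F m) y) Filter.atTop (nhds L) := by
    intro y hy
    exact cauchySeq_tendsto_of_complete (hUC.cauchySeq hy)
  choose! L hL using hlim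
  have hU : TendstoUniformlyOn (fun m => fderiv ℂ (F m)) L Filter.atTop (ball x ρ) :=
    hUC.tendstoUniformlyOn_of_tendsto hL
  refine (hasFDerivAt_of_tendstoUniformlyOn (f := F) isOpen_ball hU ?_ ?_ (mem_ball_self hρ)).differentiableAt
  · intro m y hy
    exact ((hF m).differentiableAt (isOpen_ball.mem_nhds (ball_subset_ball (by linarith) hy))).hasFDerivAt
  · intro y hy
    exact hu.tendsto_at (ball_subset_ball (by linarith) hy)

theorem weyl (z0 : Fin n → ℂ) {r : ℝ} {h : (Fin n → ℂ) → ℂ} (hc : ContinuousOn h (ball z0 r))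
    (hw : ∀ j φ, Tst (ball z0 r) φ → ∫ z, h z * WD Complex.I j φ z = 0) : DifferentiableOn ℂ h (ball z0 r) := by
  intro x hx
  apply DifferentiableAt.differentiableWithinAt
  rw [mem_ball] at hx
  obtain ⟨s, hs1, hs2⟩ := exists_between hx
  obtain ⟨t, ht1, ht2⟩ := exists_between hs2
  set g : (Fin n → ℂ) → ℂ := (closedBall z0 t).indicator h with hg
  have hct : ContinuousOn h (closedBall z0 t) := hc.mono (closedBall_subset_ball ht2)
  have hgi : Integrable g := (integrable_indicator_iff measurableSet_closedBall).2 (hct.integrableOn_compact (isCompact_closedBall _ _))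
  have hgw : ∀ j φ, Tst (ball z0 t) φ → ∫ z, g z * WD Complex.I j φ z = - ∫ z, (0 : (Fin n → ℂ) → ℂ) z * φ z := by
    intro j φ hφ
    have := hw j φ (hφ.mono (ball_subset_ball ht2.le))
    simp only [Pi.zero_apply, zero_mul, integral_zero, neg_zero]
    rw [← this]; congr 1; ext z
    by_cases hz : z ∈ ball z0 t
    · rw [hg, indicator_of_mem (ball_subset_closedBall hz)]
    · rw [(hφ.WD Complex.I j).zero hz, mul_zero, mul_zero]
  have hcg : ∀ y ∈ ball z0 t, ContinuousAt g y := by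
    intro y hy
    have h1 : ContinuousAt h y := hc.continuousAt (isOpen_ball.mem_nhds (ball_subset_ball ht2.le hy))
    apply h1.congr
    filter_upwards [isOpen_ball.mem_nhds hy] with z hz
    rw [hg, indicator_of_mem (ball_subset_closedBall hz)]
  have hloc : TendstoLocallyUniformlyOn (fun m => mol m g) g Filter.atTop (ball z0 t) := by
    rw [tendstoLocallyUniformlyOn_iff_filter]
    intro y hy
    have h1 : CC (fun m => mol m g) g y := mol_CC (ψ := fun _ => g) (CC_const (hcg y hy)) (fun _ => hgi.1)
    rw [isOpen_ball.nhdsWithin_eq hy]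
    rw [Metric.tendstoUniformlyOnFilter_iff]
    intro ε hε
    have h2 : CC (fun _ => g) g y := CC_const (hcg y hy)
    have h3 := h2.dist h1
    rw [dist_self] at h3
    exact h3.eventually (gt_mem_nhds hε)
  have hun : TendstoUniformlyOn (fun m => mol m g) g Filter.atTop (closedBall z0 s) :=
    (tendstoLocallyUniformlyOn_iff_tendstoUniformlyOn_of_compact (isCompact_closedBall _ _)).1 (hloc.mono (closedBall_subset_ball ht1))
  obtain ⟨m0, hm0⟩ := exists_nat_one_div_lt (show 0 < t - s by linarith)
  set ρ := (s - dist x z0) / 2 with hρ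
  have hρ0 : 0 < ρ := by rw [hρ]; linarith
  have hbs : ball x (2 * ρ) ⊆ ball z0 s := ball_subset_ball' (by rw [hρ]; linarith)
  have key : DifferentiableAt ℂ g x := by
    apply holo_limit hρ0 (F := fun m => mol (m + m0) g)
    · intro m y hy
      apply DifferentiableAt.differentiableWithinAt
      apply holo_of_WD ((mol_contDiff _ hgi.locallyIntegrable).differentiable (by simp) y)
      intro j
      rw [mol_WD (m + m0) j z0 t hgi.locallyIntegrable (hgw j) y]
      · simp [mol]
      · refine ball_subset_ball ?_ (hbs hy)
        have : 1 / (((m + m0 : ℕ) : ℝ) + 1) ≤ 1 / ((m0 : ℝ) + 1) := by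
          gcongr; exact_mod_cast Nat.le_add_left m0 m
        linarith
    · have h1 := hun.mono (hbs.trans ball_subset_closedBall)
      intro U hU
      exact (Filter.tendsto_add_atTop_nat m0).eventually (h1 U hU)
  apply key.congr_of_eventuallyEq
  filter_upwards [isOpen_ball.mem_nhds (show x ∈ ball z0 t from mem_ball.2 (hs1.trans ht1))] with z hz
  rw [hg, indicator_of_mem (ball_subset_closedBall hz)]

end weyl
end

section

section linefix

lemma dbar1_add {φ ψ : ℂ → ℂ} (h : Differentiable ℝ φ) (h' : Differentiable ℝ ψ) (z : ℂ) :
    dbar1 (fun z => φ z + ψ z) z = dbar1 φ z + dbar1 ψ z := by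
  simp only [dbar1]; rw [fderiv_fun_add (h z) (h' z)]; simp; ring

lemma test_dbar_integrable {U : Set ℂ} (hU : IsOpen U) {g φ : ℂ → ℂ} (hg : ContinuousOn g U) (hφ : IsTest1 U φ) :
    Integrable (fun z => g z * dbar1 φ z) (volume.restrict U) := by
  have hK : IsCompact (tsupport φ) := hφ.2.1
  have h1 : IntegrableOn (fun z => g z * dbar1 φ z) (tsupport φ) volume :=
    ((hg.mono hφ.2.2).mul (dbar1_smooth hφ.1).continuousOn).integrableOn_compact hK
  have h2 : IntegrableOn (fun z => g z * dbar1 φ z) U volume := by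
    apply h1.of_forall_sdiff_eq_zero hU.measurableSet
    intro z hz
    rw [dbar1_tsupport φ hz.2, mul_zero]
  exact h2

lemma line_fix {U : Set ℂ} (hU : IsOpen U) {g A : ℂ → ℂ} (hg : ContinuousOn g U) {p K : ENNReal}
    (hA : eLpNorm A p (volume.restrict U) ≤ K) (h : DbarEq1On U g A) :
    ∃ A' : ℂ → ℂ, AEStronglyMeasurable A' (volume.restrict U) ∧ eLpNorm A' p (volume.restrict U) ≤ K ∧ DbarEq1On U g A' := by
  classical
  by_cases hm : ∀ φ, IsTest1 U φ → AEStronglyMeasurable (fun z => A z * g z * φ z) (volume.restrict U)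
  · refine ⟨fun z => if g z = 0 then 0 else A z, ?_, ?_, ?_⟩
    · have hgm : AEMeasurable g (volume.restrict U) := (hg.aestronglyMeasurable hU.measurableSet).aemeasurable
      -- A g measurable on U
      have hAg : AEMeasurable (fun z => A z * g z) (volume.restrict U) := by
        have hx : ∀ x : U, ∃ V : Set ℂ, IsOpen V ∧ (x:ℂ) ∈ V ∧ V ⊆ U ∧ AEMeasurable (fun z => A z * g z) (volume.restrict V) := by
          rintro ⟨x, hx⟩
          obtain ⟨ε, hε, hεU⟩ := Metric.isOpen_iff.1 hU x hx
          obtain ⟨χ, h1, h2, h3, h4, -⟩ := bump_exists x (half_pos hε) (half_lt_self hε)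
          have hs : ball x (ε/2) ⊆ U := (ball_subset_ball (half_lt_self hε).le).trans hεU
          refine ⟨ball x (ε/2), isOpen_ball, mem_ball_self (half_pos hε), hs, ?_⟩
          have := ((hm χ ⟨h1, h2, h3.trans hεU⟩).mono_measure (Measure.restrict_mono hs le_rfl)).aemeasurable
          refine this.congr ?_
          filter_upwards [ae_restrict_mem measurableSet_ball] with z hz
          rw [h4 z hz, mul_one]
        choose V hV1 hV2 hV3 hV4 using hx
        obtain ⟨T, hT, hTU⟩ := TopologicalSpace.isOpen_iUnion_countable V hV1
        have hUe : U = ⋃ i ∈ T, V i := by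
          rw [hTU]; apply Subset.antisymm
          · intro x hx; exact mem_iUnion.2 ⟨⟨x, hx⟩, hV2 _⟩
          · exact iUnion_subset hV3
        rw [hUe]
        have := hT.to_subtype
        rw [biUnion_eq_iUnion]
        exact AEMeasurable.iUnion fun i => hV4 i
      have := (hAg.div hgm).aestronglyMeasurable
      refine this.congr (ae_of_all _ fun z => ?_)
      by_cases hz : g z = 0
      · simp [hz]
      · simp [hz]
    · refine (eLpNorm_mono fun z => ?_).trans hA
      split_ifs <;> simp
    · intro φ hφ
      rw [h φ hφ]; congr 2; ext z
      by_cases hz : g z = 0 <;> simp [hz]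
  · push Not at hm
    obtain ⟨φ0, hφ0, hn0⟩ := hm
    refine ⟨0, aestronglyMeasurable_const, by simp, ?_⟩
    have e0 : ∀ φ, IsTest1 U φ → ¬ AEStronglyMeasurable (fun z => A z * g z * φ z) (volume.restrict U) →
        ∫ z in U, g z * dbar1 φ z = 0 := by
      intro φ hφ hn
      rw [h φ hφ, integral_non_aestronglyMeasurable hn, neg_zero]
    intro φ hφ
    simp only [Pi.zero_apply, zero_mul, integral_zero, neg_zero]
    by_cases hn : AEStronglyMeasurable (fun z => A z * g z * φ z) (volume.restrict U)
    · have ht : IsTest1 U (fun z => φ z + φ0 z) := ⟨hφ.1.add hφ0.1, hφ.2.1.add hφ0.2.1, (tsupport_add φ φ0).trans (union_subset hφ.2.2 hφ0.2.2)⟩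
      have h1 := e0 _ ht (by
        intro hh
        apply hn0
        refine (hh.sub hn).congr (ae_of_all _ fun z => ?_)
        simp only [Pi.sub_apply]; ring)
      have h2 := e0 _ hφ0 hn0
      simp_rw [dbar1_add (hφ.1.differentiable (by simp)) (hφ0.1.differentiable (by simp)), mul_add] at h1
      rw [integral_add (test_dbar_integrable hU hg hφ) (test_dbar_integrable hU hg hφ0), h2, add_zero] at h1
      exact h1
    · exact e0 φ hφ hn

end linefix

section slicing
variable {n : ℕ}

lemma insertNth_eq_update (j : Fin (n+1)) (ζ : ℂ) (y : Fin n → ℂ) :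
    (j.insertNth ζ y : Fin (n+1) → ℂ) = Function.update (j.insertNth 0 y : Fin (n+1) → ℂ) j ζ := by
  simp

lemma integral_slice_zero (j : Fin n) {H : (Fin n → ℂ) → ℂ} (hH : Integrable H)
    (h : ∀ x, ∫ ζ, H (Function.update x j ζ) = 0) : ∫ z, H z = 0 := by
  obtain _ | n := n
  · exact j.elim0
  have hp := volume_preserving_piFinSuccAbove (fun _ : Fin (n+1) => ℂ) j
  rw [← hp.symm.integral_comp (MeasurableEquiv.measurableEmbedding _)]
  have hi : Integrable (fun a => H ((MeasurableEquiv.piFinSuccAbove (fun _ : Fin (n+1) => ℂ) j).symm a)) (volume.prod volume) :=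
    hp.symm.integrable_comp_of_integrable hH
  change ∫ a, H ((MeasurableEquiv.piFinSuccAbove (fun _ : Fin (n+1) => ℂ) j).symm a) ∂(volume.prod volume) = 0
  rw [integral_prod_symm _ hi]
  have : ∀ y, ∫ ζ, H ((MeasurableEquiv.piFinSuccAbove (fun _ : Fin (n+1) => ℂ) j).symm (ζ, y)) = 0 := by
    intro y
    rw [← h (j.insertNth 0 y : Fin (n+1) → ℂ)]
    congr 1; ext ζ
    rw [← insertNth_eq_update]; rfl
  simp_rw [this]; simp

lemma lintegral_slice_lt_top (z0 : Fin n → ℂ) (R : ℝ) (j : Fin n) {H : (Fin n → ℂ) → ENNReal} (hH : Measurable H)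
    (h0 : ∀ z ∉ ball z0 R, H z = 0) {K : ENNReal} (hK : K ≠ ⊤)
    (h : ∀ x, ∫⁻ ζ, H (Function.update x j ζ) ≤ K) : ∫⁻ z, H z < ⊤ := by
  obtain _ | n := n
  · exact j.elim0
  have hp := volume_preserving_piFinSuccAbove (fun _ : Fin (n+1) => ℂ) j
  rw [← hp.symm.lintegral_comp hH]
  change ∫⁻ a, H ((MeasurableEquiv.piFinSuccAbove (fun _ : Fin (n+1) => ℂ) j).symm a) ∂(volume.prod volume) < ⊤
  have hm : Measurable (fun a => H ((MeasurableEquiv.piFinSuccAbove (fun _ : Fin (n+1) => ℂ) j).symm a)) := hH.comp (MeasurableEquiv.measurable _)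
  rw [lintegral_prod_symm _ hm.aemeasurable]
  have : ∀ y, ∫⁻ ζ, H ((MeasurableEquiv.piFinSuccAbove (fun _ : Fin (n+1) => ℂ) j).symm (ζ, y)) ≤
      (ball (fun i => z0 (j.succAbove i)) R).indicator (fun _ => K) y := by
    intro y
    by_cases hy : y ∈ ball (fun i => z0 (j.succAbove i)) R
    · rw [indicator_of_mem hy]
      refine le_trans (le_of_eq ?_) (h (j.insertNth 0 y : Fin (n+1) → ℂ))
      congr 1; ext ζ
      rw [← insertNth_eq_update]; rfl
    · rw [indicator_of_notMem hy, nonpos_iff_eq_zero]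
      have : ∀ ζ, H ((MeasurableEquiv.piFinSuccAbove (fun _ : Fin (n+1) => ℂ) j).symm (ζ, y)) = 0 := by
        intro ζ
        apply h0
        intro hh
        apply hy
        have hR : 0 < R := pos_of_mem_ball hh
        rw [mem_ball, dist_pi_lt_iff hR] at hh ⊢
        intro i
        have := hh (j.succAbove i)
        have e : (MeasurableEquiv.piFinSuccAbove (fun _ : Fin (n+1) => ℂ) j).symm (ζ, y) (j.succAbove i) = y i := by
          change (j.insertNth ζ y : Fin (n+1) → ℂ) (j.succAbove i) = y i
          simp
        rw [e] at this
        exact this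
      simp_rw [this, lintegral_zero]
  refine (lintegral_mono this).trans_lt ?_
  rw [lintegral_indicator measurableSet_ball, setLIntegral_const]
  exact ENNReal.mul_lt_top hK.lt_top measure_ball_lt_top

end slicing
end

section

section joint
variable {n : ℕ}

lemma line_limit {c : ℂ} {R : ℝ} {g a : ℂ → ℂ} (hg : Continuous g) (ha : Integrable ((ball c R).indicator (fun ζ => a ζ * g ζ)))
    (h : DbarEq1On (ball c R) g a) : ∀ᵐ w, w ∈ ball c R →
    Filter.Tendsto (fun m => ∫ ζ, g ζ * dbar1 (fun y => (rk ℂ m y : ℂ)) (w - ζ)) Filter.atTop (nhds (a w * g w)) := by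
  set b := (ball c R).indicator (fun ζ => a ζ * g ζ) with hb
  filter_upwards [mol_ae ha.locallyIntegrable] with w hw hwD
  have hbw : b w = a w * g w := by rw [hb, indicator_of_mem hwD]
  rw [hbw] at hw
  refine hw.congr' ?_
  rw [mem_ball] at hwD
  obtain ⟨m0, hm0⟩ := exists_nat_one_div_lt (show 0 < R - dist w c by linarith)
  filter_upwards [Filter.eventually_ge_atTop m0] with m hm
  have hm1 : 1 / ((m:ℝ) + 1) < R - dist w c := by
    refine lt_of_le_of_lt ?_ hm0
    gcongr
  have hsm : ContDiff ℝ (⊤ : ℕ∞) (fun y : ℂ => (rk ℂ m y : ℂ)) :=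
    Complex.ofRealCLM.contDiff.comp (rk_contDiff m)
  set φ : ℂ → ℂ := fun ζ => (rk ℂ m (w - ζ) : ℂ) with hφ
  have hφs : tsupport φ ⊆ closedBall w (1 / ((m:ℝ) + 1)) := by
    apply closure_minimal _ isClosed_closedBall
    intro ζ hζ
    by_contra hh
    apply hζ
    rw [mem_closedBall, not_le, dist_comm, dist_eq_norm] at hh
    simp [hφ, rk_zero m hh.le]
  have hφt : IsTest1 (ball c R) φ := by
    refine ⟨hsm.comp (contDiff_const.sub contDiff_id), ?_, ?_⟩
    · exact (isCompact_closedBall _ _).of_isClosed_subset (isClosed_tsupport _) hφs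
    · refine hφs.trans (closedBall_subset_ball' (by linarith))
  have h1 := h φ hφt
  have e1 : ∫ z in ball c R, g z * dbar1 φ z = - ∫ ζ, g ζ * dbar1 (fun y => (rk ℂ m y : ℂ)) (w - ζ) := by
    rw [← integral_neg, setIntegral_eq_integral_of_forall_compl_eq_zero]
    · congr 1; ext ζ
      rw [hφ, dbar1_comp_sub (fun y => (rk ℂ m y : ℂ)) (hsm.differentiable (by simp))]; ring
    · intro z hz
      rw [dbar1_tsupport φ (fun hh => hz (hφt.2.2 hh)), mul_zero]
  rw [e1, neg_inj, ← integral_indicator measurableSet_ball] at h1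
  rw [h1, mol_swap]
  congr 1; ext ζ
  by_cases hζ : ζ ∈ ball c R
  · rw [hb, indicator_of_mem hζ, indicator_of_mem hζ]; simp only [hφ]; ring
  · rw [hb, indicator_of_notMem hζ, indicator_of_notMem hζ, mul_zero]

lemma line_A (z0 : Fin n → ℂ) (R : ℝ) (j : Fin n) {p K : ENNReal} (hp : 1 ≤ p) (hK : K ≠ ⊤) {F : (Fin n → ℂ) → ℂ}
    (hF : Continuous F) (hFc : HasCompactSupport F)
    (H : ∀ x ∈ ball z0 R, ∃ a : ℂ → ℂ, AEStronglyMeasurable a (volume.restrict (ball (z0 j) R)) ∧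
      eLpNorm a p (volume.restrict (ball (z0 j) R)) ≤ K ∧ DbarEq1On (ball (z0 j) R) (fun ζ => F (Function.update x j ζ)) a) :
    ∃ A : (Fin n → ℂ) → ℂ, Measurable A ∧ (∀ z ∉ ball z0 R, A z = 0) ∧ (∀ z, F z = 0 → A z = 0) ∧
      (∀ x, eLpNorm (fun ζ => A (Function.update x j ζ)) p volume ≤ K) ∧
      (∀ φ, Tst (ball z0 R) φ → ∀ x, ∫ ζ, F (Function.update x j ζ) * WD Complex.I j φ (Function.update x j ζ) =
        - ∫ ζ, A (Function.update x j ζ) * F (Function.update x j ζ) * φ (Function.update x j ζ)) := by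
  classical
  set G : ℕ → (Fin n → ℂ) → ℂ := fun m z => ∫ ζ, F (Function.update z j ζ) * dbar1 (fun y => (rk ℂ m y : ℂ)) (z j - ζ) with hG
  have hGm : ∀ m, StronglyMeasurable (G m) := by
    intro m
    have hsm : ContDiff ℝ (⊤ : ℕ∞) (fun y : ℂ => (rk ℂ m y : ℂ)) :=
      Complex.ofRealCLM.contDiff.comp (rk_contDiff m)
    have : Continuous (fun q : (Fin n → ℂ) × ℂ => F (Function.update q.1 j q.2) * dbar1 (fun y => (rk ℂ m y : ℂ)) (q.1 j - q.2)) :=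
      (hF.comp (continuous_upd j)).mul ((dbar1_smooth hsm).comp (((continuous_apply j).comp continuous_fst).sub continuous_snd))
    exact this.stronglyMeasurable.integral_prod_right
  set g : (Fin n → ℂ) → ℂ := fun z => Filter.limUnder Filter.atTop (fun m => G m z) with hg
  have hgm : Measurable g := (StronglyMeasurable.limUnder hGm).measurable
  set A : (Fin n → ℂ) → ℂ := (ball z0 R).indicator (fun z => g z / F z) with hA
  have hAm : Measurable A := (hgm.div hF.measurable).indicator measurableSet_ball
  have hA0 : ∀ z ∉ ball z0 R, A z = 0 := fun z hz => by rw [hA, indicator_of_notMem hz]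
  have hAF : ∀ z, F z = 0 → A z = 0 := by
    intro z hz
    by_cases h : z ∈ ball z0 R
    · rw [hA, indicator_of_mem h, hz, div_zero]
    · exact hA0 z h
  obtain ⟨CF, hCF⟩ := hFc.exists_bound_of_continuous hF
  have hsl : ∀ x, Continuous (fun ζ => F (Function.update x j ζ)) := fun x => hF.comp (continuous_const.update j continuous_id)
  have key : ∀ x ∈ ball z0 R, ∃ a : ℂ → ℂ, 
      eLpNorm a p (volume.restrict (ball (z0 j) R)) ≤ K ∧ DbarEq1On (ball (z0 j) R) (fun ζ => F (Function.update x j ζ)) a ∧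
      ∀ᵐ w, A (Function.update x j w) = (ball (z0 j) R).indicator (fun w => if F (Function.update x j w) = 0 then 0 else a w) w := by
    intro x hx
    obtain ⟨a, h1, h2, h3⟩ := H x hx
    refine ⟨a, h2, h3, ?_⟩
    have hfin : IsFiniteMeasure (volume.restrict (ball (z0 j) R)) := ⟨by rw [Measure.restrict_apply_univ]; exact measure_ball_lt_top⟩
    have hai : IntegrableOn a (ball (z0 j) R) := by
      have : MemLp a p (volume.restrict (ball (z0 j) R)) := ⟨h1, h2.trans_lt hK.lt_top⟩
      exact this.integrable hp
    have hi : Integrable ((ball (z0 j) R).indicator (fun ζ => a ζ * F (Function.update x j ζ))) := by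
      rw [integrable_indicator_iff measurableSet_ball]
      exact hai.mul_bdd (c := CF) (hsl x).aestronglyMeasurable (ae_of_all _ fun ζ => hCF _)
    filter_upwards [line_limit (hsl x) hi h3] with w hw
    by_cases hwD : w ∈ ball (z0 j) R
    · have h4 := hw hwD
      have h5 : g (Function.update x j w) = a w * F (Function.update x j w) := by
        rw [hg]; simp only []
        apply Filter.Tendsto.limUnder_eq
        refine h4.congr fun m => ?_
        rw [hG]; simp
      rw [indicator_of_mem hwD, hA, indicator_of_mem (upd_mem_ball hx hwD), h5]
      by_cases h6 : F (Function.update x j w) = 0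
      · simp [h6]
      · simp [h6]
    · rw [indicator_of_notMem hwD]
      apply hA0
      intro hh
      have := dist_coord_le hh j
      rw [Function.update_self] at this
      exact hwD this
  have red : ∀ x, (∃ x' ∈ ball z0 R, ∀ ζ, Function.update x' j ζ = Function.update x j ζ) ∨ ∀ ζ, Function.update x j ζ ∉ ball z0 R := by
    intro x
    by_cases h : ∃ w, Function.update x j w ∈ ball z0 R
    · obtain ⟨w, hw⟩ := h
      exact Or.inl ⟨_, hw, fun ζ => by simp⟩
    · right; push Not at h; exact h
  refine ⟨A, hAm, hA0, hAF, ?_, ?_⟩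
  · intro x
    rcases red x with ⟨x', hx', he⟩ | h
    · simp_rw [← he]
      obtain ⟨a, h1, -, h3⟩ := key x' hx'
      rw [eLpNorm_congr_ae h3, eLpNorm_indicator_eq_eLpNorm_restrict measurableSet_ball]
      refine (eLpNorm_mono fun z => ?_).trans h1
      split_ifs <;> simp
    · have : (fun ζ => A (Function.update x j ζ)) = 0 := by
        ext ζ; exact hA0 _ (h ζ)
      rw [this]; simp
  · intro φ hφ x
    rcases red x with ⟨x', hx', he⟩ | h
    · simp_rw [← he]
      obtain ⟨a, -, h2, h3⟩ := key x' hx'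
      have ht : IsTest1 (ball (z0 j) R) (fun ζ => φ (Function.update x' j ζ)) := by
        refine ⟨slice_contDiff hφ.1 j x', slice_compact hφ.2.1 j x', (slice_tsupport j x').trans ?_⟩
        intro ζ hζ
        have := dist_coord_le (hφ.2.2 hζ) j
        rwa [Function.update_self] at this
      have h4 := h2 _ ht
      have hz : ∀ ζ ∉ ball (z0 j) R, Function.update x' j ζ ∉ ball z0 R := by
        intro ζ hζ hh
        have := dist_coord_le hh j
        rw [Function.update_self] at this
        exact hζ this
      simp_rw [dbar1_line (hφ.1.differentiable (by simp))] at h4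
      rw [setIntegral_eq_integral_of_forall_compl_eq_zero] at h4
      · rw [h4]; congr 1
        rw [← integral_indicator measurableSet_ball]
        apply integral_congr_ae
        filter_upwards [h3] with w hw
        by_cases hwD : w ∈ ball (z0 j) R
        · rw [indicator_of_mem hwD, hw, indicator_of_mem hwD]
          by_cases h6 : F (Function.update x' j w) = 0 <;> simp [h6]
        · rw [indicator_of_notMem hwD, hw, indicator_of_notMem hwD]; simp
      · intro ζ hζ
        rw [(hφ.WD Complex.I j).zero (hz ζ hζ), mul_zero]
    · simp [hA0 _ (h _), (hφ.WD Complex.I j).zero (h _)]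

end joint
end

section

section lines
variable {n : ℕ}

/-- line `L^q` bound -/
lemma line_Lq (z0 : Fin n → ℂ) (R : ℝ) (j : Fin n) {p : ENNReal} {K : ENNReal} (hK : K ≠ ⊤) {A : (Fin n → ℂ) → ℂ}
    (hA : Measurable A) (h0 : ∀ z ∉ ball z0 R, A z = 0) (hL : ∀ x, eLpNorm (fun ζ => A (Function.update x j ζ)) p volume ≤ K)
    {q : ℝ} (hq : 1 ≤ q) (hqp : ENNReal.ofReal q ≤ p) :
    ∃ K' : ENNReal, K' ≠ ⊤ ∧ ∀ x, (∫⁻ ζ, ‖A (Function.update x j ζ)‖ₑ ^ q) ≤ K' := by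
  set μ := (volume : Measure ℂ).restrict (ball (z0 j) R) with hμ
  have hμt : μ univ ≠ ⊤ := by rw [hμ, Measure.restrict_apply_univ]; exact measure_ball_lt_top.ne
  set e : ℝ := 1 / (ENNReal.ofReal q).toReal - 1 / p.toReal with he
  have he0 : 0 ≤ e := by
    rw [he, sub_nonneg]
    by_cases hpt : p = ⊤
    · rw [hpt]; simp
    · have : (ENNReal.ofReal q).toReal ≤ p.toReal := ENNReal.toReal_mono hpt hqp
      rw [ENNReal.toReal_ofReal (by linarith)] at *
      apply one_div_le_one_div_of_le (by linarith) this
  refine ⟨(K * μ univ ^ e) ^ q, ?_, fun x => ?_⟩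
  · have := ENNReal.rpow_ne_top_of_nonneg he0 hμt
    exact ENNReal.rpow_ne_top_of_nonneg (by linarith) (by finiteness)
  · have hm : Measurable (fun ζ => A (Function.update x j ζ)) := hA.comp (continuous_const.update j continuous_id).measurable
    have hs : (ball (z0 j) R).indicator (fun ζ => A (Function.update x j ζ)) = fun ζ => A (Function.update x j ζ) := by
      rw [indicator_eq_self]
      intro ζ hζ
      by_contra hh
      apply hζ
      apply h0
      intro h1
      have := dist_coord_le h1 j
      rw [Function.update_self] at this
      exact hh this
    have hr : ∀ s : ENNReal, eLpNorm (fun ζ => A (Function.update x j ζ)) s μ = eLpNorm (fun ζ => A (Function.update x j ζ)) s volume := by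
      intro s
      rw [hμ, ← eLpNorm_indicator_eq_eLpNorm_restrict measurableSet_ball, hs]
    have h1 := eLpNorm_le_eLpNorm_mul_rpow_measure_univ (μ := μ) hqp hm.aestronglyMeasurable
    rw [hr, hr, ← he] at h1
    have h2 := h1.trans (mul_le_mul_left (hL x) _)
    rw [eLpNorm_eq_lintegral_rpow_enorm_toReal (by simp; linarith) ENNReal.ofReal_ne_top, ENNReal.toReal_ofReal (by linarith)] at h2
    rw [one_div, ENNReal.rpow_inv_le_iff (by linarith)] at h2
    exact h2

lemma line_Pot (j : Fin n) {A : (Fin n → ℂ) → ℂ} (hA : Measurable A) {q : ℝ} (hq : 2 < q) {K' : ENNReal} (hK : K' ≠ ⊤)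
    (h : ∀ x, (∫⁻ ζ, ‖A (Function.update x j ζ)‖ₑ ^ q) ≤ K') : ∃ K, K ≠ ⊤ ∧ Pot q K j A := by
  obtain ⟨C, hC, hC'⟩ := ker2_holder q hq
  refine ⟨C * K' ^ (1 / q), ?_, ?_⟩
  · have := ENNReal.rpow_ne_top_of_nonneg (show 0 ≤ 1 / q by positivity) hK
    finiteness
  · intro x a b hab
    have hm : Measurable (fun ζ => ‖A (Function.update x j ζ)‖ₑ) := (hA.comp (continuous_const.update j continuous_id).measurable).enorm
    refine (hC' a b hab _ hm.aemeasurable).trans ?_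
    gcongr
    exact h x

lemma line_P1 (j : Fin n) {A : (Fin n → ℂ) → ℂ} (hA : Measurable A) {q : ℝ} {K K1 : ENNReal} (hK : K ≠ ⊤) (hK1 : K1 ≠ ⊤)
    (h : ∀ x, (∫⁻ ζ, ‖A (Function.update x j ζ)‖ₑ) ≤ K1) (hP : Pot q K j A) : ∃ N, N ≠ ⊤ ∧ P1 j A N := by
  refine ⟨K1 + 2 * K, by finiteness, ?_⟩
  intro x a
  have hm : Measurable (fun ζ => ‖A (Function.update x j ζ)‖ₑ) := (hA.comp (continuous_const.update j continuous_id).measurable).enorm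
  calc ∫⁻ ζ, ‖A (Function.update x j ζ)‖ₑ * ‖a - ζ‖ₑ⁻¹ ≤ ∫⁻ ζ, (‖A (Function.update x j ζ)‖ₑ + 2 * (‖A (Function.update x j ζ)‖ₑ * ker2 a (a + 1) ζ)) := by
        apply lintegral_mono; intro ζ
        calc _ ≤ ‖A (Function.update x j ζ)‖ₑ * (1 + 2 * ker2 a (a + 1) ζ) := mul_le_mul' le_rfl (inv_le_ker2 a ζ)
          _ = _ := by ring
    _ = (∫⁻ ζ, ‖A (Function.update x j ζ)‖ₑ) + 2 * ∫⁻ ζ, ‖A (Function.update x j ζ)‖ₑ * ker2 a (a + 1) ζ := by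
        rw [lintegral_add_left hm, lintegral_const_mul' _ _ (by simp)]
    _ ≤ K1 + 2 * K := by
        gcongr
        · exact h x
        · have := hP x a (a + 1) (by simp)
          simpa using this

lemma weak_of_lines (z0 : Fin n → ℂ) (R : ℝ) (j : Fin n) {F A φ : (Fin n → ℂ) → ℂ} (hF : Continuous F) (hA : Integrable A)
    (hφ : Tst (ball z0 R) φ) (h : ∀ x, ∫ ζ, F (Function.update x j ζ) * WD Complex.I j φ (Function.update x j ζ) =
        - ∫ ζ, A (Function.update x j ζ) * F (Function.update x j ζ) * φ (Function.update x j ζ))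
    (hAl : ∀ x, Integrable (fun ζ => A (Function.update x j ζ))) :
    ∫ z, F z * WD Complex.I j φ z = - ∫ z, A z * F z * φ z := by
  have hc : Continuous (fun z => F z * φ z) := hF.mul hφ.1.continuous
  have hcs : HasCompactSupport (fun z => F z * φ z) := hφ.2.1.mul_left
  obtain ⟨C, hC⟩ := hcs.exists_bound_of_continuous hc
  have i1 : Integrable (fun z => F z * WD Complex.I j φ z) :=
    (hF.mul (hφ.WD _ _).1.continuous).integrable_of_hasCompactSupport ((hφ.WD _ _).2.1.mul_left)
  have i2 : Integrable (fun z => A z * F z * φ z) := by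
    have := hA.mul_bdd (c := C) hc.aestronglyMeasurable (ae_of_all _ hC)
    refine this.congr (ae_of_all _ fun z => ?_)
    simp only []; ring
  rw [eq_neg_iff_add_eq_zero, ← integral_add i1 i2]
  apply integral_slice_zero j (i1.add i2)
  intro x
  have hu : Continuous (fun ζ => Function.update x j ζ) := continuous_const.update j continuous_id
  have j1 : Integrable (fun ζ => F (Function.update x j ζ) * WD Complex.I j φ (Function.update x j ζ)) :=
    ((hF.comp hu).mul ((hφ.WD _ _).1.continuous.comp hu)).integrable_of_hasCompactSupport ((slice_compact (hφ.WD _ _).2.1 j x).mul_left)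
  have j2 : Integrable (fun ζ => A (Function.update x j ζ) * F (Function.update x j ζ) * φ (Function.update x j ζ)) := by
    have := (hAl x).mul_bdd (c := C) (hc.comp hu).aestronglyMeasurable (ae_of_all _ fun ζ => hC _)
    refine this.congr (ae_of_all _ fun z => ?_)
    simp only [Function.comp]; ring
  have := integral_add j1 j2
  simp only [Pi.add_apply]
  rw [this, h x, neg_add_cancel]

end lines
end

section

/-- package of local data -/
structure LocData (n : ℕ) (p : ENNReal) (z0 : Fin n → ℂ) (R : ℝ) (F : (Fin n → ℂ) → ℂ) (A : Fin n → (Fin n → ℂ) → ℂ) : Prop where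
  cont : Continuous F
  comp : HasCompactSupport F
  meas : ∀ j, Measurable (A j)
  off : ∀ j, ∀ z ∉ ball z0 R, A j z = 0
  zer : ∀ j z, F z = 0 → A j z = 0
  int1 : ∀ j, Integrable (A j)
  int2 : ∀ j, Integrable (fun z => ‖A j z‖ ^ 2)
  pot : ∀ q : ℝ, 2 < q → ENNReal.ofReal q ≤ p → ∀ j, ∃ K, K ≠ ⊤ ∧ Pot q K j (A j)
  p1 : ∀ j, ∃ N, N ≠ ⊤ ∧ P1 j (A j) N
  weak : ∀ j φ, Tst (ball z0 R) φ → ∫ z, F z * WD Complex.I j φ z = - ∫ z, A j z * F z * φ z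

lemma DbarEq1On.mono {U D : Set ℂ} (hU : MeasurableSet U) (hDU : D ⊆ U) {g A : ℂ → ℂ} (h : DbarEq1On U g A) : DbarEq1On D g A := by
  intro φ hφ
  have h1 := h φ ⟨hφ.1, hφ.2.1, hφ.2.2.trans hDU⟩
  rw [setIntegral_eq_of_subset_of_forall_sdiff_eq_zero hU hDU (f := fun z => g z * dbar1 φ z),
    setIntegral_eq_of_subset_of_forall_sdiff_eq_zero hU hDU (f := fun z => A z * g z * φ z)] at h1
  · exact h1
  · intro z hz; rw [image_eq_zero_of_notMem_tsupport (fun hh => hz.2 (hφ.2.2 hh)), mul_zero]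
  · intro z hz; rw [dbar1_tsupport φ (fun hh => hz.2 (hφ.2.2 hh)), mul_zero]

theorem loc_data (n : ℕ) (p : ENNReal) (hp : 2 < p)
    (Ω : Set (Fin n → ℂ)) (hΩ : IsOpen Ω)
    (f : (Fin n → ℂ) → ℂ) (hf : ContinuousOn f Ω)
    (M : ℝ) (hL : ∀ j : Fin n, ∀ c : Fin n → ℂ, CondL n Ω f p M j c) (z0 : Fin n → ℂ) (hz0 : z0 ∈ Ω) :
    ∃ R : ℝ, 0 < R ∧ ball z0 R ⊆ Ω ∧ ∃ F A, (∀ z ∈ ball z0 R, F z = f z) ∧ LocData n p z0 R F A := by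
  obtain ⟨R0, hR0, hR0Ω⟩ := Metric.isOpen_iff.1 hΩ z0 hz0
  let β : ContDiffBump z0 := ⟨R0 / 4, R0 / 2, by positivity, by linarith⟩
  set F : (Fin n → ℂ) → ℂ := fun z => (β z : ℂ) * f z with hFd
  have hβs : tsupport β ⊆ ball z0 R0 := by
    rw [β.tsupport_eq]; exact closedBall_subset_ball (half_lt_self hR0)
  have hFc : Continuous F := by
    rw [continuous_iff_continuousAt]
    intro x
    by_cases hx : x ∈ ball z0 R0
    · exact (Complex.continuous_ofReal.comp β.continuous).continuousAt.mul (hf.continuousAt (hΩ.mem_nhds (hR0Ω hx)))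
    · have h1 : x ∉ tsupport β := fun h => hx (hβs h)
      have : F =ᶠ[nhds x] fun _ => 0 := by
        filter_upwards [(isClosed_tsupport _).isOpen_compl.mem_nhds h1] with z hz
        simp [hFd, image_eq_zero_of_notMem_tsupport hz]
      exact continuousAt_const.congr this.symm
  have hFs : HasCompactSupport F := by
    have : HasCompactSupport (fun z => (β z : ℂ)) := β.hasCompactSupport.comp_left (g := fun x : ℝ => (x : ℂ)) (by simp)
    exact this.mul_right
  set R := R0 / 4 with hR
  have hRp : 0 < R := by positivity
  have hRR : ball z0 R ⊆ Ω := (ball_subset_ball (by rw [hR]; linarith)).trans hR0Ω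
  have hFf : ∀ z ∈ ball z0 R, F z = f z := by
    intro z hz
    have : β z = 1 := β.one_of_mem_closedBall (ball_subset_closedBall hz)
    simp [hFd, this]
  have hp1 : 1 ≤ p := le_trans (by norm_num) hp.le
  have HA : ∀ j, _ := fun j => line_A z0 R j hp1 (ENNReal.ofReal_ne_top (r := M)) hFc hFs (by
    intro x hx
    obtain ⟨a, ha1, ha2⟩ := hL j x
    set U := {ζ : ℂ | Function.update x j ζ ∈ Ω} with hU
    have hUo : IsOpen U := hΩ.preimage (continuous_const.update j continuous_id)
    have hDU : ball (z0 j) R ⊆ U := fun ζ hζ => hRR (upd_mem_ball hx hζ)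
    have h1 := ha2.mono hUo.measurableSet hDU
    have h2 : DbarEq1On (ball (z0 j) R) (fun ζ => F (Function.update x j ζ)) a := by
      intro φ hφ
      have h3 := h1 φ hφ
      have e1 : ∫ z in ball (z0 j) R, F (Function.update x j z) * dbar1 φ z = ∫ z in ball (z0 j) R, f (Function.update x j z) * dbar1 φ z :=
        setIntegral_congr_fun measurableSet_ball (fun ζ hζ => by rw [hFf _ (upd_mem_ball hx hζ)])
      have e2 : ∫ z in ball (z0 j) R, a z * F (Function.update x j z) * φ z = ∫ z in ball (z0 j) R, a z * f (Function.update x j z) * φ z :=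
        setIntegral_congr_fun measurableSet_ball (fun ζ hζ => by rw [hFf _ (upd_mem_ball hx hζ)])
      simp only []
      rw [e1, e2]; exact h3
    exact line_fix isOpen_ball (hFc.comp (continuous_const.update j continuous_id)).continuousOn
      ((eLpNorm_mono_measure _ (Measure.restrict_mono hDU le_rfl)).trans ha1) h2)
  choose A hAm hA0 hAF hAL hAW using HA
  have hq := fun (j : Fin n) (q : ℝ) (h1 : 1 ≤ q) (h2 : ENNReal.ofReal q ≤ p) => line_Lq z0 R j (ENNReal.ofReal_ne_top (r := M)) (hAm j) (hA0 j) (hAL j) h1 h2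
  have hpot : ∀ q : ℝ, 2 < q → ENNReal.ofReal q ≤ p → ∀ j, ∃ K, K ≠ ⊤ ∧ Pot q K j (A j) := by
    intro q h1 h2 j
    obtain ⟨K', hK', h⟩ := hq j q (by linarith) h2
    exact line_Pot j (hAm j) h1 hK' h
  have hl1 : ∀ j, ∃ K : ENNReal, K ≠ ⊤ ∧ ∀ x, ∫⁻ ζ, ‖A j (Function.update x j ζ)‖ₑ ≤ K := by
    intro j
    obtain ⟨K', hK', h⟩ := hq j 1 le_rfl (by simpa using hp1)
    exact ⟨K', hK', fun x => by simpa using h x⟩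
  have hl2 : ∀ j, ∃ K : ENNReal, K ≠ ⊤ ∧ ∀ x, ∫⁻ ζ, ‖A j (Function.update x j ζ)‖ₑ ^ (2:ℝ) ≤ K := by
    intro j
    exact hq j 2 (by norm_num) (by simpa using hp.le)
  have hi1 : ∀ j, Integrable (A j) := by
    intro j
    obtain ⟨K, hK, h⟩ := hl1 j
    refine ⟨(hAm j).aestronglyMeasurable, ?_⟩
    exact lintegral_slice_lt_top z0 R j (hAm j).enorm (fun z hz => by simp [hA0 j z hz]) hK h
  have hi2 : ∀ j, Integrable (fun z => ‖A j z‖ ^ 2) := by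
    intro j
    obtain ⟨K, hK, h⟩ := hl2 j
    refine ⟨((hAm j).norm.pow_const 2).aestronglyMeasurable, ?_⟩
    have := lintegral_slice_lt_top z0 R j ((hAm j).enorm.pow_const (2:ℝ)) (fun z hz => by simp [hA0 j z hz]) hK h
    refine lt_of_le_of_lt (le_of_eq ?_) this
    apply lintegral_congr; intro z
    rw [← ofReal_norm, ← ofReal_norm, ENNReal.ofReal_rpow_of_nonneg (norm_nonneg _) (by norm_num)]
    simp
  obtain ⟨q0, hq0, hq0p⟩ : ∃ q0 : ℝ, 2 < q0 ∧ ENNReal.ofReal q0 ≤ p := by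
    by_cases h : p = ⊤
    · exact ⟨3, by norm_num, by simp [h]⟩
    · refine ⟨p.toReal, ?_, by rw [ENNReal.ofReal_toReal h]⟩
      have := (ENNReal.toReal_lt_toReal (by simp) h).2 hp
      simpa using this
  refine ⟨R, hRp, hRR, F, A, hFf, hFc, hFs, hAm, hA0, hAF, hi1, hi2, hpot, ?_, ?_⟩
  · intro j
    obtain ⟨K1, hK1, h1⟩ := hl1 j
    obtain ⟨K, hK, h⟩ := hpot q0 hq0 hq0p j
    exact line_P1 j (hAm j) hK hK1 h1 h
  · intro j φ hφ
    apply weak_of_lines z0 R j hFc (hi1 j) hφ (hAW j φ hφ)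
    intro x
    obtain ⟨K1, hK1, h1⟩ := hl1 j
    exact ⟨((hAm j).comp (continuous_const.update j continuous_id).measurable).aestronglyMeasurable, (h1 x).trans_lt hK1.lt_top⟩

end

section

section idn
variable {n : ℕ} {σ : ℂ} {j k : Fin n}
/-- complex conjugation -/
abbrev cj : ℂ →+* ℂ := starRingEnd ℂ

lemma ibp {V : Set (Fin n → ℂ)} {φ g : (Fin n → ℂ) → ℂ} (hφ : Tst V φ) (hg : ContDiff ℝ (⊤ : ℕ∞) g) (σ : ℂ) (j : Fin n) :
    ∫ z, g z * WD σ j φ z = - ∫ z, φ z * WD σ j g z := by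
  have h1 := integral_WD_eq_zero (σ := σ) (j := j) (hφ.mul_right hg).1 (hφ.mul_right hg).2.1
  have h2 : ∀ z, WD σ j (fun z => φ z * g z) z = φ z * WD σ j g z + g z * WD σ j φ z := by
    intro z
    rw [WD_mul (hφ.1.differentiable (by simp) z) (hg.differentiable (by simp) z)]; ring
  simp_rw [h2] at h1
  rw [integral_add] at h1
  · linear_combination h1
  · exact (hφ.mul_right (WD_contDiff hg)).1.continuous.integrable_of_hasCompactSupport (hφ.mul_right (WD_contDiff hg)).2.1
  · exact (hg.continuous.mul (hφ.WD σ j).1.continuous).integrable_of_hasCompactSupport (hφ.WD σ j).2.1.mul_left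

/-- regularised denominator -/
def Dn (u : (Fin n → ℂ) → ℂ) (ε : ℝ) (z : Fin n → ℂ) : ℂ := u z * cj (u z) + (ε:ℂ) ^ 2
def Tn (u : (Fin n → ℂ) → ℂ) (ε : ℝ) (z : Fin n → ℂ) : ℂ := cj (u z) / Dn u ε z

lemma Dn_eq (u : (Fin n → ℂ) → ℂ) (ε : ℝ) (z : Fin n → ℂ) : Dn u ε z = ((‖u z‖ ^ 2 + ε ^ 2 : ℝ) : ℂ) := by
  rw [Dn, Complex.mul_conj, Complex.normSq_eq_norm_sq]; push_cast; ring

lemma Dn_pos {ε : ℝ} (hε : 0 < ε) (u : (Fin n → ℂ) → ℂ) (z : Fin n → ℂ) : 0 < ‖u z‖ ^ 2 + ε ^ 2 := by positivity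

lemma Dn_ne {ε : ℝ} (hε : 0 < ε) (u : (Fin n → ℂ) → ℂ) (z : Fin n → ℂ) : Dn u ε z ≠ 0 := by
  rw [Dn_eq]; exact_mod_cast (Dn_pos hε u z).ne'

variable {u : (Fin n → ℂ) → ℂ} {ε : ℝ}

lemma cj_contDiff (hu : ContDiff ℝ (⊤ : ℕ∞) u) : ContDiff ℝ (⊤ : ℕ∞) (fun z => cj (u z)) := Complex.conjCLE.contDiff.comp hu

lemma Dn_contDiff (hu : ContDiff ℝ (⊤ : ℕ∞) u) (ε : ℝ) : ContDiff ℝ (⊤ : ℕ∞) (Dn u ε) := (hu.mul (cj_contDiff hu)).add contDiff_const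

lemma Tn_contDiff (hu : ContDiff ℝ (⊤ : ℕ∞) u) (hε : 0 < ε) : ContDiff ℝ (⊤ : ℕ∞) (Tn u ε) := by
  have := (Dn_contDiff hu ε).inv (Dn_ne hε u)
  have h2 := (cj_contDiff hu).mul this
  have e : Tn u ε = fun z => cj (u z) * (Dn u ε z)⁻¹ := by ext z; rw [Tn, div_eq_mul_inv]
  rw [e]; exact h2

lemma WD_Dn (hu : ContDiff ℝ (⊤ : ℕ∞) u) (z : Fin n → ℂ) : WD σ j (Dn u ε) z = u z * WD σ j (fun z => cj (u z)) z + WD σ j u z * cj (u z) := by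
  have d1 := hu.differentiable (by simp) z
  have d2 := (cj_contDiff hu).differentiable (by simp) z
  have e : Dn u ε = fun z => (fun z => u z * cj (u z)) z + (fun _ => (ε:ℂ)^2) z := by ext z; rfl
  rw [e, WD_add (φ := fun z => u z * cj (u z)) (d1.mul d2) (differentiableAt_const _), WD_mul d1 d2, WD_const, add_zero]

lemma WD_Tn (hu : ContDiff ℝ (⊤ : ℕ∞) u) (hε : 0 < ε) (z : Fin n → ℂ) : WD σ j (Tn u ε) z =
    ((ε:ℂ)^2 * WD σ j (fun z => cj (u z)) z - cj (u z) ^ 2 * WD σ j u z) / Dn u ε z ^ 2 := by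
  have hne := Dn_ne hε u z
  have d1 := (Tn_contDiff hu hε).differentiable (by simp) z
  have d2 := (Dn_contDiff hu ε).differentiable (by simp) z
  have e : (fun z => Tn u ε z * Dn u ε z) = fun z => cj (u z) := by
    ext z; rw [Tn, div_mul_cancel₀ _ (Dn_ne hε u z)]
  have h1 := WD_mul (σ := σ) (j := j) d1 d2
  rw [e, WD_Dn hu] at h1
  rw [eq_div_iff (pow_ne_zero 2 hne)]
  have hT : Tn u ε z * Dn u ε z = cj (u z) := by rw [Tn, div_mul_cancel₀ _ hne]
  have hD : Dn u ε z = u z * cj (u z) + (ε:ℂ)^2 := rfl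
  set W := WD σ j (fun z => cj (u z)) z
  set W' := WD σ j u z
  have h2 : WD σ j (Tn u ε) z * Dn u ε z ^ 2 = W * Dn u ε z - (Tn u ε z * Dn u ε z) * (u z * W + W' * cj (u z)) := by
    linear_combination (-(Dn u ε z)) * h1
  rw [h2, hT, hD]; ring

lemma ident_I (hu : ContDiff ℝ (⊤ : ℕ∞) u) (hε : 0 < ε) {V : Set (Fin n → ℂ)} {φ : (Fin n → ℂ) → ℂ} (hφ : Tst V φ) (j k : Fin n) :
    (∫ z, Tn u ε z * WD Complex.I j u z * WD Complex.I k φ z) - ∫ z, Tn u ε z * WD Complex.I k u z * WD Complex.I j φ z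
    = - ∫ z, φ z * ((ε:ℂ)^2 / Dn u ε z ^ 2 * (cj (WD (-Complex.I) k u z) * WD Complex.I j u z - cj (WD (-Complex.I) j u z) * WD Complex.I k u z)) := by
  have hT := Tn_contDiff hu hε
  have c1 : ∀ j : Fin n, ContDiff ℝ (⊤ : ℕ∞) (fun z => Tn u ε z * WD Complex.I j u z) := fun j => hT.mul (WD_contDiff hu)
  rw [ibp hφ (c1 j) Complex.I k, ibp hφ (c1 k) Complex.I j, ← sub_eq_zero]
  have ii : ∀ j k : Fin n, Integrable (fun z => φ z * WD Complex.I k (fun z => Tn u ε z * WD Complex.I j u z) z) := fun j k =>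
    (hφ.mul_right (WD_contDiff (c1 j))).1.continuous.integrable_of_hasCompactSupport (hφ.mul_right (WD_contDiff (c1 j))).2.1
  have : ∀ z, φ z * ((ε:ℂ)^2 / Dn u ε z ^ 2 * (cj (WD (-Complex.I) k u z) * WD Complex.I j u z - cj (WD (-Complex.I) j u z) * WD Complex.I k u z))
     = φ z * WD Complex.I k (fun z => Tn u ε z * WD Complex.I j u z) z - φ z * WD Complex.I j (fun z => Tn u ε z * WD Complex.I k u z) z := by
    intro z
    have dT := hT.differentiable (by simp) z
    have dP : ∀ j : Fin n, DifferentiableAt ℝ (WD Complex.I j u) z := fun j => (WD_contDiff hu).differentiable (by simp) z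
    rw [WD_mul dT (dP j), WD_mul dT (dP k), WD_Tn hu hε, WD_Tn hu hε, WD_comm (j := k) (k := j) hu z, WD_conj (hu.differentiable (by simp) z), WD_conj (hu.differentiable (by simp) z)]
    simp only [Complex.conj_I]
    have hne := Dn_ne hε u z
    field_simp
    ring
  simp_rw [this]
  rw [integral_sub (ii j k) (ii k j)]
  ring

lemma ident_II (hu : ContDiff ℝ (⊤ : ℕ∞) u) (hε : 0 < ε) {V : Set (Fin n → ℂ)} {θ : (Fin n → ℂ) → ℂ} (hθ : Tst V θ) (k : Fin n) :
    ∫ z, θ z * ((ε:ℂ)^2 / Dn u ε z ^ 2 * (WD (-Complex.I) k u z * cj (WD (-Complex.I) k u z))) =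
    (∫ z, θ z * ((ε:ℂ)^2 / Dn u ε z ^ 2 * (WD Complex.I k u z * cj (WD Complex.I k u z))))
    + (∫ z, Complex.log (Dn u ε z) * WD (-Complex.I) k (WD Complex.I k θ) z)
    + (∫ z, (u z / Dn u ε z * cj (WD Complex.I k u z)) * WD Complex.I k θ z)
    + ∫ z, (Tn u ε z * WD Complex.I k u z) * WD (-Complex.I) k θ z := by
  have hT := Tn_contDiff hu hε
  have hne := Dn_ne hε u
  have hDi : ContDiff ℝ (⊤ : ℕ∞) (fun z => (Dn u ε z)⁻¹) := (Dn_contDiff hu ε).inv hne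
  have hsl : ∀ z, Dn u ε z ∈ Complex.slitPlane := fun z => by
    rw [Dn_eq]; exact Complex.ofReal_mem_slitPlane.2 (Dn_pos hε u z)
  have hS : ContDiff ℝ (⊤ : ℕ∞) (fun z => Complex.log (Dn u ε z)) := by
    rw [contDiff_iff_contDiffAt]; intro z
    exact ((Complex.contDiffAt_log (hsl z)).restrict_scalars ℝ).comp z (Dn_contDiff hu ε).contDiffAt
  have cP : ∀ σ : ℂ, ContDiff ℝ (⊤ : ℕ∞) (fun z => Tn u ε z * WD σ k u z) := fun σ => hT.mul (WD_contDiff hu)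
  have cR : ContDiff ℝ (⊤ : ℕ∞) (fun z => u z / Dn u ε z * cj (WD Complex.I k u z)) := by
    have := (hu.mul hDi).mul (cj_contDiff (u := WD Complex.I k u) (WD_contDiff hu))
    simpa only [div_eq_mul_inv] using this
  have i1 : ∀ σ τ : ℂ, Integrable (fun z => θ z * WD τ k (fun z => Tn u ε z * WD σ k u z) z) := fun σ τ =>
    (hθ.mul_right (WD_contDiff (cP σ))).1.continuous.integrable_of_hasCompactSupport (hθ.mul_right (WD_contDiff (cP σ))).2.1
  -- difference identity
  have cX : ∀ σ : ℂ, Integrable (fun z => θ z * ((ε:ℂ)^2 / Dn u ε z ^ 2 * (WD σ k u z * cj (WD σ k u z)))) := by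
    intro σ
    have c : ContDiff ℝ (⊤ : ℕ∞) (fun z => (ε:ℂ)^2 / Dn u ε z ^ 2 * (WD σ k u z * cj (WD σ k u z))) := by
      have := ((contDiff_const (c := (ε:ℂ)^2)).mul (hDi.pow 2)).mul ((WD_contDiff (σ := σ) (j := k) hu).mul (cj_contDiff (u := WD σ k u) (WD_contDiff hu)))
      simpa only [div_eq_mul_inv, inv_pow] using this
    exact (hθ.mul_right c).1.continuous.integrable_of_hasCompactSupport (hθ.mul_right c).2.1
  have hpt : ∀ z, θ z * ((ε:ℂ)^2 / Dn u ε z ^ 2 * (WD (-Complex.I) k u z * cj (WD (-Complex.I) k u z))) =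
      θ z * ((ε:ℂ)^2 / Dn u ε z ^ 2 * (WD Complex.I k u z * cj (WD Complex.I k u z))) +
      (θ z * WD Complex.I k (fun z => Tn u ε z * WD (-Complex.I) k u z) z - θ z * WD (-Complex.I) k (fun z => Tn u ε z * WD Complex.I k u z) z) := by
    intro z
    have dT := hT.differentiable (by simp) z
    have dP : ∀ σ : ℂ, DifferentiableAt ℝ (WD σ k u) z := fun σ => (WD_contDiff hu).differentiable (by simp) z
    rw [WD_mul dT (dP _), WD_mul dT (dP _), WD_Tn hu hε, WD_Tn hu hε, WD_comm (σ := Complex.I) (τ := -Complex.I) (j := k) (k := k) hu z, WD_conj (hu.differentiable (by simp) z), WD_conj (hu.differentiable (by simp) z)]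
    simp only [Complex.conj_I, map_neg, neg_neg]
    have hne := hne z
    field_simp
    ring
  simp_rw [hpt]
  have i2 : Integrable (fun z => θ z * WD Complex.I k (fun z => Tn u ε z * WD (-Complex.I) k u z) z - θ z * WD (-Complex.I) k (fun z => Tn u ε z * WD Complex.I k u z) z) := (i1 _ _).sub (i1 _ _)
  rw [integral_add (cX _) i2, integral_sub (i1 _ _) (i1 _ _)]
  have a1 := ibp hθ (cP (-Complex.I)) Complex.I k
  have a2 := ibp hθ (cP Complex.I) (-Complex.I) k
  have a3 := ibp (hθ.WD Complex.I k) hS (-Complex.I) k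
  have hWS : ∀ z, WD (-Complex.I) k (fun z => Complex.log (Dn u ε z)) z = u z / Dn u ε z * cj (WD Complex.I k u z) + Tn u ε z * WD (-Complex.I) k u z := by
    intro z
    rw [WD_comp_holo ((Dn_contDiff hu ε).differentiable (by simp) z) (Complex.hasDerivAt_log (hsl z)), WD_Dn hu, WD_conj (hu.differentiable (by simp) z), Tn]
    simp only [Complex.conj_I, map_neg, neg_neg]
    have hne := hne z
    field_simp
  simp_rw [hWS, mul_add] at a3
  rw [integral_add] at a3
  · have e1 : ∫ z, WD Complex.I k θ z * (u z / Dn u ε z * cj (WD Complex.I k u z)) = ∫ z, (u z / Dn u ε z * cj (WD Complex.I k u z)) * WD Complex.I k θ z := by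
      congr 1; ext z; ring
    have e2 : ∫ z, WD Complex.I k θ z * (Tn u ε z * WD (-Complex.I) k u z) = ∫ z, (Tn u ε z * WD (-Complex.I) k u z) * WD Complex.I k θ z := by
      congr 1; ext z; ring
    rw [e1, e2] at a3
    linear_combination a1 - a2 - a3
  · exact ((hθ.WD Complex.I k).mul_right cR).1.continuous.integrable_of_hasCompactSupport ((hθ.WD Complex.I k).mul_right cR).2.1
  · exact ((hθ.WD Complex.I k).mul_right (cP _)).1.continuous.integrable_of_hasCompactSupport ((hθ.WD Complex.I k).mul_right (cP _)).2.1

end idn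
end

section

section est
variable {n : ℕ}

/-- weighted energy -/
def Zq (u : (Fin n → ℂ) → ℂ) (ε : ℝ) (θ : (Fin n → ℂ) → ℝ) (σ : ℂ) (k : Fin n) : ℝ :=
  ∫ z, θ z * (ε ^ 2 / (‖u z‖ ^ 2 + ε ^ 2) ^ 2 * ‖WD σ k u z‖ ^ 2)

lemma Zq_integrable {V : Set (Fin n → ℂ)} {u : (Fin n → ℂ) → ℂ} (hu : ContDiff ℝ (⊤ : ℕ∞) u) {ε : ℝ} (hε : 0 < ε)
    {θ : (Fin n → ℂ) → ℝ} (hθ : Tst V (fun z => (θ z : ℂ))) (σ : ℂ) (k : Fin n) :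
    Integrable (fun z => θ z * (ε ^ 2 / (‖u z‖ ^ 2 + ε ^ 2) ^ 2 * ‖WD σ k u z‖ ^ 2)) := by
  have hθc : Continuous θ := Complex.continuous_re.comp hθ.1.continuous
  have hθs : HasCompactSupport θ := hθ.2.1.comp_left (g := Complex.re) (by simp)
  have hW : Continuous (WD σ k u) := (WD_contDiff hu).continuous
  have hu' := hu.continuous
  refine Continuous.integrable_of_hasCompactSupport ?_ hθs.mul_right
  refine hθc.mul ((continuous_const.div (by fun_prop) ?_).mul (by fun_prop))
  intro z; have := Dn_pos hε u z; positivity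

lemma Zq_cast {u : (Fin n → ℂ) → ℂ} {ε : ℝ} {θ : (Fin n → ℂ) → ℝ} (σ : ℂ) (k : Fin n) :
    ((Zq u ε θ σ k : ℝ) : ℂ) = ∫ z, (θ z : ℂ) * ((ε:ℂ)^2 / Dn u ε z ^ 2 * (WD σ k u z * cj (WD σ k u z))) := by
  rw [Zq, ← integral_complex_ofReal]
  congr 1; ext z
  rw [Dn_eq, Complex.mul_conj, Complex.normSq_eq_norm_sq]; push_cast; ring

lemma sm_est2 {V : Set (Fin n → ℂ)} {u : (Fin n → ℂ) → ℂ} (hu : ContDiff ℝ (⊤ : ℕ∞) u) {ε : ℝ} (hε : 0 < ε)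
    {θ : (Fin n → ℂ) → ℝ} (hθ : Tst V (fun z => (θ z : ℂ))) (k : Fin n) {Λ : ℝ} (hΛ : ∀ z, ‖Complex.log (Dn u ε z)‖ ≤ Λ) :
    Zq u ε θ (-Complex.I) k ≤ Zq u ε θ Complex.I k
      + Λ * (∫ z, ‖WD (-Complex.I) k (WD Complex.I k (fun z => (θ z : ℂ))) z‖)
      + 2 * ‖∫ z, (Tn u ε z * WD Complex.I k u z) * WD (-Complex.I) k (fun z => (θ z : ℂ)) z‖ := by
  have h := ident_II hu hε hθ k
  rw [← Zq_cast, ← Zq_cast] at h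
  have hW : ∀ z, WD (-Complex.I) k (fun z => (θ z : ℂ)) z = cj (WD Complex.I k (fun z => (θ z : ℂ)) z) := by
    intro z
    have := WD_conj (σ := -Complex.I) (j := k) (hθ.1.differentiable (by simp) z)
    simpa using this
  have e : ‖∫ z, (u z / Dn u ε z * cj (WD Complex.I k u z)) * WD Complex.I k (fun z => (θ z : ℂ)) z‖
      = ‖∫ z, (Tn u ε z * WD Complex.I k u z) * WD (-Complex.I) k (fun z => (θ z : ℂ)) z‖ := by
    have : ∫ z, (u z / Dn u ε z * cj (WD Complex.I k u z)) * WD Complex.I k (fun z => (θ z : ℂ)) z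
      = cj (∫ z, (Tn u ε z * WD Complex.I k u z) * WD (-Complex.I) k (fun z => (θ z : ℂ)) z) := by
      rw [← integral_conj]; congr 1; ext z
      rw [hW, Tn, Dn_eq]; simp
    rw [this]; exact RCLike.norm_conj _
  have hl : ‖∫ z, Complex.log (Dn u ε z) * WD (-Complex.I) k (WD Complex.I k (fun z => (θ z : ℂ))) z‖ ≤
      Λ * (∫ z, ‖WD (-Complex.I) k (WD Complex.I k (fun z => (θ z : ℂ))) z‖) := by
    rw [← integral_const_mul]
    have hT := (hθ.WD Complex.I k).WD (-Complex.I) k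
    apply norm_integral_le_of_norm_le
    · exact ((hT.1.continuous.integrable_of_hasCompactSupport hT.2.1).norm).const_mul _
    · refine ae_of_all _ fun z => ?_
      rw [norm_mul]; exact mul_le_mul_of_nonneg_right (hΛ z) (norm_nonneg _)
  have h2 := congrArg Complex.re h
  simp only [Complex.add_re, Complex.ofReal_re] at h2
  have r1 := Complex.re_le_norm (∫ z, Complex.log (Dn u ε z) * WD (-Complex.I) k (WD Complex.I k (fun z => (θ z : ℂ))) z)
  have r2 := Complex.re_le_norm (∫ z, (u z / Dn u ε z * cj (WD Complex.I k u z)) * WD Complex.I k (fun z => (θ z : ℂ)) z)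
  have r3 := Complex.re_le_norm (∫ z, (Tn u ε z * WD Complex.I k u z) * WD (-Complex.I) k (fun z => (θ z : ℂ)) z)
  rw [e] at r2
  linarith

lemma amgm {a b t : ℝ} (ht : 0 < t) : a * b ≤ (t * a ^ 2 + b ^ 2 / t) / 2 := by
  have h0 : b ^ 2 / t = t * (b / t) ^ 2 := by field_simp
  have h1 : a * b = t * (a * (b / t)) := by field_simp
  rw [h0, h1]
  nlinarith [mul_nonneg ht.le (sq_nonneg (a - b / t))]

lemma sm_est1 {V : Set (Fin n → ℂ)} {u : (Fin n → ℂ) → ℂ} (hu : ContDiff ℝ (⊤ : ℕ∞) u) {ε : ℝ} (hε : 0 < ε)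
    {θ : (Fin n → ℂ) → ℝ} (hθ : Tst V (fun z => (θ z : ℂ))) {φ : (Fin n → ℂ) → ℂ} (hφ : Tst V φ)
    {c : ℝ} (hc : ∀ z, ‖φ z‖ ≤ c * θ z) (j k : Fin n) {t : ℝ} (ht : 0 < t) :
    ‖(∫ z, Tn u ε z * WD Complex.I j u z * WD Complex.I k φ z) - ∫ z, Tn u ε z * WD Complex.I k u z * WD Complex.I j φ z‖
    ≤ c / 2 * (t * (Zq u ε θ (-Complex.I) k + Zq u ε θ (-Complex.I) j) + (Zq u ε θ Complex.I j + Zq u ε θ Complex.I k) / t) := by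
  rw [ident_I hu hε hφ, norm_neg]
  have i := fun σ k => Zq_integrable hu hε hθ σ k
  have e : c / 2 * (t * (Zq u ε θ (-Complex.I) k + Zq u ε θ (-Complex.I) j) + (Zq u ε θ Complex.I j + Zq u ε θ Complex.I k) / t) =
    ∫ z, (c / 2 * t * (θ z * (ε ^ 2 / (‖u z‖ ^ 2 + ε ^ 2) ^ 2 * ‖WD (-Complex.I) k u z‖ ^ 2)) +
      c / 2 * t * (θ z * (ε ^ 2 / (‖u z‖ ^ 2 + ε ^ 2) ^ 2 * ‖WD (-Complex.I) j u z‖ ^ 2))) +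
      (c / 2 / t * (θ z * (ε ^ 2 / (‖u z‖ ^ 2 + ε ^ 2) ^ 2 * ‖WD Complex.I j u z‖ ^ 2)) +
      c / 2 / t * (θ z * (ε ^ 2 / (‖u z‖ ^ 2 + ε ^ 2) ^ 2 * ‖WD Complex.I k u z‖ ^ 2))) := by
    rw [integral_add, integral_add ((i _ _).const_mul _) ((i _ _).const_mul _), integral_add ((i _ _).const_mul _) ((i _ _).const_mul _)]
    · simp only [integral_const_mul, Zq]
      ring
    · exact ((i _ _).const_mul _).add ((i _ _).const_mul _)
    · exact ((i _ _).const_mul _).add ((i _ _).const_mul _)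
  rw [e]
  apply norm_integral_le_of_norm_le
  · exact (((i _ _).const_mul _).add ((i _ _).const_mul _)).add (((i _ _).const_mul _).add ((i _ _).const_mul _))
  · refine ae_of_all _ fun z => ?_
    have hw : ‖(ε:ℂ)^2 / Dn u ε z ^ 2‖ = ε ^ 2 / (‖u z‖ ^ 2 + ε ^ 2) ^ 2 := by
      rw [Dn_eq, norm_div, norm_pow, norm_pow, Complex.norm_real, Complex.norm_real, Real.norm_of_nonneg hε.le,
        Real.norm_of_nonneg (Dn_pos hε u z).le]
    rw [norm_mul, norm_mul, hw]
    set w := ε ^ 2 / (‖u z‖ ^ 2 + ε ^ 2) ^ 2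
    have hw0 : 0 ≤ w := by positivity
    have hcθ : 0 ≤ c * θ z := (norm_nonneg _).trans (hc z)
    have h1 : ‖cj (WD (-Complex.I) k u z) * WD Complex.I j u z - cj (WD (-Complex.I) j u z) * WD Complex.I k u z‖
      ≤ ‖WD (-Complex.I) k u z‖ * ‖WD Complex.I j u z‖ + ‖WD (-Complex.I) j u z‖ * ‖WD Complex.I k u z‖ := by
      refine (norm_sub_le _ _).trans (le_of_eq ?_)
      rw [norm_mul, norm_mul, RCLike.norm_conj, RCLike.norm_conj]
    have h2 := amgm (a := ‖WD (-Complex.I) k u z‖) (b := ‖WD Complex.I j u z‖) ht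
    have h3 := amgm (a := ‖WD (-Complex.I) j u z‖) (b := ‖WD Complex.I k u z‖) ht
    calc ‖φ z‖ * (w * _) ≤ (c * θ z) * (w * ((t * ‖WD (-Complex.I) k u z‖ ^ 2 + ‖WD Complex.I j u z‖ ^ 2 / t) / 2 + (t * ‖WD (-Complex.I) j u z‖ ^ 2 + ‖WD Complex.I k u z‖ ^ 2 / t) / 2)) := by
          apply mul_le_mul (hc z) _ (by positivity) hcθ
          exact mul_le_mul_of_nonneg_left (h1.trans (add_le_add h2 h3)) hw0
      _ = _ := by ring

/-- abstract contradiction argument -/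
lemma seq_zero {L : ℕ → ℂ} {l : ℂ} (hL : Filter.Tendsto L Filter.atTop (nhds l)) {s : ℕ → ℝ} (hs0 : ∀ N, 0 ≤ s N) (hs : Summable s)
    {C : ℝ} (h : ∀ N : ℕ, ∀ t : ℝ, 0 < t → ‖L N‖ ≤ C * (t * (1 + N) + s N / t)) : l = 0 := by
  by_contra hl
  have hc : 0 < ‖l‖ := norm_pos_iff.2 hl
  set c := ‖l‖ / 2 with hcd
  have hc' : 0 < c := by positivity
  have hev : ∀ᶠ N in Filter.atTop, c < ‖L N‖ := hL.norm.eventually (lt_mem_nhds (by rw [hcd]; linarith))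
  have hC : 0 < C := by
    obtain ⟨N, hN⟩ := hev.exists
    have := hN.trans_le (h N 1 one_pos)
    by_contra hh
    have h2 : 0 ≤ 1 * (1 + (N:ℝ)) + s N / 1 := by have := hs0 N; positivity
    nlinarith
  have key : ∀ᶠ N : ℕ in Filter.atTop, c ^ 2 / (4 * C ^ 2) * (1 / ((N:ℝ) + 1)) ≤ s N := by
    filter_upwards [hev] with N hN
    have hp : (0:ℝ) < 1 + N := by positivity
    have := hN.trans_le (h N (c / (2 * C * (1 + N))) (by positivity))
    have e : C * (c / (2 * C * (1 + (N:ℝ))) * (1 + N) + s N / (c / (2 * C * (1 + N)))) = c / 2 + 2 * C ^ 2 * (1 + N) * s N / c := by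
      field_simp
    rw [e] at this
    have h3 : c / 2 < 2 * C ^ 2 * (1 + N) * s N / c := by linarith
    rw [lt_div_iff₀ hc'] at h3
    rw [div_mul_div_comm, mul_one, div_le_iff₀ (by positivity)]
    nlinarith
  have hsum : Summable (fun N : ℕ => c ^ 2 / (4 * C ^ 2) * (1 / ((N:ℝ) + 1))) := by
    apply summable_of_isBigO_nat hs
    refine Asymptotics.IsBigO.of_bound 1 ?_
    filter_upwards [key] with N hN
    rw [one_mul, Real.norm_of_nonneg (hs0 N), Real.norm_of_nonneg (by positivity)]; exact hN
  rw [summable_mul_left_iff (by positivity)] at hsum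
  have := (summable_nat_add_iff 1 (f := fun N : ℕ => 1 / (N:ℝ))).1 (by simpa using hsum)
  exact Real.not_summable_one_div_natCast this

end est
end

section

section lim
variable {n : ℕ} {p : ENNReal} {z0 : Fin n → ℂ} {R : ℝ} {F : (Fin n → ℂ) → ℂ} {A : Fin n → (Fin n → ℂ) → ℂ}

lemma LocData.bd (hd : LocData n p z0 R F A) : ∃ B : ℝ, 0 ≤ B ∧ ∀ z, ‖F z‖ ≤ B := by
  obtain ⟨B, hB⟩ := hd.comp.exists_bound_of_continuous hd.cont
  exact ⟨B, (norm_nonneg _).trans (hB 0), hB⟩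

lemma LocData.H_int (hd : LocData n p z0 R F A) (k : Fin n) : Integrable (fun z => A k z * F z) := by
  obtain ⟨B, _, hB⟩ := hd.bd
  exact (hd.int1 k).mul_bdd (c := B) hd.cont.aestronglyMeasurable (ae_of_all _ hB)

lemma LocData.H2_int (hd : LocData n p z0 R F A) (k : Fin n) : Integrable (fun z => ((‖A k z * F z‖ ^ 2 : ℝ) : ℂ)) := by
  obtain ⟨B, hB0, hB⟩ := hd.bd
  have h : Integrable (fun z => ‖A k z‖ ^ 2 * ‖F z‖ ^ 2) := by
    refine (hd.int2 k).mul_bdd (c := B ^ 2) (hd.cont.norm.pow 2).aestronglyMeasurable (ae_of_all _ fun z => ?_)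
    rw [Real.norm_of_nonneg (by positivity)]
    exact pow_le_pow_left₀ (norm_nonneg _) (hB z) 2
  have h2 := h.ofReal (𝕜 := ℂ)
  refine h2.congr (ae_of_all _ fun z => ?_)
  simp only [norm_mul, mul_pow]; rfl

lemma LocData.CCF (hd : LocData n p z0 R F A) (y : Fin n → ℂ) : CC (fun m => mol m F) F y :=
  mol_CC (CC_const hd.cont.continuousAt) (fun _ => hd.cont.aestronglyMeasurable)

lemma LocData.molS (hd : LocData n p z0 R F A) (m : ℕ) : ContDiff ℝ (⊤ : ℕ∞) (mol m F) :=
  mol_contDiff m hd.cont.locallyIntegrable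

lemma Tn_bound (u : (Fin n → ℂ) → ℂ) {ε : ℝ} (hε : 0 < ε) (z : Fin n → ℂ) : ‖Tn u ε z‖ ≤ 1 / ε := by
  rw [Tn, Dn_eq, norm_div, RCLike.norm_conj, Complex.norm_real, Real.norm_of_nonneg (Dn_pos hε u z).le,
    div_le_div_iff₀ (Dn_pos hε u z) hε]
  nlinarith [sq_nonneg (‖u z‖ - ε), sq_nonneg (‖u z‖), norm_nonneg (u z)]

lemma CC_Tn {w : ℕ → (Fin n → ℂ) → ℂ} {w' : (Fin n → ℂ) → ℂ} {y : Fin n → ℂ} {ε : ℝ} (hε : 0 < ε) (h : CC w w' y) :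
    CC (fun m => Tn (w m) ε) (Tn w' ε) y := by
  have h1 : Filter.Tendsto (fun p : ℕ × (Fin n → ℂ) => cj (w p.1 p.2)) (Filter.atTop ×ˢ nhds y) (nhds (cj (w' y))) :=
    (Complex.continuous_conj.tendsto _).comp h
  exact h1.div ((Filter.Tendsto.mul h h1).add tendsto_const_nhds) (Dn_ne hε w' y)

lemma CC_Dn {w : ℕ → (Fin n → ℂ) → ℂ} {w' : (Fin n → ℂ) → ℂ} {y : Fin n → ℂ} {ε : ℝ} (hε : 0 < ε) (h : CC w w' y) :
    CC (fun m z => (ε:ℂ)^2 / Dn (w m) ε z ^ 2) (fun z => (ε:ℂ)^2 / Dn w' ε z ^ 2) y := by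
  have h1 : Filter.Tendsto (fun p : ℕ × (Fin n → ℂ) => cj (w p.1 p.2)) (Filter.atTop ×ˢ nhds y) (nhds (cj (w' y))) :=
    (Complex.continuous_conj.tendsto _).comp h
  exact tendsto_const_nhds.div (((Filter.Tendsto.mul h h1).add tendsto_const_nhds).pow 2) (pow_ne_zero 2 (Dn_ne hε w' y))

lemma LocData.WDm (hd : LocData n p z0 R F A) {r : ℝ} (hr : r < R) :
    ∀ᶠ m : ℕ in Filter.atTop, ∀ z ∈ ball z0 r, ∀ k, WD Complex.I k (mol m F) z = mol m (fun z => A k z * F z) z := by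
  have h0 : Filter.Tendsto (fun m : ℕ => 1 / ((m:ℝ) + 1)) Filter.atTop (nhds 0) := tendsto_one_div_add_atTop_nhds_zero_nat
  filter_upwards [h0.eventually (gt_mem_nhds (sub_pos.2 hr))] with m hm z hz k
  refine mol_WD m k z0 R hd.cont.locallyIntegrable (hd.weak k) z (ball_subset_ball (by linarith) hz)

lemma LocData.lim1 (hd : LocData n p z0 R F A) {r : ℝ} (hr : r < R) {χ : (Fin n → ℂ) → ℂ} (hχ : Tst (ball z0 r) χ) {ε : ℝ} (hε : 0 < ε)
    (k : Fin n) : Filter.Tendsto (fun m => ∫ z, Tn (mol m F) ε z * WD Complex.I k (mol m F) z * χ z) Filter.atTop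
      (nhds (∫ z, Tn F ε z * (A k z * F z) * χ z)) := by
  obtain ⟨C, hC⟩ := hχ.bdd
  have h := dual_limit (ψ := fun m z => χ z * Tn (mol m F) ε z) (ψ' := fun z => χ z * Tn F ε z) (hd.H_int k)
    (fun m => by
      have := hχ.mul_right (Tn_contDiff (hd.molS m) hε)
      exact this.1.continuous.integrable_of_hasCompactSupport this.2.1)
    (C := C * (1 / ε)) (fun m z => by
      rw [norm_mul]
      exact mul_le_mul (hC z) (Tn_bound _ hε z) (norm_nonneg _) ((norm_nonneg _).trans (hC z)))
    (fun y => CC_cut (V := univ) hχ.1.continuous (subset_univ _) (fun y _ => CC_Tn hε (hd.CCF y)) y)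
  have e : ∫ z, Tn F ε z * (A k z * F z) * χ z = ∫ z, χ z * Tn F ε z * (A k z * F z) := by congr 1; ext z; ring
  rw [e]
  refine h.congr' ?_
  filter_upwards [hd.WDm hr] with m hm
  congr 1; ext z
  by_cases hz : z ∈ ball z0 r
  · rw [hm z hz]; ring
  · rw [hχ.zero hz]; ring

/-- limit energy -/
def SS (F : (Fin n → ℂ) → ℂ) (A : (Fin n → ℂ) → ℂ) (θ : (Fin n → ℂ) → ℝ) (ε : ℝ) : ℝ :=
  ∫ z, θ z * (ε ^ 2 / (‖F z‖ ^ 2 + ε ^ 2) ^ 2 * ‖A z * F z‖ ^ 2)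

lemma LocData.lim2 (hd : LocData n p z0 R F A) {r : ℝ} (hr : r < R) {θ : (Fin n → ℂ) → ℝ} (hθ : Tst (ball z0 r) (fun z => (θ z : ℂ)))
    (hθ0 : ∀ z, 0 ≤ θ z) {ε : ℝ} (hε : 0 < ε) (k : Fin n) : ∃ Y : ℕ → ℝ, Filter.Tendsto Y Filter.atTop (nhds (SS F (A k) θ ε)) ∧
      ∀ᶠ m in Filter.atTop, Zq (mol m F) ε θ Complex.I k ≤ Y m := by
  obtain ⟨C, hC⟩ := hθ.bdd
  set H2 : (Fin n → ℂ) → ℂ := fun z => ((‖A k z * F z‖ ^ 2 : ℝ) : ℂ) with hH2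
  have hcd : ∀ m, ContDiff ℝ (⊤ : ℕ∞) (fun z => (ε:ℂ)^2 / Dn (mol m F) ε z ^ 2) := by
    intro m
    have := (contDiff_const (c := (ε:ℂ)^2)).mul (((Dn_contDiff (hd.molS m) ε).inv (Dn_ne hε _)).pow 2)
    simpa only [div_eq_mul_inv, inv_pow, Pi.inv_apply] using this
  have hn : ∀ (u : (Fin n → ℂ) → ℂ) z, ‖(ε:ℂ)^2 / Dn u ε z ^ 2‖ ≤ 1 / ε ^ 2 := by
    intro u z
    rw [Dn_eq, norm_div, norm_pow, norm_pow, Complex.norm_real, Complex.norm_real, Real.norm_of_nonneg hε.le,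
        Real.norm_of_nonneg (Dn_pos hε u z).le, div_le_div_iff₀ (pow_pos (Dn_pos hε u z) 2) (by positivity)]
    nlinarith [sq_nonneg (‖u z‖ ^ 2), mul_nonneg (sq_nonneg ‖u z‖) (sq_nonneg ε)]
  have hT : ∀ m, Tst (ball z0 r) (fun z => (θ z : ℂ) * ((ε:ℂ)^2 / Dn (mol m F) ε z ^ 2)) := fun m => hθ.mul_right (hcd m)
  have h := dual_limit (ψ := fun m z => (θ z : ℂ) * ((ε:ℂ)^2 / Dn (mol m F) ε z ^ 2)) (ψ' := fun z => (θ z : ℂ) * ((ε:ℂ)^2 / Dn F ε z ^ 2)) (hd.H2_int k)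
    (fun m => (hT m).1.continuous.integrable_of_hasCompactSupport (hT m).2.1)
    (C := C * (1 / ε ^ 2)) (fun m z => by
      rw [norm_mul]
      exact mul_le_mul (hC z) (hn _ z) (norm_nonneg _) ((norm_nonneg _).trans (hC z)))
    (fun y => CC_cut (φ := fun z => (θ z : ℂ)) (V := univ) hθ.1.continuous (subset_univ _) (fun y _ => CC_Dn hε (hd.CCF y)) y)
  have h2 := (Complex.continuous_re.tendsto _).comp h
  have e : (∫ z, (θ z : ℂ) * ((ε:ℂ)^2 / Dn F ε z ^ 2) * ((‖A k z * F z‖ ^ 2 : ℝ) : ℂ)).re = SS F (A k) θ ε := by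
    rw [← Complex.ofReal_re (SS F (A k) θ ε), SS, ← integral_complex_ofReal]
    congr 2; ext z; rw [Dn_eq]; push_cast; ring
  rw [e] at h2
  refine ⟨_, h2, ?_⟩
  filter_upwards [hd.WDm hr] with m hm
  have hi : Integrable (fun z => (θ z : ℂ) * ((ε:ℂ)^2 / Dn (mol m F) ε z ^ 2) * mol m H2 z) := by
    have := (hT m).integrable_mul (mol_integrable m (hd.H2_int k))
    refine this.congr (ae_of_all _ fun z => ?_)
    simp only []; ring
  simp only [Function.comp]
  have e2 : (∫ z, (θ z : ℂ) * ((ε:ℂ)^2 / Dn (mol m F) ε z ^ 2) * mol m H2 z).re = ∫ z, ((θ z : ℂ) * ((ε:ℂ)^2 / Dn (mol m F) ε z ^ 2) * mol m H2 z).re :=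
    (integral_re hi).symm
  rw [e2]
  apply integral_mono (Zq_integrable (hd.molS m) hε hθ _ _) hi.re
  intro z
  simp only []
  have e3 : (θ z : ℂ) * ((ε:ℂ)^2 / Dn (mol m F) ε z ^ 2) * mol m H2 z = ((θ z * (ε ^ 2 / (‖mol m F z‖ ^ 2 + ε ^ 2) ^ 2) : ℝ) : ℂ) * mol m H2 z := by
    rw [Dn_eq]; push_cast; ring
  have e4 : RCLike.re ((θ z : ℂ) * ((ε:ℂ)^2 / Dn (mol m F) ε z ^ 2) * mol m H2 z) = θ z * (ε ^ 2 / (‖mol m F z‖ ^ 2 + ε ^ 2) ^ 2) * (mol m H2 z).re := by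
    rw [e3]; exact Complex.re_ofReal_mul _ _
  rw [e4, ← mul_assoc]
  by_cases hz : z ∈ ball z0 r
  · rw [hm z hz]
    refine mul_le_mul_of_nonneg_left (mol_sq m (hd.H_int k).locallyIntegrable (hd.H2_int k).locallyIntegrable z) ?_
    have := hθ0 z; positivity
  · have : θ z = 0 := by exact_mod_cast hθ.zero hz
    rw [this]; simp

lemma LocData.est (hd : LocData n p z0 R F A) {r : ℝ} (hr : r < R) {θ : (Fin n → ℂ) → ℝ} (hθ : Tst (ball z0 r) (fun z => (θ z : ℂ)))
    (hθ0 : ∀ z, 0 ≤ θ z) {φ : (Fin n → ℂ) → ℂ} (hφ : Tst (ball z0 r) φ)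
    {c : ℝ} (hc0 : 0 ≤ c) (hc : ∀ z, ‖φ z‖ ≤ c * θ z) (j k : Fin n) {t : ℝ} (ht : 0 < t) {ε : ℝ} (hε : 0 < ε)
    {Λ : ℝ} (hΛ : ∀ m z, ‖Complex.log (Dn (mol m F) ε z)‖ ≤ Λ) :
    ‖(∫ z, Tn F ε z * (A j z * F z) * WD Complex.I k φ z) - ∫ z, Tn F ε z * (A k z * F z) * WD Complex.I j φ z‖
    ≤ c / 2 * (t * ((SS F (A k) θ ε
      + Λ * (∫ z, ‖WD (-Complex.I) k (WD Complex.I k (fun z => (θ z : ℂ))) z‖)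
      + 2 * ‖∫ z, Tn F ε z * (A k z * F z) * WD (-Complex.I) k (fun z => (θ z : ℂ)) z‖) + (SS F (A j) θ ε
      + Λ * (∫ z, ‖WD (-Complex.I) j (WD Complex.I j (fun z => (θ z : ℂ))) z‖)
      + 2 * ‖∫ z, Tn F ε z * (A j z * F z) * WD (-Complex.I) j (fun z => (θ z : ℂ)) z‖)) + (SS F (A j) θ ε + SS F (A k) θ ε) / t) := by
  obtain ⟨Yk, hYk, hYk'⟩ := hd.lim2 hr hθ hθ0 hε k
  obtain ⟨Yj, hYj, hYj'⟩ := hd.lim2 hr hθ hθ0 hε j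
  have l1 := ((hd.lim1 hr (hφ.WD Complex.I k) hε j).sub (hd.lim1 hr (hφ.WD Complex.I j) hε k)).norm
  have lk := (hd.lim1 hr (hθ.WD (-Complex.I) k) hε k).norm
  have lj := (hd.lim1 hr (hθ.WD (-Complex.I) j) hε j).norm
  refine le_of_tendsto_of_tendsto l1 ((((((hYk.add tendsto_const_nhds).add (lk.const_mul 2)).add ((hYj.add tendsto_const_nhds).add (lj.const_mul 2))).const_mul t).add ((hYj.add hYk).div_const t)).const_mul (c / 2)) ?_
  filter_upwards [hYk', hYj'] with m hk hj
  refine (sm_est1 (hd.molS m) hε hθ hφ hc j k ht).trans ?_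
  have ek := sm_est2 (hd.molS m) hε hθ k (hΛ m)
  have ej := sm_est2 (hd.molS m) hε hθ j (hΛ m)
  gcongr
  · linarith
  · linarith

end lim
end

section

section closed
variable {n : ℕ} {p : ENNReal} {z0 : Fin n → ℂ} {R : ℝ} {F : (Fin n → ℂ) → ℂ} {A : Fin n → (Fin n → ℂ) → ℂ}

lemma Tn_mul (F : (Fin n → ℂ) → ℂ) (ε : ℝ) (z : Fin n → ℂ) : Tn F ε z * F z = ((‖F z‖ ^ 2 / (‖F z‖ ^ 2 + ε ^ 2) : ℝ) : ℂ) := by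
  have : F z * cj (F z) = ((‖F z‖ ^ 2 : ℝ) : ℂ) := by rw [Complex.mul_conj, Complex.normSq_eq_norm_sq]
  rw [Tn, Dn_eq, div_mul_eq_mul_div, mul_comm, this]; push_cast; rfl

lemma Tn_mul_norm (F : (Fin n → ℂ) → ℂ) {ε : ℝ} (hε : 0 < ε) (z : Fin n → ℂ) : ‖Tn F ε z * F z‖ ≤ 1 := by
  have h := Dn_pos hε F z
  rw [Tn_mul, Complex.norm_real, Real.norm_of_nonneg (by positivity), div_le_one h]
  nlinarith [sq_nonneg ε]

lemma LocData.pt (hd : LocData n p z0 R F A) {V : Set (Fin n → ℂ)} {χ : (Fin n → ℂ) → ℂ} {C : ℝ} (hC : ∀ z, ‖χ z‖ ≤ C) {ε : ℝ} (hε : 0 < ε)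
    (k : Fin n) (z : Fin n → ℂ) : ‖Tn F ε z * (A k z * F z) * χ z‖ ≤ C * ‖A k z‖ := by
  have e : Tn F ε z * (A k z * F z) * χ z = (Tn F ε z * F z) * (A k z * χ z) := by ring
  rw [e, norm_mul (Tn F ε z * F z), norm_mul (A k z)]
  have h1 := Tn_mul_norm F hε z
  have h2 := hC z
  calc _ ≤ 1 * (‖A k z‖ * C) := by gcongr
    _ = _ := by ring

lemma Tn_continuous (hF : Continuous F) {ε : ℝ} (hε : 0 < ε) : Continuous (Tn F ε) := by
  unfold Tn Dn
  exact (Complex.continuous_conj.comp hF).div ((hF.mul (Complex.continuous_conj.comp hF)).add continuous_const) (Dn_ne hε F)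

lemma LocData.Ebd (hd : LocData n p z0 R F A) {V : Set (Fin n → ℂ)} {χ : (Fin n → ℂ) → ℂ} (hχ : Tst V χ) (k : Fin n) :
    ∃ K : ℝ, 0 ≤ K ∧ ∀ ε : ℝ, 0 < ε → ‖∫ z, Tn F ε z * (A k z * F z) * χ z‖ ≤ K := by
  obtain ⟨C, hC⟩ := hχ.bdd
  have hC0 : 0 ≤ C := (norm_nonneg _).trans (hC 0)
  refine ⟨∫ z, C * ‖A k z‖, integral_nonneg fun z => by positivity, fun ε hε => ?_⟩
  exact norm_integral_le_of_norm_le ((hd.int1 k).norm.const_mul C) (ae_of_all _ (hd.pt (V := V) hC hε k))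

lemma LocData.lim3 (hd : LocData n p z0 R F A) {V : Set (Fin n → ℂ)} {χ : (Fin n → ℂ) → ℂ} (hχ : Tst V χ) (k : Fin n)
    {e : ℕ → ℝ} (he : ∀ N, 0 < e N) (he0 : Filter.Tendsto e Filter.atTop (nhds 0)) :
    Filter.Tendsto (fun N => ∫ z, Tn F (e N) z * (A k z * F z) * χ z) Filter.atTop (nhds (∫ z, A k z * χ z)) := by
  obtain ⟨C, hC⟩ := hχ.bdd
  apply tendsto_integral_of_dominated_convergence (fun z => C * ‖A k z‖)
  · intro N
    exact (((Tn_continuous hd.cont (he N)).measurable.mul ((hd.meas k).mul hd.cont.measurable)).mul hχ.1.continuous.measurable).aestronglyMeasurable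
  · exact (hd.int1 k).norm.const_mul C
  · intro N; exact ae_of_all _ (hd.pt (V := V) hC (he N) k)
  · refine ae_of_all _ fun z => ?_
    by_cases hz : F z = 0
    · simp [hd.zer k z hz]
    · have e1 : ∀ N, Tn F (e N) z * (A k z * F z) * χ z = ((‖F z‖ ^ 2 / (‖F z‖ ^ 2 + e N ^ 2) : ℝ) : ℂ) * (A k z * χ z) := by
        intro N; rw [← Tn_mul]; ring
      simp_rw [e1]
      have hp : 0 < ‖F z‖ := norm_pos_iff.2 hz
      have h2 : Filter.Tendsto (fun N => ‖F z‖ ^ 2 / (‖F z‖ ^ 2 + e N ^ 2)) Filter.atTop (nhds (‖F z‖ ^ 2 / (‖F z‖ ^ 2 + 0 ^ 2))) :=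
        tendsto_const_nhds.div (tendsto_const_nhds.add (he0.pow 2)) (by positivity)
      have h3 : ‖F z‖ ^ 2 / (‖F z‖ ^ 2 + 0 ^ 2) = 1 := by
        rw [zero_pow two_ne_zero, add_zero, div_self (by positivity)]
      rw [h3] at h2
      have h4 := ((Complex.continuous_ofReal.tendsto _).comp h2).mul_const (A k z * χ z)
      simpa using h4

lemma tele_pt {a e : ℝ} (ha : 0 ≤ a) (he : 0 < e) : e * a / (a + e) ^ 2 ≤ 4 / 3 * (a / (a + e / 4) - a / (a + e)) := by
  have h : 4 / 3 * (a / (a + e / 4) - a / (a + e)) = e * a / ((a + e / 4) * (a + e)) := by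
    field_simp; ring
  rw [h, sq]
  apply div_le_div_of_nonneg_left (by positivity) (by positivity)
  apply mul_le_mul_of_nonneg_right _ (by positivity)
  linarith

lemma tele_sum {a : ℝ} (ha : 0 ≤ a) (M : ℕ) :
    ∑ N ∈ Finset.range M, (((1/2:ℝ) ^ N) ^ 2 * a / (a + ((1/2:ℝ) ^ N) ^ 2) ^ 2) ≤ 4 / 3 := by
  set g : ℕ → ℝ := fun N => a / (a + ((1/2:ℝ) ^ N) ^ 2) with hg
  have h1 : ∑ N ∈ Finset.range M, (((1/2:ℝ) ^ N) ^ 2 * a / (a + ((1/2:ℝ) ^ N) ^ 2) ^ 2) ≤ ∑ N ∈ Finset.range M, 4 / 3 * (g (N+1) - g N) := by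
    apply Finset.sum_le_sum
    intro N _
    have := tele_pt ha (e := ((1/2:ℝ) ^ N) ^ 2) (by positivity)
    have e : ((1/2:ℝ) ^ (N+1)) ^ 2 = ((1/2:ℝ) ^ N) ^ 2 / 4 := by rw [pow_succ]; ring
    simp only [hg, e]; exact this
  rw [← Finset.mul_sum, Finset.sum_range_sub] at h1
  have h2 : g M ≤ 1 := by
    simp only [hg]
    have : (0:ℝ) < ((1/2:ℝ) ^ M) ^ 2 := by positivity
    rw [div_le_one (by positivity)]; linarith
  have h3 : 0 ≤ g 0 := by simp only [hg]; positivity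
  linarith

lemma LocData.SS_int (hd : LocData n p z0 R F A) {V : Set (Fin n → ℂ)} {θ : (Fin n → ℂ) → ℝ} (hθ : Tst V (fun z => (θ z : ℂ))) (k : Fin n) {ε : ℝ} (hε : 0 < ε) :
    Integrable (fun z => θ z * (ε ^ 2 / (‖F z‖ ^ 2 + ε ^ 2) ^ 2 * ‖A k z * F z‖ ^ 2)) := by
  obtain ⟨C, hC⟩ := hθ.bdd
  have hθc : Continuous θ := Complex.continuous_re.comp hθ.1.continuous
  have hF := hd.cont
  have hw : Continuous (fun z => θ z * (ε ^ 2 * ‖F z‖ ^ 2 / (‖F z‖ ^ 2 + ε ^ 2) ^ 2)) :=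
    hθc.mul ((by fun_prop : Continuous (fun z => ε ^ 2 * ‖F z‖ ^ 2)).div (by fun_prop) (fun z => by have := Dn_pos hε F z; positivity))
  have := (hd.int2 k).bdd_mul (c := C) (f := fun z => θ z * (ε ^ 2 * ‖F z‖ ^ 2 / (‖F z‖ ^ 2 + ε ^ 2) ^ 2)) hw.aestronglyMeasurable
    (ae_of_all _ fun z => by
      have hD := Dn_pos hε F z
      have h2 : ε ^ 2 * ‖F z‖ ^ 2 / (‖F z‖ ^ 2 + ε ^ 2) ^ 2 ≤ 1 := by
        rw [div_le_one (by positivity)]; nlinarith [sq_nonneg (ε ^ 2), sq_nonneg (‖F z‖ ^ 2), mul_nonneg (sq_nonneg ε) (sq_nonneg ‖F z‖)]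
      rw [norm_mul, Real.norm_of_nonneg (r := ε ^ 2 * ‖F z‖ ^ 2 / (‖F z‖ ^ 2 + ε ^ 2) ^ 2) (by positivity)]
      have h3 := hC z
      rw [Complex.norm_real] at h3
      calc _ ≤ ‖θ z‖ * 1 := by gcongr
        _ ≤ C := by rw [mul_one]; exact h3)
  refine this.congr (ae_of_all _ fun z => ?_)
  simp only [norm_mul, mul_pow]; ring

lemma LocData.SS_sum (hd : LocData n p z0 R F A) {V : Set (Fin n → ℂ)} {θ : (Fin n → ℂ) → ℝ} (hθ : Tst V (fun z => (θ z : ℂ)))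
    (hθ0 : ∀ z, 0 ≤ θ z) (k : Fin n) : Summable (fun N : ℕ => SS F (A k) θ ((1/2) ^ N)) := by
  have hi : Integrable (fun z => 4 / 3 * (θ z * ‖A k z‖ ^ 2)) := by
    obtain ⟨C, hC⟩ := hθ.bdd
    have hθc : Continuous θ := Complex.continuous_re.comp hθ.1.continuous
    refine Integrable.const_mul ((hd.int2 k).bdd_mul (c := C) hθc.aestronglyMeasurable (ae_of_all _ fun z => ?_)) _
    have h3 := hC z
    rwa [Complex.norm_real] at h3
  refine summable_of_sum_range_le (c := ∫ z, 4 / 3 * (θ z * ‖A k z‖ ^ 2)) ?_ ?_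
  · intro N
    exact integral_nonneg fun z => by have := hθ0 z; positivity
  · intro M
    unfold SS
    rw [← integral_finsetSum _ (fun N _ => hd.SS_int hθ k (by positivity))]
    apply integral_mono (integrable_finsetSum _ (fun N _ => hd.SS_int hθ k (by positivity))) hi
    intro z
    have h := tele_sum (sq_nonneg ‖F z‖) M
    have h0 : 0 ≤ θ z * ‖A k z‖ ^ 2 := by have := hθ0 z; positivity
    calc _ = (θ z * ‖A k z‖ ^ 2) * ∑ N ∈ Finset.range M, (((1/2:ℝ) ^ N) ^ 2 * ‖F z‖ ^ 2 / (‖F z‖ ^ 2 + ((1/2:ℝ) ^ N) ^ 2) ^ 2) := by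
          rw [Finset.mul_sum]; apply Finset.sum_congr rfl; intro N _; simp only [norm_mul, mul_pow]; ring
      _ ≤ (θ z * ‖A k z‖ ^ 2) * (4 / 3) := mul_le_mul_of_nonneg_left h h0
      _ = _ := by ring

lemma log_bound {u : (Fin n → ℂ) → ℂ} {B : ℝ} (hB : ∀ z, ‖u z‖ ≤ B) (N : ℕ) (z : Fin n → ℂ) :
    ‖Complex.log (Dn u ((1/2) ^ N) z)‖ ≤ (B ^ 2 + 2) * (1 + N) := by
  have hε : (0:ℝ) < (1/2) ^ N := by positivity
  have hD := Dn_pos hε u z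
  rw [Dn_eq, ← Complex.ofReal_log hD.le, Complex.norm_real, Real.norm_eq_abs, abs_le]
  have h1 : Real.log (‖u z‖ ^ 2 + ((1/2:ℝ) ^ N) ^ 2) ≤ B ^ 2 := by
    refine (Real.log_le_sub_one_of_pos hD).trans ?_
    have h2 : ((1/2:ℝ) ^ N) ^ 2 ≤ 1 := pow_le_one₀ hε.le (pow_le_one₀ (by norm_num) (by norm_num))
    have h3 : ‖u z‖ ^ 2 ≤ B ^ 2 := pow_le_pow_left₀ (norm_nonneg _) (hB z) 2
    linarith
  have h2 : -(2 * N : ℝ) ≤ Real.log (‖u z‖ ^ 2 + ((1/2:ℝ) ^ N) ^ 2) := by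
    have : Real.log (((1/2:ℝ) ^ N) ^ 2) ≤ Real.log (‖u z‖ ^ 2 + ((1/2:ℝ) ^ N) ^ 2) :=
      Real.log_le_log (by positivity) (by nlinarith [sq_nonneg ‖u z‖])
    refine le_trans ?_ this
    rw [Real.log_pow, Real.log_pow, one_div, Real.log_inv]
    have := Real.log_two_lt_d9
    have hN : (0:ℝ) ≤ N := Nat.cast_nonneg N
    push_cast
    nlinarith
  have hN : (0:ℝ) ≤ N := Nat.cast_nonneg N
  constructor <;> nlinarith [sq_nonneg B, mul_nonneg (sq_nonneg B) hN]

theorem LocData.closed (hd : LocData n p z0 R F A) {r : ℝ} (hr0 : 0 < r) (hr : r < R) : WClosed (ball z0 r) A := by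
  intro j k φ hφ
  obtain ⟨B, hB0, hB⟩ := hd.bd
  let g : ContDiffBump z0 := ⟨r, (r + (r + R) / 2) / 2, hr0, by linarith⟩
  set θ : (Fin n → ℂ) → ℝ := fun z => g z with hθd
  have hr' : (r + R) / 2 < R := by linarith
  have hθ : Tst (ball z0 ((r + R) / 2)) (fun z => (θ z : ℂ)) := by
    refine ⟨Complex.ofRealCLM.contDiff.comp g.contDiff, g.hasCompactSupport.comp_left (g := fun x : ℝ => (x : ℂ)) (by simp), ?_⟩
    refine (tsupport_comp_subset (g := fun x : ℝ => (x : ℂ)) (by simp) g).trans ?_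
    rw [g.tsupport_eq]
    exact closedBall_subset_ball (by change (r + (r + R) / 2) / 2 < _; linarith)
  have hθ0 : ∀ z, 0 ≤ θ z := fun z => g.nonneg
  have hφ' : Tst (ball z0 ((r + R) / 2)) φ := hφ.mono (ball_subset_ball (by linarith))
  obtain ⟨c, hc⟩ := hφ.bdd
  have hc0 : 0 ≤ c := (norm_nonneg _).trans (hc 0)
  have hc' : ∀ z, ‖φ z‖ ≤ c * θ z := by
    intro z
    by_cases hz : z ∈ ball z0 r
    · have : θ z = 1 := g.one_of_mem_closedBall (ball_subset_closedBall hz)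
      rw [this, mul_one]; exact hc z
    · rw [hφ.zero hz, norm_zero]; exact mul_nonneg hc0 (hθ0 z)
  set e : ℕ → ℝ := fun N => (1/2) ^ N with he
  have hep : ∀ N, 0 < e N := fun N => by simp only [he]; positivity
  have he0 : Filter.Tendsto e Filter.atTop (nhds 0) := tendsto_pow_atTop_nhds_zero_of_lt_one (by norm_num) (by norm_num)
  have hlim := (hd.lim3 (hφ.WD Complex.I k) j hep he0).sub (hd.lim3 (hφ.WD Complex.I j) k hep he0)
  obtain ⟨Kk, hKk0, hKk⟩ := hd.Ebd (hθ.WD (-Complex.I) k) k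
  obtain ⟨Kj, hKj0, hKj⟩ := hd.Ebd (hθ.WD (-Complex.I) j) j
  have ss : ∀ k, ∀ N, 0 ≤ SS F (A k) θ (e N) := fun k N => integral_nonneg fun z => by have := hθ0 z; positivity
  have sk := hd.SS_sum hθ hθ0 k
  have sj := hd.SS_sum hθ hθ0 j
  have bk : ∀ N, SS F (A k) θ (e N) ≤ ∑' N, SS F (A k) θ (e N) := fun N => sk.le_tsum N (fun i _ => ss k i)
  have bj : ∀ N, SS F (A j) θ (e N) ≤ ∑' N, SS F (A j) θ (e N) := fun N => sj.le_tsum N (fun i _ => ss j i)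
  set Sgk := ∑' N, SS F (A k) θ (e N)
  set Sgj := ∑' N, SS F (A j) θ (e N)
  have hSgk : 0 ≤ Sgk := (ss k 0).trans (bk 0)
  have hSgj : 0 ≤ Sgj := (ss j 0).trans (bj 0)
  set Jk := ∫ z, ‖WD (-Complex.I) k (WD Complex.I k (fun z => (θ z : ℂ))) z‖
  set Jj := ∫ z, ‖WD (-Complex.I) j (WD Complex.I j (fun z => (θ z : ℂ))) z‖
  have hJk : 0 ≤ Jk := integral_nonneg fun z => norm_nonneg _
  have hJj : 0 ≤ Jj := integral_nonneg fun z => norm_nonneg _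
  set C1 := Sgk + Sgj + (B ^ 2 + 2) * (Jk + Jj) + 2 * (Kk + Kj) with hC1
  have hC1p : 0 ≤ C1 := by positivity
  refine sub_eq_zero.1 (seq_zero hlim (s := fun N => SS F (A j) θ (e N) + SS F (A k) θ (e N)) (fun N => add_nonneg (ss j N) (ss k N)) (sj.add sk)
    (C := c / 2 * (C1 + 1)) ?_)
  intro N t ht
  have hest := hd.est hr' hθ hθ0 hφ' hc0 hc' j k ht (hep N) (Λ := (B ^ 2 + 2) * (1 + N)) (fun m z => log_bound (mol_bound m hB) N z)
  refine hest.trans ?_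
  have hk := hKk (e N) (hep N)
  have hj := hKj (e N) (hep N)
  have hbk := bk N
  have hbj := bj N
  rw [mul_assoc (c/2)]
  refine mul_le_mul_of_nonneg_left ?_ (by positivity)
  have hN : (1:ℝ) ≤ 1 + N := by have : (0:ℝ) ≤ N := Nat.cast_nonneg N; linarith
  have hs : 0 ≤ (SS F (A j) θ (e N) + SS F (A k) θ (e N)) / t := div_nonneg (add_nonneg (ss j N) (ss k N)) ht.le
  have hmain : (SS F (A k) θ (e N) + (B ^ 2 + 2) * (1 + (N:ℝ)) * Jk + 2 * Kk) + (SS F (A j) θ (e N) + (B ^ 2 + 2) * (1 + (N:ℝ)) * Jj + 2 * Kj) ≤ C1 * (1 + N) := by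
    have : C1 * (1 + N) = (Sgk + Sgj + 2 * (Kk + Kj)) * (1 + N) + (B ^ 2 + 2) * (1 + (N:ℝ)) * Jk + (B ^ 2 + 2) * (1 + (N:ℝ)) * Jj := by rw [hC1]; ring
    rw [this]
    have h5 : (Sgk + Sgj + 2 * (Kk + Kj)) ≤ (Sgk + Sgj + 2 * (Kk + Kj)) * (1 + N) := le_mul_of_one_le_right (by positivity) hN
    linarith
  calc _ ≤ t * (C1 * (1 + N)) + (SS F (A j) θ (e N) + SS F (A k) θ (e N)) / t := by
        gcongr
        refine le_trans ?_ hmain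
        gcongr
    _ ≤ (C1 + 1) * (t * (1 + N) + (SS F (A j) θ (e N) + SS F (A k) θ (e N)) / t) := by
        have : 0 ≤ t * (1 + (N:ℝ)) := by positivity
        nlinarith [mul_nonneg hC1p hs]

end closed
end

section

lemma cont_of_holder {n : ℕ} {v : (Fin n → ℂ) → ℂ} {U : Set (Fin n → ℂ)} {C β : ℝ} (hβ : 0 < β)
    (h : ∀ a ∈ U, ∀ b ∈ U, ‖v a - v b‖ ≤ C * dist a b ^ β) : ContinuousOn v U := by
  intro x hx
  have h1 : Filter.Tendsto (fun y => C * dist y x ^ β) (nhdsWithin x U) (nhds 0) := by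
    have : Continuous (fun y : Fin n → ℂ => C * dist y x ^ β) :=
      continuous_const.mul ((continuous_id.dist continuous_const).rpow_const (fun _ => Or.inr hβ.le))
    have h2 := this.tendsto x
    rw [dist_self, Real.zero_rpow hβ.ne', mul_zero] at h2
    exact h2.mono_left nhdsWithin_le_nhds
  rw [ContinuousWithinAt, tendsto_iff_norm_sub_tendsto_zero]
  refine squeeze_zero' (Filter.Eventually.of_forall fun _ => norm_nonneg _) ?_ h1
  filter_upwards [self_mem_nhdsWithin] with y hy
  exact h y hy x hx

theorem local_part (n : ℕ) (p : ENNReal) (hp : 2 < p)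
    (Ω : Set (Fin n → ℂ)) (hΩ : IsOpen Ω)
    (f : (Fin n → ℂ) → ℂ) (hf : ContinuousOn f Ω)
    (M : ℝ) (hL : ∀ j : Fin n, ∀ c : Fin n → ℂ, CondL n Ω f p M j c) :
    ∀ z ∈ Ω, ∃ U : Set (Fin n → ℂ), IsOpen U ∧ z ∈ U ∧ U ⊆ Ω ∧
      ∃ u : (Fin n → ℂ) → ℂ,
        ((p ≠ ⊤ → HolderLocOn (1 - 2 / p.toReal) u U) ∧
         (p = ⊤ → ∀ α : ℝ, 0 < α → α < 1 → HolderLocOn α u U)) ∧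
        DifferentiableOn ℂ (fun w => Complex.exp (-u w) * f w) U := by
  intro z0 hz0
  obtain ⟨R, hR, hRΩ, F, A, hFf, hd⟩ := loc_data n p hp Ω hΩ f hf M hL z0 hz0
  have hcl := hd.closed (r := 3 * R / 4) (by linarith) (by linarith)
  obtain ⟨u, hu, ⟨C, hC⟩, hw⟩ := weak_dolbeault z0 Finset.univ (R / 2) (3 * R / 4) (by linarith) (by linarith) A
    (fun j => ⟨hd.meas j, hd.int1 j, hd.p1 j⟩) (fun j hj => absurd (Finset.mem_univ j) hj) hcl
  have hpr : p ≠ ⊤ → 2 < p.toReal := by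
    intro h
    have := (ENNReal.toReal_lt_toReal (by simp) h).2 hp
    simpa using this
  obtain ⟨q0, hq0, hq0p⟩ : ∃ q : ℝ, 2 < q ∧ ENNReal.ofReal q ≤ p := by
    by_cases h : p = ⊤
    · exact ⟨3, by norm_num, by rw [h]; exact le_top⟩
    · exact ⟨p.toReal, hpr h, by rw [ENNReal.ofReal_toReal h]⟩
  obtain ⟨v, hv, hvH⟩ := holder_reg z0 (r := R / 4) (R := R / 2) (by linarith) (by linarith) hu hC hd.meas hw ⟨q0, hq0, hd.pot q0 hq0 hq0p⟩
  have hvH' : ∀ q : ℝ, 2 < q → ENNReal.ofReal q ≤ p → HolderLocOn (1 - 2 / q) v (ball z0 (R / 4)) := by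
    intro q hq hqp x hx
    obtain ⟨C', hC'⟩ := hvH q hq (hd.pot q hq hqp)
    exact ⟨univ, isOpen_univ, mem_univ _, C', fun a ha b hb => hC' a ha.2 b hb.2⟩
  have hvc : ContinuousOn v (ball z0 (R / 4)) := by
    obtain ⟨C', hC'⟩ := hvH q0 hq0 (hd.pot q0 hq0 hq0p)
    refine cont_of_holder (β := 1 - 2 / q0) ?_ hC'
    rw [sub_pos, div_lt_one (by linarith)]; exact hq0
  refine ⟨ball z0 (R / 4), isOpen_ball, mem_ball_self (by linarith), (ball_subset_ball (by linarith)).trans hRΩ, v, ⟨?_, ?_⟩, ?_⟩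
  · intro h
    exact hvH' _ (hpr h) (by rw [ENNReal.ofReal_toReal h])
  · intro h α h0 h1
    have := hvH' (2 / (1 - α)) (by rw [lt_div_iff₀ (by linarith)]; linarith) (by rw [h]; exact le_top)
    have e : 1 - 2 / (2 / (1 - α)) = α := by
      have : 1 - α ≠ 0 := by linarith
      field_simp; ring
    rwa [e] at this
  · have hh := weyl z0 (r := R / 4) (h := fun w => Complex.exp (- v w) * F w) ?_ ?_
    · refine hh.congr fun w hw' => ?_
      rw [hFf w (ball_subset_ball (by linarith) hw')]
    · exact (Complex.continuous_exp.comp_continuousOn hvc.neg).mul hd.cont.continuousOn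
    · intro j φ hφ
      exact twist z0 (r := R / 4) (R := R / 2) (by linarith) hd.cont (hd.int1 j) hu hC
        (fun ψ hψ => hd.weak j ψ (hψ.mono (ball_subset_ball (by linarith)))) (hw j) hv hφ

/-- **Theorem A.** Let `2 < p ≤ ∞` and let `f` be a continuous function on an open
set `Ω ⊆ ℂⁿ`.  Assume there is a constant `M` such that for each `j = 1,…,n` and
every complex line `L` parallel to the `z_j`-axis, condition (L) holds:
`∂̄(f|_L) = A_L f` in the distribution sense on `L ∩ Ω` with `‖A_L‖_{L^p(L∩Ω)} ≤ M`.
Then `f⁻¹(0)` is a complex variety in `Ω`; moreover every point of `Ω` has an open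
neighborhood `U ⊆ Ω` carrying a function `u` of class `C^α_loc` (with `α = 1 − 2/p`
for `2 < p < ∞`, and any `α < 1` for `p = ∞`) such that `e^{−u} f` is holomorphic on `U`. -/
theorem thm_A (n : ℕ) (p : ENNReal) (hp : 2 < p)
    (Ω : Set (Fin n → ℂ)) (hΩ : IsOpen Ω)
    (f : (Fin n → ℂ) → ℂ) (hf : ContinuousOn f Ω)
    (M : ℝ) (hL : ∀ j : Fin n, ∀ c : Fin n → ℂ, CondL n Ω f p M j c) :
    IsComplexVarietyIn n {z ∈ Ω | f z = 0} Ω ∧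
    ∀ z ∈ Ω, ∃ U : Set (Fin n → ℂ), IsOpen U ∧ z ∈ U ∧ U ⊆ Ω ∧
      ∃ u : (Fin n → ℂ) → ℂ,
        ((p ≠ ⊤ → HolderLocOn (1 - 2 / p.toReal) u U) ∧
         (p = ⊤ → ∀ α : ℝ, 0 < α → α < 1 → HolderLocOn α u U)) ∧
        DifferentiableOn ℂ (fun w => Complex.exp (-u w) * f w) U := by
  have h := local_part n p hp Ω hΩ f hf M hL
  refine ⟨?_, h⟩
  intro z hz
  obtain ⟨U, hU, hzU, hUΩ, u, _, hd⟩ := h z hz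
  refine ⟨U, hU, hzU, hUΩ, Unit, fun _ w => Complex.exp (-u w) * f w, fun _ => hd, ?_⟩
  ext w
  simp only [mem_inter_iff, Set.mem_ofPred_eq, mul_eq_zero, Complex.exp_ne_zero, false_or, forall_const]
  exact ⟨fun h => ⟨h.2, h.1.2⟩, fun h => ⟨⟨hUΩ h.1, h.2⟩, h.1⟩⟩

end

end
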